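/- Let N ≥ 5 be an integer and p > 1 a real number. Let H(x) = x⁴ − (32p(p+1)/(p−1)²)x² + (32p(p+1)(p+3)/(p−1)³)x − 64p(p+1)²/(p−1)⁴, and let x₀ be the largest real root of H. If N < 2 + 2x₀, then there exists no classical stable solution of the Navier problem on the half space ℝ^N₊ = {x ∈ ℝ^N : x_N > 0}: there is no function u, of class C⁴ on the closed half space, with u > 0 in ℝ^N₊, Δ(Δu) = u^p in ℝ^N₊, u = Δu = 0 on the boundary {x_N = 0}, and ∫_{ℝ^N₊} |Δφ|² dx ≥ p ∫_{ℝ^N₊} u^{p−1} φ² dx for every φ ∈ C_c^∞(ℝ^N) vanishing on {x_N = 0}. -/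

import Mathlib

open MeasureTheory Real

/-- The Laplacian of a function on `ℝ^N` (sum of pure second derivatives). -/
noncomputable def lap {N : ℕ} (u : EuclideanSpace ℝ (Fin N) → ℝ)
    (x : EuclideanSpace ℝ (Fin N)) : ℝ :=
  ∑ i : Fin N, fderiv ℝ (fun y => fderiv ℝ u y (EuclideanSpace.single i 1)) x
    (EuclideanSpace.single i 1)
/-- The quartic polynomial `H` from Theorem 1.1. -/
noncomputable def Hpoly (p x : ℝ) : ℝ :=
  x ^ 4 - 32 * p * (p + 1) / (p - 1) ^ 2 * x ^ 2
    + 32 * p * (p + 1) * (p + 3) / (p - 1) ^ 3 * x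
    - 64 * p * (p + 1) ^ 2 / (p - 1) ^ 4

namespace HalfSpace

open Set Filter Topology SchwartzMap

variable {N : ℕ}

/-- Euclidean space of dimension `N`. -/
abbrev Eu (N : ℕ) := EuclideanSpace ℝ (Fin N)

/-- The `i`-th partial derivative. -/
noncomputable def pd (i : Fin N) (f : Eu N → ℝ) (x : Eu N) : ℝ :=
  fderiv ℝ f x (EuclideanSpace.single i 1)

/-- The open half space on which the `n`-th coordinate is positive. -/
def hs (n : Fin N) : Set (Eu N) := {y | 0 < y n}

/-- The closed half space on which the `n`-th coordinate is nonnegative. -/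
def chs (n : Fin N) : Set (Eu N) := {y | 0 ≤ y n}

theorem mem_hs {n : Fin N} {x : Eu N} : x ∈ hs n ↔ 0 < x n := Iff.rfl

theorem lap_eq_sum_pd (f : Eu N → ℝ) (x : Eu N) : lap f x = ∑ i, pd i (pd i f) x := rfl

theorem isOpen_hs (n : Fin N) : IsOpen (hs n) :=
  isOpen_lt continuous_const (by fun_prop)

theorem isClosed_chs (n : Fin N) : IsClosed (chs n) :=
  isClosed_le continuous_const (by fun_prop)

theorem hs_subset_chs (n : Fin N) : hs n ⊆ chs n := fun x hx => le_of_lt (show 0 < x n from hx)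

theorem contDiff_pd {f : Eu N → ℝ} {k m : WithTop ℕ∞} (hf : ContDiff ℝ k f) (hkm : m + 1 ≤ k)
    (i : Fin N) : ContDiff ℝ m (pd i f) :=
  (hf.fderiv_right hkm).clm_apply contDiff_const

theorem hasDerivAt_line_of_hasFDerivAt {f : Eu N → ℝ} {x : Eu N} (hf : DifferentiableAt ℝ f x)
    (i : Fin N) :
    HasDerivAt (fun t : ℝ => f (x + t • EuclideanSpace.single i (1 : ℝ))) (pd i f x) 0 := by
  exact hf.hasFDerivAt.hasLineDerivAt (EuclideanSpace.single i 1)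

theorem pd_eq_of_hasDerivAt {f : Eu N → ℝ} {x : Eu N} (hf : DifferentiableAt ℝ f x)
    {i : Fin N} {c : ℝ}
    (h : HasDerivAt (fun t : ℝ => f (x + t • EuclideanSpace.single i (1 : ℝ))) c 0) :
    pd i f x = c :=
  (hasDerivAt_line_of_hasFDerivAt hf i).unique h

theorem pd_congr {f g : Eu N → ℝ} {x : Eu N} (h : f =ᶠ[𝓝 x] g) (i : Fin N) :
    pd i f x = pd i g x := by
  unfold pd; rw [h.fderiv_eq]

theorem pd_congr_eventually {f g : Eu N → ℝ} {x : Eu N} (h : f =ᶠ[𝓝 x] g) (i : Fin N) :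
    pd i f =ᶠ[𝓝 x] pd i g :=
  h.eventuallyEq_nhds.mono fun _ hy => pd_congr hy i

theorem lap_congr {f g : Eu N → ℝ} {x : Eu N} (h : f =ᶠ[𝓝 x] g) : lap f x = lap g x := by
  simp only [lap_eq_sum_pd]
  exact Finset.sum_congr rfl fun i _ => pd_congr (pd_congr_eventually h i) i

theorem pd_mul {f g : Eu N → ℝ} {x : Eu N} (hf : DifferentiableAt ℝ f x)
    (hg : DifferentiableAt ℝ g x) (i : Fin N) :
    pd i (fun y => f y * g y) x = pd i f x * g x + f x * pd i g x := by
  unfold pd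
  rw [fderiv_fun_mul hf hg]
  simp; ring

theorem pd_add {f g : Eu N → ℝ} {x : Eu N} (hf : DifferentiableAt ℝ f x)
    (hg : DifferentiableAt ℝ g x) (i : Fin N) :
    pd i (fun y => f y + g y) x = pd i f x + pd i g x := by
  unfold pd
  rw [fderiv_fun_add hf hg]
  simp

theorem pd_const (c : ℝ) (i : Fin N) (x : Eu N) : pd i (fun _ => c) x = 0 := by
  simp [pd]

theorem pd_const_mul {f : Eu N → ℝ} {x : Eu N} (c : ℝ) (i : Fin N) :
    pd i (fun y => c * f y) x = c * pd i f x := by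
  unfold pd
  rw [show (fun y => c * f y) = c • f from rfl, fderiv_const_smul_field]
  simp

theorem pd_neg {f : Eu N → ℝ} {x : Eu N} (i : Fin N) :
    pd i (fun y => - f y) x = - pd i f x := by
  simpa using pd_const_mul (f := f) (x := x) (-1) i

theorem pd_sub {f g : Eu N → ℝ} {x : Eu N} (hf : DifferentiableAt ℝ f x)
    (hg : DifferentiableAt ℝ g x) (i : Fin N) :
    pd i (fun y => f y - g y) x = pd i f x - pd i g x := by
  unfold pd
  rw [fderiv_fun_sub hf hg]
  simp

theorem pd_comp {f : Eu N → ℝ} {γ : ℝ → ℝ} {γ' : ℝ} {x : Eu N} (hf : DifferentiableAt ℝ f x)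
    (hγ : HasDerivAt γ γ' (f x)) (i : Fin N) :
    pd i (fun y => γ (f y)) x = γ' * pd i f x := by
  unfold pd
  rw [show (fun y => γ (f y)) = γ ∘ f from rfl, (hγ.comp_hasFDerivAt x hf.hasFDerivAt).fderiv]
  simp

theorem lap_mul {f g : Eu N → ℝ} {x : Eu N} (hf : ContDiffAt ℝ 2 f x) (hg : ContDiffAt ℝ 2 g x) :
    lap (fun y => f y * g y) x
      = lap f x * g x + 2 * ∑ i, pd i f x * pd i g x + f x * lap g x := by
  have hd : ∀ {h : Eu N → ℝ}, ContDiffAt ℝ 2 h x → ∀ᶠ y in 𝓝 x, DifferentiableAt ℝ h y := by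
    intro h hh
    filter_upwards [hh.eventually (by simp)] with y hy
    exact hy.differentiableAt (by simp)
  have hd2 : ∀ {h : Eu N → ℝ}, ContDiffAt ℝ 2 h x → ∀ i, DifferentiableAt ℝ (pd i h) x := by
    intro h hh i
    have : ContDiffAt ℝ 1 (fderiv ℝ h) x := hh.fderiv_right (by norm_num)
    exact (this.differentiableAt (by simp)).clm_apply (by fun_prop)
  have h1 : ∀ i, pd i (fun y => f y * g y) =ᶠ[𝓝 x]
      fun y => pd i f y * g y + f y * pd i g y := by
    intro i
    filter_upwards [hd hf, hd hg] with y h1 h2 using pd_mul h1 h2 i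
  simp only [lap_eq_sum_pd]
  have hf1 := (hd hf).self_of_nhds
  have hg1 := (hd hg).self_of_nhds
  have : ∀ i, pd i (pd i fun y => f y * g y) x = pd i (pd i f) x * g x
      + 2 * (pd i f x * pd i g x) + f x * pd i (pd i g) x := by
    intro i
    have h2 := pd_add ((hd2 hf i).mul hg1) (hf1.mul (hd2 hg i)) i
    simp only [Pi.mul_apply] at h2
    have h3 := pd_mul (hd2 hf i) hg1 i
    have h4 := pd_mul hf1 (hd2 hg i) i
    rw [pd_congr (h1 i), h2]
    linear_combination h3 + h4
  simp only [this, Finset.sum_add_distrib, Finset.sum_mul, Finset.mul_sum]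

/-- A continuous bounded function with bounded support on the half space. -/
structure Nice (n : Fin N) (f : Eu N → ℝ) : Prop where
  cont : ContinuousOn f (hs n)
  bdd : ∃ C, ∀ x ∈ hs n, |f x| ≤ C
  supp : ∃ R, ∀ x ∈ hs n, R ≤ ‖x‖ → f x = 0

theorem Nice.integrableOn {n : Fin N} {f : Eu N → ℝ} (h : Nice n f) : IntegrableOn f (hs n) := by
  obtain ⟨C, hC⟩ := h.bdd
  obtain ⟨R, hR⟩ := h.supp
  have hm := (isOpen_hs n).measurableSet
  have h1 : IntegrableOn f (hs n ∩ Metric.closedBall 0 R) := by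
    refine IntegrableOn.of_bound (C := C) ?_ ?_ ?_
    · exact (measure_mono inter_subset_right).trans_lt measure_closedBall_lt_top
    · exact (h.cont.mono inter_subset_left).aestronglyMeasurable
        (hm.inter Metric.isClosed_closedBall.measurableSet)
    · refine (ae_restrict_mem (hm.inter Metric.isClosed_closedBall.measurableSet)).mono ?_
      intro x hx
      exact hC x hx.1
  refine h1.of_forall_sdiff_eq_zero hm ?_
  intro x hx
  refine hR x hx.1 ?_
  by_contra hlt
  exact hx.2 ⟨hx.1, by simpa using (not_le.mp hlt).le⟩

theorem nice_of_continuousOn {n : Fin N} {f : Eu N → ℝ} (h : ContinuousOn f (chs n)) {R : ℝ}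
    (hR : ∀ x ∈ hs n, R ≤ ‖x‖ → f x = 0) : Nice n f := by
  refine ⟨h.mono (hs_subset_chs n), ?_, R, hR⟩
  have hK : IsCompact (chs n ∩ Metric.closedBall 0 R) :=
    (isCompact_closedBall _ _).inter_left (isClosed_chs n)
  obtain ⟨C, hC⟩ := hK.exists_bound_of_continuousOn (h.mono inter_subset_left)
  refine ⟨max C 0, fun x hx => ?_⟩
  by_cases hxR : R ≤ ‖x‖
  · rw [hR x hx hxR]; simp
  · exact (hC x ⟨hs_subset_chs n hx, by simpa using (not_le.mp hxR).le⟩).trans (le_max_left _ _)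

theorem Nice.add {n : Fin N} {f g : Eu N → ℝ} (hf : Nice n f) (hg : Nice n g) :
    Nice n (fun x => f x + g x) := by
  obtain ⟨C, hC⟩ := hf.bdd
  obtain ⟨C', hC'⟩ := hg.bdd
  obtain ⟨R, hR⟩ := hf.supp
  obtain ⟨R', hR'⟩ := hg.supp
  refine ⟨hf.cont.add hg.cont, ⟨C + C', fun x hx => ?_⟩, ⟨max R R', fun x hx h => ?_⟩⟩
  · exact (abs_add_le _ _).trans (add_le_add (hC x hx) (hC' x hx))
  · rw [hR x hx ((le_max_left _ _).trans h), hR' x hx ((le_max_right _ _).trans h), add_zero]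

theorem Nice.const_mul {n : Fin N} {f : Eu N → ℝ} (hf : Nice n f) (c : ℝ) :
    Nice n (fun x => c * f x) := by
  obtain ⟨C, hC⟩ := hf.bdd
  obtain ⟨R, hR⟩ := hf.supp
  refine ⟨continuousOn_const.mul hf.cont, ⟨|c| * C, fun x hx => ?_⟩, ⟨R, fun x hx h => ?_⟩⟩
  · rw [abs_mul]; exact mul_le_mul_of_nonneg_left (hC x hx) (abs_nonneg _)
  · rw [hR x hx h, mul_zero]

theorem Nice.sum {n : Fin N} {ι : Type*} {s : Finset ι} {f : ι → Eu N → ℝ}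
    (hf : ∀ i ∈ s, Nice n (f i)) : Nice n (fun x => ∑ i ∈ s, f i x) := by
  classical
  induction s using Finset.induction_on with
  | empty => exact ⟨by simpa using continuousOn_const, ⟨0, by simp⟩, ⟨0, by simp⟩⟩
  | insert a s ha ih =>
    simp only [Finset.sum_insert ha]
    exact (hf a (by simp)).add (ih fun i hi => hf i (by simp [hi]))

/-- Integration over the half space of a partial derivative of a function vanishing on the
boundary. -/
theorem integral_pd_eq_zero {n : Fin N} (i : Fin N) {F F' : Eu N → ℝ}
    (hF : ContinuousOn F (chs n)) (hF0 : ∀ x : Eu N, x n = 0 → F x = 0) {R : ℝ}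
    (hR : ∀ x ∈ hs n, R ≤ ‖x‖ → F x = 0)
    (hd : ∀ x ∈ hs n,
      HasDerivAt (fun t : ℝ => F (x + t • EuclideanSpace.single i (1 : ℝ))) (F' x) 0)
    (hF' : ∃ C, ∀ x ∈ hs n, |F' x| ≤ C) :
    ∫ x in hs n, F' x = 0 := by
  set e : Eu N := EuclideanSpace.single i (1 : ℝ) with he
  have hen : ‖e‖ = 1 := by simp [he]
  obtain ⟨C, hC⟩ := hF'
  have hC0 : ∀ x ∈ hs n, 0 ≤ C := fun x hx => (abs_nonneg _).trans (hC x hx)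
  have hm := (isOpen_hs n).measurableSet
  set G : Eu N → ℝ := (hs n).indicator F with hG
  have hGint : Integrable G :=
    (integrable_indicator_iff hm).mpr (nice_of_continuousOn hF hR).integrableOn
  have hline : ∀ (x : Eu N) (t : ℝ), x + t • e ∈ hs n →
      HasDerivAt (fun t : ℝ => F (x + t • e)) (F' (x + t • e)) t := by
    intro x t ht
    have h1 := hd _ ht
    have h2 : HasDerivAt (fun s : ℝ => F (x + t • e + (s - t) • e)) (F' (x + t • e)) t := by
      have h3 : HasDerivAt (fun s : ℝ => s - t) 1 t := (hasDerivAt_id t).sub_const t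
      have := HasDerivAt.comp t (h₂ := fun s : ℝ => F (x + t • e + s • e)) (h := fun s => s - t)
        (by simpa using h1) h3
      simpa [Function.comp_def] using this
    refine h2.congr_of_eventuallyEq (Eventually.of_forall fun s => ?_)
    simp only
    congr 1
    rw [add_assoc, ← add_smul]; congr 2; ring
  have hcoord : ∀ (x : Eu N) (t : ℝ), (x + t • e) n = x n + t * e n := by
    intro x t; simp
  have hen0 : 0 ≤ e n := by
    rw [he]; simp only [PiLp.single_apply]; split_ifs <;> norm_num
  -- Lipschitz bound along segments
  have hlip : ∀ x ∈ hs n, ∀ h : ℝ, 0 < h → x - h • e ∈ chs n →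
      |F x - F (x - h • e)| ≤ C * h := by
    intro x hx h hh hxh
    have hxh' : ∀ t ∈ Icc 0 h, x - h • e + t • e ∈ chs n := by
      intro t ht
      have : 0 ≤ (x - h • e) n := hxh
      change 0 ≤ (x - h • e + t • e) n
      rw [hcoord]; have := mul_nonneg ht.1 hen0; linarith
    have hin : ∀ t ∈ Ioo 0 h, x - h • e + t • e ∈ hs n := by
      intro t ht
      have h1 : 0 ≤ (x - h • e) n := hxh
      have h2 : 0 < x n := hx
      have h3 : (x - h • e) n = x n - h * e n := by simp
      change 0 < (x - h • e + t • e) n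
      rw [hcoord]
      rcases hen0.eq_or_lt with h0 | h0
      · rw [← h0] at h3 ⊢; linarith
      · have := mul_pos ht.1 h0; linarith
    obtain ⟨c, hc, hceq⟩ := exists_hasDerivAt_eq_slope (fun t : ℝ => F (x - h • e + t • e))
      (fun t => F' (x - h • e + t • e)) hh
      (hF.comp (by fun_prop) hxh') (fun t ht => hline _ t (hin t ht))
    have h5 := hC _ (hin c hc)
    rw [hceq] at h5
    simp only [sub_add_cancel, zero_smul, add_zero, sub_zero, abs_div, abs_of_pos hh] at h5
    rwa [div_le_iff₀ hh] at h5
  set q : ℕ → Eu N → ℝ := fun k x => (k + 1 : ℝ) * (G x - G (x - (1 / (k + 1 : ℝ)) • e)) with hq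
  have hqint : ∀ k, ∫ x, q k x = 0 := by
    intro k
    simp only [hq]
    rw [integral_const_mul, integral_sub hGint (hGint.comp_sub_right _),
      integral_sub_right_eq_self G, sub_self, mul_zero]
  have hlim : ∀ x, Tendsto (fun k => q k x) atTop (𝓝 ((hs n).indicator F' x)) := by
    intro x
    by_cases hx : x ∈ hs n
    · rw [indicator_of_mem hx]
      have h1 : HasDerivAt (fun t : ℝ => G (x + t • e)) (F' x) 0 := by
        refine (hd x hx).congr_of_eventuallyEq ?_
        have : ∀ᶠ t : ℝ in 𝓝 0, x + t • e ∈ hs n := by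
          have hc : ContinuousAt (fun t : ℝ => x + t • e) 0 := by fun_prop
          exact hc ((isOpen_hs n).mem_nhds (by simpa using hx))
        filter_upwards [this] with t ht
        rw [hG, indicator_of_mem ht]
      have h2 := h1.tendsto_slope_zero
      have h3 : Tendsto (fun k : ℕ => -(1 / ((k : ℝ) + 1))) atTop (𝓝[≠] 0) := by
        refine tendsto_nhdsWithin_iff.mpr ⟨?_, Eventually.of_forall fun k => ?_⟩
        · simpa using (tendsto_one_div_add_atTop_nhds_zero_nat (𝕜 := ℝ)).neg
        · have : (0 : ℝ) < 1 / ((k : ℝ) + 1) := by positivity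
          simp only [mem_compl_iff, mem_singleton_iff]; linarith
      refine (h2.comp h3).congr fun k => ?_
      simp only [Function.comp, hq, zero_add, zero_smul, add_zero, neg_smul, smul_eq_mul]
      rw [← sub_eq_add_neg]
      field_simp
      ring
    · rw [indicator_of_notMem hx]
      refine tendsto_const_nhds.congr fun k => ?_
      have : x - (1 / (k + 1 : ℝ)) • e ∉ hs n := by
        intro hmem
        have h1 : 0 < (x - (1 / (k + 1 : ℝ)) • e) n := hmem
        have h2 : (x - (1 / (k + 1 : ℝ)) • e) n = x n - (1 / (k + 1 : ℝ)) * e n := by simp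
        have h3 : 0 ≤ (1 / (k + 1 : ℝ)) * e n := mul_nonneg (by positivity) hen0
        exact hx (show 0 < x n by linarith)
      simp only [hq, hG, indicator_of_notMem hx, indicator_of_notMem this, sub_zero, mul_zero]
  have hbound : ∀ k x, ‖q k x‖ ≤ (Metric.closedBall (0 : Eu N) (R + 1)).indicator
      (fun _ => |C|) x := by
    intro k x
    have hk : (0 : ℝ) < k + 1 := by positivity
    have hk1 : (1 : ℝ) / (k + 1) ≤ 1 := by
      rw [div_le_one hk]; linarith [(Nat.cast_nonneg k : (0 : ℝ) ≤ k)]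
    by_cases hx : x ∈ hs n
    · by_cases hxR : ‖x‖ ≤ R + 1
      · rw [indicator_of_mem (by simpa using hxR)]
        have key : |G x - G (x - (1 / (k + 1 : ℝ)) • e)| ≤ C * (1 / (k + 1)) := by
          by_cases hy : x - (1 / (k + 1 : ℝ)) • e ∈ hs n
          · rw [hG, indicator_of_mem hx, indicator_of_mem hy]
            exact hlip x hx _ (by positivity) (hs_subset_chs n hy)
          · rw [hG, indicator_of_mem hx, indicator_of_notMem hy]
            have h1 : ¬ 0 < (x - (1 / (k + 1 : ℝ)) • e) n := hy
            have h2 : (x - (1 / (k + 1 : ℝ)) • e) n = x n - (1 / (k + 1 : ℝ)) * e n := by simp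
            have h0 : 0 < x n := hx
            have hin : i = n := by
              by_contra hne
              have : e n = 0 := by
                rw [he]; simp only [PiLp.single_apply]; rw [if_neg (Ne.symm hne)]
              rw [h2, this] at h1; simp at h1; linarith
            have he1 : e n = 1 := by rw [he, hin]; simp
            rw [he1] at h2
            have h3 : (x - (x n) • e) n = 0 := by simp [he1]
            have h4 := hlip x hx (x n) h0 (show 0 ≤ (x - (x n) • e) n by rw [h3])
            rw [hF0 _ h3] at h4
            refine h4.trans ?_
            have := hC0 x hx
            exact mul_le_mul_of_nonneg_left (by linarith) this
        simp only [hq]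
        rw [norm_mul, Real.norm_eq_abs, Real.norm_eq_abs, abs_of_pos hk]
        calc (k + 1 : ℝ) * _ ≤ (k + 1) * (C * (1 / (k + 1))) := by gcongr
          _ = C := by field_simp
          _ ≤ |C| := le_abs_self C
      · rw [indicator_of_notMem (by simpa using hxR)]
        have h1 : G x = 0 := by
          rw [hG, indicator_of_mem hx]; exact hR x hx (by linarith)
        have h2 : G (x - (1 / (k + 1 : ℝ)) • e) = 0 := by
          by_cases hy : x - (1 / (k + 1 : ℝ)) • e ∈ hs n
          · rw [hG, indicator_of_mem hy]
            refine hR _ hy ?_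
            have h5 := norm_sub_norm_le x ((1 / (k + 1 : ℝ)) • e)
            have h6 : ‖(1 / (k + 1 : ℝ)) • e‖ ≤ 1 := by
              rw [norm_smul, hen, mul_one, Real.norm_eq_abs, abs_of_pos (by positivity)]; exact hk1
            linarith
          · rw [hG, indicator_of_notMem hy]
        simp only [hq, h1, h2, sub_zero, mul_zero, norm_zero, le_refl]
    · have : x - (1 / (k + 1 : ℝ)) • e ∉ hs n := by
        intro hmem
        have h1 : 0 < (x - (1 / (k + 1 : ℝ)) • e) n := hmem
        have h2 : (x - (1 / (k + 1 : ℝ)) • e) n = x n - (1 / (k + 1 : ℝ)) * e n := by simp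
        have h3 : 0 ≤ (1 / (k + 1 : ℝ)) * e n := mul_nonneg (by positivity) hen0
        exact hx (show 0 < x n by linarith)
      simp only [hq, hG, indicator_of_notMem hx, indicator_of_notMem this]
      simp only [sub_zero, mul_zero, norm_zero]
      exact indicator_nonneg (fun _ _ => abs_nonneg _) _
  have hfin : Tendsto (fun k => ∫ x, q k x) atTop (𝓝 (∫ x, (hs n).indicator F' x)) := by
    refine tendsto_integral_of_dominated_convergence _ (fun k => ?_) ?_
      (fun k => Eventually.of_forall (hbound k)) (Eventually.of_forall hlim)
    · exact ((hGint.sub (hGint.comp_sub_right _)).const_mul _).aestronglyMeasurable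
    · exact (integrable_indicator_iff Metric.isClosed_closedBall.measurableSet).mpr
        (integrableOn_const measure_closedBall_lt_top.ne)
  rw [← integral_indicator hm]
  simp only [hqint] at hfin
  exact (tendsto_nhds_unique hfin tendsto_const_nhds)

/-- A smooth radial cutoff at scale `R`. -/
noncomputable def cut (R : ℝ) (x : Eu N) : ℝ :=
  Real.smoothTransition ((3 - ‖R⁻¹ • x‖ ^ 2) / 2)

theorem cut_nonneg (R : ℝ) (x : Eu N) : 0 ≤ cut R x := Real.smoothTransition.nonneg _

theorem cut_le_one (R : ℝ) (x : Eu N) : cut R x ≤ 1 := Real.smoothTransition.le_one _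

theorem contDiff_cut (R : ℝ) : ContDiff ℝ (⊤ : ℕ∞) (cut R : Eu N → ℝ) := by
  have h : ContDiff ℝ (⊤ : ℕ∞) (fun x : Eu N => (3 - ‖R⁻¹ • x‖ ^ 2) / 2) :=
    (contDiff_const.sub ((contDiff_norm_sq ℝ).comp (contDiff_const_smul R⁻¹))).div_const _
  exact Real.smoothTransition.contDiff.comp h

theorem cut_eq_one {R : ℝ} (hR : 0 < R) {x : Eu N} (hx : ‖x‖ ≤ R) : cut R x = 1 := by
  apply Real.smoothTransition.one_of_one_le
  have : ‖R⁻¹ • x‖ ≤ 1 := by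
    rw [norm_smul, norm_inv, Real.norm_eq_abs, abs_of_pos hR, inv_mul_le_iff₀ hR]; linarith
  have h0 := norm_nonneg (R⁻¹ • x)
  nlinarith

theorem cut_eq_zero_aux {R : ℝ} (hR : 0 < R) {x : Eu N} (hx : 7 / 4 * R ≤ ‖x‖) :
    cut R x = 0 := by
  apply Real.smoothTransition.zero_of_nonpos
  have : 7 / 4 ≤ ‖R⁻¹ • x‖ := by
    rw [norm_smul, norm_inv, Real.norm_eq_abs, abs_of_pos hR, ← div_eq_inv_mul, le_div_iff₀ hR]
    exact hx
  nlinarith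

theorem cut_eq_zero {R : ℝ} (hR : 0 < R) {x : Eu N} (hx : 2 * R ≤ ‖x‖) : cut R x = 0 :=
  cut_eq_zero_aux hR (by linarith)

theorem cut_eventually_zero {R : ℝ} (hR : 0 < R) {x : Eu N} (hx : 2 * R ≤ ‖x‖) :
    cut R =ᶠ[𝓝 x] fun _ => 0 := by
  have : ∀ᶠ y : Eu N in 𝓝 x, 7 / 4 * R < ‖y‖ :=
    continuous_norm.continuousAt.eventually (lt_mem_nhds (by linarith))
  filter_upwards [this] with y hy using cut_eq_zero_aux hR hy.le

theorem pd_cut_eq_zero {R : ℝ} (hR : 0 < R) {x : Eu N} (hx : 2 * R ≤ ‖x‖) (i : Fin N) :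
    pd i (cut R) x = 0 := by
  rw [pd_congr (cut_eventually_zero hR hx), pd_const]

theorem pd_pd_cut_eq_zero {R : ℝ} (hR : 0 < R) {x : Eu N} (hx : 2 * R ≤ ‖x‖) (i j : Fin N) :
    pd j (pd i (cut R)) x = 0 := by
  rw [pd_congr (pd_congr_eventually (cut_eventually_zero hR hx) i)]
  have : pd i (fun _ : Eu N => (0 : ℝ)) = fun _ => 0 := by
    funext y; exact pd_const 0 i y
  rw [this, pd_const]

theorem pd_comp_smul (f : Eu N → ℝ) (c : ℝ) (i : Fin N) (x : Eu N) :
    pd i (fun y => f (c • y)) x = c * pd i f (c • x) := by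
  unfold pd
  rw [fderiv_comp_smul]
  simp

theorem cut_eq_comp (R : ℝ) : (cut R : Eu N → ℝ) = fun x => cut 1 (R⁻¹ • x) := by
  funext x; simp [cut]

theorem hasCompactSupport_cut {R : ℝ} (hR : 0 < R) : HasCompactSupport (cut R : Eu N → ℝ) := by
  refine HasCompactSupport.intro (isCompact_closedBall 0 (2 * R)) fun x hx => ?_
  refine cut_eq_zero hR ?_
  have : ¬ ‖x‖ ≤ 2 * R := by simpa using hx
  linarith

theorem contDiff_pd_top {f : Eu N → ℝ} (hf : ContDiff ℝ (⊤ : ℕ∞) f) (i : Fin N) :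
    ContDiff ℝ (⊤ : ℕ∞) (pd i f) := contDiff_pd hf (by simp) i

theorem exists_cut_bound : ∃ C : ℝ, 0 < C ∧ ∀ R : ℝ, 0 < R → ∀ x : Eu N, ∀ i j : Fin N,
    |pd i (cut R) x| ≤ C / R ∧ |pd j (pd i (cut R)) x| ≤ C / R ^ 2 := by
  have hz : ∀ f : Eu N → ℝ, Continuous f → (∀ x : Eu N, 2 ≤ ‖x‖ → f x = 0) →
      ∃ C, ∀ x, |f x| ≤ C := by
    intro f hf h0
    obtain ⟨C, hC⟩ := hf.bounded_above_of_compact_support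
      (HasCompactSupport.intro (isCompact_closedBall (0 : Eu N) 2) fun x hx => h0 x (by
        have : ¬ ‖x‖ ≤ 2 := by simpa using hx
        linarith))
    exact ⟨C, hC⟩
  have h1 : ∀ i : Fin N, ∃ C, ∀ x : Eu N, |pd i (cut 1) x| ≤ C := fun i =>
    hz _ (contDiff_pd_top (contDiff_cut 1) i).continuous
      fun x hx => pd_cut_eq_zero one_pos (by linarith) i
  have h2 : ∀ i j : Fin N, ∃ C, ∀ x : Eu N, |pd j (pd i (cut 1)) x| ≤ C := fun i j =>
    hz _ (contDiff_pd_top (contDiff_pd_top (contDiff_cut 1) i) j).continuous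
      fun x hx => pd_pd_cut_eq_zero one_pos (by linarith) i j
  choose A hA using h1
  choose B hB using h2
  have hA0 : ∀ i, 0 ≤ A i := fun i => (abs_nonneg _).trans (hA i 0)
  have hB0 : ∀ i j, 0 ≤ B i j := fun i j => (abs_nonneg _).trans (hB i j 0)
  refine ⟨∑ i, A i + ∑ i, ∑ j, B i j + 1, ?_, fun R hR x i j => ?_⟩
  · have := Finset.sum_nonneg fun i (_ : i ∈ Finset.univ) => hA0 i
    have := Finset.sum_nonneg fun i (_ : i ∈ Finset.univ) =>
      Finset.sum_nonneg fun j (_ : j ∈ Finset.univ) => hB0 i j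
    linarith
  have hAle : A i ≤ ∑ i, A i := Finset.single_le_sum (fun i _ => hA0 i) (Finset.mem_univ i)
  have hBle : B i j ≤ ∑ i, ∑ j, B i j :=
    (Finset.single_le_sum (fun j _ => hB0 i j) (Finset.mem_univ j)).trans
      (Finset.single_le_sum (f := fun i => ∑ j, B i j)
        (fun i _ => Finset.sum_nonneg fun j _ => hB0 i j) (Finset.mem_univ i))
  have hAs : 0 ≤ ∑ i, A i := Finset.sum_nonneg fun i _ => hA0 i
  have hBs : 0 ≤ ∑ i, ∑ j, B i j :=
    Finset.sum_nonneg fun i _ => Finset.sum_nonneg fun j _ => hB0 i j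
  have e1 : ∀ i, pd i (cut R) = fun x : Eu N => R⁻¹ * pd i (cut 1) (R⁻¹ • x) := by
    intro i; funext x; rw [cut_eq_comp R, pd_comp_smul]
  constructor
  · rw [e1, abs_mul, abs_of_pos (inv_pos.mpr hR), div_eq_inv_mul]
    have := hA i (R⁻¹ • x)
    gcongr; linarith
  · rw [e1, pd_const_mul, pd_comp_smul, abs_mul, abs_mul, abs_of_pos (inv_pos.mpr hR),
      ← mul_assoc, div_eq_inv_mul, show (R ^ 2)⁻¹ = R⁻¹ * R⁻¹ by ring]
    have := hB i j (R⁻¹ • x)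
    gcongr; linarith

/-- Mollification with a normalised bump. -/
noncomputable def moll (b : ContDiffBump (0 : Eu N)) (f : Eu N → ℝ) : Eu N → ℝ :=
  convolution (b.normed volume) f (ContinuousLinearMap.lsmul ℝ ℝ) volume

theorem contDiff_moll (b : ContDiffBump (0 : Eu N)) {f : Eu N → ℝ} (hf : Continuous f) :
    ContDiff ℝ (⊤ : ℕ∞) (moll b f) :=
  HasCompactSupport.contDiff_convolution_left _ b.hasCompactSupport_normed b.contDiff_normed
    hf.locallyIntegrable

theorem pd_moll (b : ContDiffBump (0 : Eu N)) {f : Eu N → ℝ} (hf : ContDiff ℝ 1 f)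
    (hc : HasCompactSupport f) (i : Fin N) : pd i (moll b f) = moll b (pd i f) := by
  funext x
  have h := hc.hasFDerivAt_convolution_right (ContinuousLinearMap.lsmul ℝ ℝ) (μ := volume)
    (f := b.normed volume) b.continuous_normed.locallyIntegrable hf x
  unfold pd moll
  rw [h.fderiv, convolution_precompR_apply _ b.continuous_normed.locallyIntegrable
    (hc.fderiv ℝ) (hf.continuous_fderiv one_ne_zero)]

theorem moll_dist_le (b : ContDiffBump (0 : Eu N)) {f : Eu N → ℝ} (hf : Continuous f) {ε : ℝ}
    {x : Eu N} (h : ∀ y, dist y x < b.rOut → |f y - f x| ≤ ε) : |moll b f x - f x| ≤ ε := by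
  have := ContDiffBump.dist_normed_convolution_le (φ := b) (μ := volume) (g := f) (x₀ := x)
    (ε := ε) hf.aestronglyMeasurable (fun y hy => h y hy)
  exact this

theorem hasCompactSupport_pd {f : Eu N → ℝ} (hc : HasCompactSupport f) (i : Fin N) :
    HasCompactSupport (pd i f) :=
  (hc.fderiv ℝ).comp_left (g := fun L : Eu N →L[ℝ] ℝ => L (EuclideanSpace.single i 1)) (by simp)

theorem exists_bump_radius {f : Eu N → ℝ} (hf : Continuous f) (hc : HasCompactSupport f) {ε : ℝ}
    (hε : 0 < ε) : ∃ δ > 0, ∀ b : ContDiffBump (0 : Eu N), b.rOut ≤ δ →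
      ∀ x, |moll b f x - f x| ≤ ε := by
  obtain ⟨δ, hδ, h⟩ := Metric.uniformContinuous_iff.mp
    (hc.uniformContinuous_of_continuous hf) ε hε
  refine ⟨δ, hδ, fun b hb x => moll_dist_le b hf fun y hy => ?_⟩
  exact (h (hy.trans_le hb)).le

theorem moll_eq_zero (b : ContDiffBump (0 : Eu N)) {f : Eu N → ℝ} (hf : Continuous f) {x : Eu N}
    (h : ∀ y, dist y x < b.rOut → f y = 0) : moll b f x = 0 := by
  have hx : f x = 0 := h x (by simpa using b.rOut_pos)
  have := moll_dist_le b hf (ε := 0) (x := x) (fun y hy => by simp [h y hy, hx])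
  rw [hx, sub_zero] at this
  exact abs_nonpos_iff.mp this

theorem exists_radius_finset {f : Fin N → Eu N → ℝ} (hf : ∀ i, Continuous (f i))
    (hc : ∀ i, HasCompactSupport (f i)) {ε : ℝ} (hε : 0 < ε) :
    ∃ δ > 0, ∀ b : ContDiffBump (0 : Eu N), b.rOut ≤ δ →
      ∀ i x, |moll b (f i) x - f i x| ≤ ε := by
  have := fun i => exists_bump_radius (hf i) (hc i) hε
  choose d hd h using this
  have : ∃ δ > 0, ∀ i, δ ≤ d i := by
    rcases isEmpty_or_nonempty (Fin N) with hN | hN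
    · exact ⟨1, one_pos, fun i => hN.elim i⟩
    · obtain ⟨i, hi⟩ := Finite.exists_min d
      exact ⟨d i, hd i, hi⟩
  obtain ⟨δ, hδ, hδi⟩ := this
  exact ⟨δ, hδ, fun b hb i x => h i b (hb.trans (hδi i)) x⟩

/-- A bump function of outer radius `δ`. -/
noncomputable def bumpOf {δ : ℝ} (hδ : 0 < δ) : ContDiffBump (0 : Eu N) :=
  ⟨δ / 2, δ, by linarith, by linarith⟩

/-- Smooth approximation in `C¹`. -/
theorem exists_smooth_approx_one {f : Eu N → ℝ} (hf : ContDiff ℝ 1 f) (hc : HasCompactSupport f)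
    {ε : ℝ} (hε : 0 < ε) :
    ∃ g : Eu N → ℝ, ContDiff ℝ (⊤ : ℕ∞) g ∧ (∀ x, |g x - f x| ≤ ε) ∧
      (∀ i x, |pd i g x - pd i f x| ≤ ε) ∧
      ∀ x, (∀ y, dist y x < ε → f y = 0) → g x = 0 := by
  obtain ⟨δ, hδ, h⟩ := exists_bump_radius hf.continuous hc hε
  obtain ⟨δ', hδ', h'⟩ := exists_radius_finset (fun i => (contDiff_pd (m := 0) hf (by simp) i).continuous)
    (fun i => hasCompactSupport_pd hc i) hε
  have hm : 0 < min ε (min δ δ') := lt_min hε (lt_min hδ hδ')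
  have h1 : (bumpOf hm : ContDiffBump (0 : Eu N)).rOut = min ε (min δ δ') := rfl
  refine ⟨moll (bumpOf hm) f, contDiff_moll _ hf.continuous, fun x => h _ ?_ x, fun i x => ?_, ?_⟩
  · rw [h1]; exact (min_le_right _ _).trans (min_le_left _ _)
  · rw [pd_moll _ hf hc]
    exact h' _ ((min_le_right _ _).trans (min_le_right _ _)) i x
  · intro x hx
    exact moll_eq_zero _ hf.continuous fun y hy => hx y (hy.trans_le (min_le_left _ _))

/-- Smooth approximation in `C²`. -/
theorem exists_smooth_approx_two {f : Eu N → ℝ} (hf : ContDiff ℝ 2 f) (hc : HasCompactSupport f)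
    {ε : ℝ} (hε : 0 < ε) :
    ∃ g : Eu N → ℝ, ContDiff ℝ (⊤ : ℕ∞) g ∧ (∀ x, |g x - f x| ≤ ε) ∧
      (∀ i x, |pd i g x - pd i f x| ≤ ε) ∧ (∀ i x, |pd i (pd i g) x - pd i (pd i f) x| ≤ ε) ∧
      ∀ x, (∀ y, dist y x < ε → f y = 0) → g x = 0 := by
  have hf1 : ContDiff ℝ 1 f := hf.of_le (by norm_num)
  have hp1 : ∀ i, ContDiff ℝ 1 (pd i f) := fun i => contDiff_pd hf (by norm_num) i
  obtain ⟨δ, hδ, h⟩ := exists_bump_radius hf.continuous hc hε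
  obtain ⟨δ', hδ', h'⟩ := exists_radius_finset (fun i => (hp1 i).continuous)
    (fun i => hasCompactSupport_pd hc i) hε
  obtain ⟨δ'', hδ'', h''⟩ := exists_radius_finset
    (fun i => (contDiff_pd (m := 0) (hp1 i) (by simp) i).continuous)
    (fun i => hasCompactSupport_pd (hasCompactSupport_pd hc i) i) hε
  have hm : 0 < min ε (min δ (min δ' δ'')) := lt_min hε (lt_min hδ (lt_min hδ' hδ''))
  have h2 : min ε (min δ (min δ' δ'')) ≤ δ := (min_le_right _ _).trans (min_le_left _ _)
  have h3 : min ε (min δ (min δ' δ'')) ≤ min δ' δ'' := (min_le_right _ _).trans (min_le_right _ _)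
  refine ⟨moll (bumpOf hm) f, contDiff_moll _ hf.continuous, fun x => h _ h2 x, fun i x => ?_,
    fun i x => ?_, ?_⟩
  · rw [pd_moll _ hf1 hc]
    exact h' _ (h3.trans (min_le_left _ _)) i x
  · rw [pd_moll _ hf1 hc, pd_moll _ (hp1 i) (hasCompactSupport_pd hc i)]
    exact h'' _ (h3.trans (min_le_right _ _)) i x
  · intro x hx
    exact moll_eq_zero _ hf.continuous fun y hy => hx y (hy.trans_le (min_le_left _ _))

/-- The orthogonal projection onto the boundary hyperplane. -/
noncomputable def proj (n : Fin N) : Eu N →L[ℝ] Eu N :=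
  ContinuousLinearMap.id ℝ _ - (EuclideanSpace.proj n : Eu N →L[ℝ] ℝ).smulRight
    (EuclideanSpace.single n (1 : ℝ))

theorem proj_apply (n : Fin N) (x : Eu N) :
    proj n x = x - x n • EuclideanSpace.single n (1 : ℝ) := by
  simp [proj]

theorem proj_coord (n : Fin N) (x : Eu N) : proj n x n = 0 := by simp [proj_apply]

theorem proj_eq_self {n : Fin N} {x : Eu N} (hx : x n = 0) : proj n x = x := by
  simp [proj_apply, hx]

theorem proj_single_self (n : Fin N) : proj n (EuclideanSpace.single n (1 : ℝ)) = 0 := by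
  simp [proj_apply]

theorem proj_single_ne {n i : Fin N} (h : i ≠ n) :
    proj n (EuclideanSpace.single i (1 : ℝ)) = EuclideanSpace.single i (1 : ℝ) := by
  simp [proj_apply, h.symm]

theorem pd_comp_proj_self {n : Fin N} {f : Eu N → ℝ} {x : Eu N}
    (hf : Differentiable ℝ f) : pd n (fun y => f (proj n y)) x = 0 := by
  unfold pd
  rw [show (fun y => f (proj n y)) = f ∘ proj n from rfl,
    fderiv_comp x hf.differentiableAt (proj n).differentiableAt]
  simp [proj_single_self]

theorem pd_comp_proj_ne {n i : Fin N} (h : i ≠ n) {f : Eu N → ℝ} {x : Eu N}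
    (hf : Differentiable ℝ f) : pd i (fun y => f (proj n y)) x = pd i f (proj n x) := by
  unfold pd
  rw [show (fun y => f (proj n y)) = f ∘ proj n from rfl,
    fderiv_comp x hf.differentiableAt (proj n).differentiableAt]
  simp [proj_single_ne h]

/-- Tangential derivatives of a function vanishing on the hyperplane vanish there. -/
theorem pd_eq_zero_of_boundary {n i : Fin N} (h : i ≠ n) {f : Eu N → ℝ} {x : Eu N}
    (hf : Differentiable ℝ f) (h0 : ∀ y : Eu N, y n = 0 → f y = 0) (hx : x n = 0) :
    pd i f x = 0 := by
  have h1 : (fun y => f (proj n y)) = fun _ => 0 := by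
    funext y; exact h0 _ (proj_coord n y)
  have h2 := pd_comp_proj_ne h (x := x) hf
  rw [h1, pd_const, proj_eq_self hx] at h2
  exact h2.symm

theorem two_le_infty : (2 : WithTop ℕ∞) ≤ ((⊤ : ℕ∞) : WithTop ℕ∞) :=
  WithTop.coe_le_coe.mpr (le_top : (2 : ℕ∞) ≤ ⊤)

theorem exists_radius_of_hasCompactSupport {f : Eu N → ℝ} (hc : HasCompactSupport f) :
    ∃ R : ℝ, 0 < R ∧ ∀ x, R ≤ ‖x‖ → f x = 0 := by
  obtain ⟨R, hR⟩ := hc.isCompact.isBounded.subset_ball 0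
  refine ⟨max R 1, by positivity, fun x hx => ?_⟩
  apply image_eq_zero_of_notMem_tsupport
  intro hmem
  have := hR hmem
  simp only [Metric.mem_ball, dist_zero_right] at this
  exact absurd ((le_max_left R 1).trans hx) (not_le.mpr this)

theorem hasCompactSupport_of_radius {f : Eu N → ℝ} {R : ℝ} (h : ∀ x, R ≤ ‖x‖ → f x = 0) :
    HasCompactSupport f :=
  HasCompactSupport.intro (isCompact_closedBall (0 : Eu N) R) fun x hx => h x (by
    have : ¬ ‖x‖ ≤ R := by simpa using hx
    linarith)

theorem tendsto_one_div_mul (K : ℝ) : Tendsto (fun k : ℕ => K * (1 / ((k : ℝ) + 1))) atTop (𝓝 0) := by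
  simpa using (tendsto_one_div_add_atTop_nhds_zero_nat (𝕜 := ℝ)).const_mul K

theorem tendsto_setIntegral_mul_sq {W G : Eu N → ℝ} {F : ℕ → Eu N → ℝ} (s : Set (Eu N))
    (hW : Continuous W) (hG : Continuous G) (hF : ∀ k, Continuous (F k)) {K R : ℝ}
    (h : ∀ k x, |F k x - G x| ≤ K * (1 / ((k : ℝ) + 1))) (hR : ∀ k x, R ≤ ‖x‖ → F k x = 0) :
    Tendsto (fun k => ∫ x in s, W x * F k x ^ 2) atTop (𝓝 (∫ x in s, W x * G x ^ 2)) := by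
  have hlim : ∀ x, Tendsto (fun k => F k x) atTop (𝓝 (G x)) := by
    intro x
    refine tendsto_iff_norm_sub_tendsto_zero.mpr ?_
    exact squeeze_zero (fun _ => norm_nonneg _) (fun k => h k x) (tendsto_one_div_mul K)
  have hK : 0 ≤ K := by
    have := (abs_nonneg _).trans (h 0 0)
    simpa using this
  have hKk : ∀ k : ℕ, K * (1 / ((k : ℝ) + 1)) ≤ K := by
    intro k
    have : (1 : ℝ) / (k + 1) ≤ 1 := by
      rw [div_le_one (by positivity)]; linarith [(Nat.cast_nonneg k : (0 : ℝ) ≤ k)]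
    nlinarith
  obtain ⟨A, hA⟩ := (isCompact_closedBall (0 : Eu N) R).exists_bound_of_continuousOn
    (f := fun x => |W x| * (|G x| + K) ^ 2) (by fun_prop)
  refine tendsto_integral_of_dominated_convergence
    ((Metric.closedBall (0 : Eu N) R).indicator fun _ => A) (fun k => ?_) ?_ (fun k => ?_) ?_
  · exact (hW.mul ((hF k).pow 2)).aestronglyMeasurable
  · exact ((integrable_indicator_iff Metric.isClosed_closedBall.measurableSet).mpr
      (integrableOn_const measure_closedBall_lt_top.ne)).integrableOn
  · refine Eventually.of_forall fun x => ?_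
    by_cases hx : x ∈ Metric.closedBall (0 : Eu N) R
    · rw [indicator_of_mem hx]
      refine le_trans ?_ ((le_abs_self _).trans (hA x hx))
      rw [norm_mul, norm_pow, Real.norm_eq_abs, Real.norm_eq_abs]
      have : |F k x| ≤ |G x| + K := by
        have h1 := abs_sub_abs_le_abs_sub (F k x) (G x)
        linarith [h k x, hKk k]
      gcongr
    · rw [indicator_of_notMem hx, hR k x, ]
      · simp
      · have : ¬ ‖x‖ ≤ R := by simpa using hx
        linarith
  · exact Eventually.of_forall fun x => ((hlim x).pow 2).const_mul _

theorem lap_sub {f g : Eu N → ℝ} (hf : ContDiff ℝ 2 f) (hg : ContDiff ℝ 2 g) (x : Eu N) :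
    lap (fun y => f y - g y) x = lap f x - lap g x := by
  simp only [lap_eq_sum_pd, ← Finset.sum_sub_distrib]
  refine Finset.sum_congr rfl fun i _ => ?_
  have h1 : pd i (fun y => f y - g y) = fun y => pd i f y - pd i g y := by
    funext y
    exact pd_sub (hf.differentiable (by norm_num) y) (hg.differentiable (by norm_num) y) i
  rw [h1]
  exact pd_sub ((contDiff_pd (m := 1) hf (by norm_num) i).differentiable (by norm_num) x)
    ((contDiff_pd (m := 1) hg (by norm_num) i).differentiable (by norm_num) x) i

theorem contDiff_lap {f : Eu N → ℝ} {k m : WithTop ℕ∞} (hf : ContDiff ℝ k f) (hkm : m + 2 ≤ k) :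
    ContDiff ℝ m (lap f) := by
  have : lap f = fun x => ∑ i, pd i (pd i f) x := rfl
  rw [this]
  refine ContDiff.sum fun i _ => ?_
  have h : m + 1 + 1 ≤ k := by rwa [add_assoc, one_add_one_eq_two]
  exact contDiff_pd (contDiff_pd hf h i) le_rfl i

/-- A weighted Rellich type inequality for smooth functions vanishing on the boundary extends to
`C²` functions. -/
theorem stability_extend {n : Fin N} {p : ℝ} {V : Eu N → ℝ} (hV : Continuous V)
    (hstab : ∀ φ : Eu N → ℝ, ContDiff ℝ (⊤ : ℕ∞) φ → HasCompactSupport φ →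
      (∀ x : Eu N, x n = 0 → φ x = 0) →
      p * ∫ x in hs n, V x * φ x ^ 2 ≤ ∫ x in hs n, (lap φ x) ^ 2)
    {φ : Eu N → ℝ} (hφ : ContDiff ℝ 2 φ) (hc : HasCompactSupport φ)
    (h0 : ∀ x : Eu N, x n = 0 → φ x = 0) :
    p * ∫ x in hs n, V x * φ x ^ 2 ≤ ∫ x in hs n, (lap φ x) ^ 2 := by
  obtain ⟨R, hR, hRφ⟩ := exists_radius_of_hasCompactSupport hc
  set R₁ := R + 1 with hR₁
  have hR₁0 : 0 < R₁ := by linarith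
  obtain ⟨C, hC, hcut⟩ := exists_cut_bound (N := N)
  have hcut' := hcut R₁ hR₁0
  have hφd : Differentiable ℝ φ := hφ.differentiable (by norm_num)
  have key : ∀ ε : ℝ, 0 < ε → ε ≤ 1 → ∃ ψ : Eu N → ℝ, ContDiff ℝ (⊤ : ℕ∞) ψ ∧
      (∀ x, 2 * R₁ ≤ ‖x‖ → ψ x = 0) ∧ (∀ x : Eu N, x n = 0 → ψ x = 0) ∧
      (∀ x, |ψ x - φ x| ≤ 2 * ε) ∧
      ∀ x, |lap ψ x - lap φ x| ≤
        (N + (N + 2 * (N * (C / R₁)) + N * (C / R₁ ^ 2))) * ε := by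
    intro ε hε hε1
    obtain ⟨g, hg, hg0, hg1, hg2, hgs⟩ := exists_smooth_approx_two hφ hc hε
    have hgR : ∀ x, R₁ ≤ ‖x‖ → g x = 0 := by
      intro x hx
      refine hgs x fun y hy => hRφ y ?_
      have h1 : ‖x - y‖ < ε := by rwa [← dist_eq_norm, dist_comm]
      have := norm_sub_norm_le x y
      linarith
    set h : Eu N → ℝ := fun y => g (proj n y) with hh
    have hhc : ContDiff ℝ (⊤ : ℕ∞) h := hg.comp (proj n).contDiff
    have hgd : Differentiable ℝ g := hg.differentiable (by simp)
    have hgpd : ∀ i, Differentiable ℝ (pd i g) := fun i =>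
      (contDiff_pd_top hg i).differentiable (by simp)
    have b0 : ∀ x, |h x| ≤ ε := by
      intro x
      have := hg0 (proj n x)
      rwa [h0 _ (proj_coord n x), sub_zero] at this
    have b1 : ∀ i x, |pd i h x| ≤ ε := by
      intro i x
      by_cases hi : i = n
      · subst hi; rw [hh, pd_comp_proj_self hgd, abs_zero]; exact hε.le
      · rw [hh, pd_comp_proj_ne hi hgd]
        have := hg1 i (proj n x)
        rwa [pd_eq_zero_of_boundary hi hφd h0 (proj_coord n x), sub_zero] at this
    have b2 : ∀ i x, |pd i (pd i h) x| ≤ ε := by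
      intro i x
      by_cases hi : i = n
      · subst hi
        have : pd i h = fun _ => 0 := by funext y; exact pd_comp_proj_self hgd
        rw [this, pd_const, abs_zero]; exact hε.le
      · have : pd i h = fun y => pd i g (proj n y) := by
          funext y; exact pd_comp_proj_ne hi hgd
        rw [this, pd_comp_proj_ne hi (hgpd i)]
        have := hg2 i (proj n x)
        rwa [pd_eq_zero_of_boundary hi
          ((contDiff_pd (m := 1) hφ (by norm_num) i).differentiable (by norm_num))
          (fun y hy => pd_eq_zero_of_boundary hi hφd h0 hy) (proj_coord n x), sub_zero] at this
    have hhcut : ContDiff ℝ (⊤ : ℕ∞) (fun y => h y * cut R₁ y) := hhc.mul (contDiff_cut R₁)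
    refine ⟨fun y => g y - h y * cut R₁ y, hg.sub hhcut, ?_, ?_, ?_, ?_⟩
    · intro x hx
      simp only
      rw [hgR x (by linarith), cut_eq_zero hR₁0 hx, mul_zero, sub_zero]
    · intro x hx
      simp only [hh]
      rw [proj_eq_self hx]
      by_cases hxR : ‖x‖ ≤ R₁
      · rw [cut_eq_one hR₁0 hxR]; ring
      · rw [hgR x (by linarith)]; ring
    · intro x
      have h1 := hg0 x
      have h2 : |h x * cut R₁ x| ≤ ε := by
        rw [abs_mul, abs_of_nonneg (cut_nonneg R₁ x)]
        have := b0 x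
        nlinarith [cut_nonneg R₁ x, cut_le_one R₁ x, abs_nonneg (h x)]
      rw [abs_le] at *
      constructor <;> linarith
    · intro x
      rw [lap_sub (hg.of_le two_le_infty) (hhcut.of_le two_le_infty),
        lap_mul (hhc.contDiffAt.of_le two_le_infty)
          ((contDiff_cut R₁).contDiffAt.of_le two_le_infty)]
      have c1 : |lap g x - lap φ x| ≤ N * ε := by
        simp only [lap_eq_sum_pd, ← Finset.sum_sub_distrib]
        refine (Finset.abs_sum_le_sum_abs _ _).trans ?_
        refine (Finset.sum_le_sum fun i _ => hg2 i x).trans ?_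
        simp
      have c2 : |lap h x * cut R₁ x| ≤ N * ε := by
        rw [abs_mul, abs_of_nonneg (cut_nonneg R₁ x)]
        have : |lap h x| ≤ N * ε := by
          rw [lap_eq_sum_pd]
          refine (Finset.abs_sum_le_sum_abs _ _).trans ?_
          refine (Finset.sum_le_sum fun i _ => b2 i x).trans ?_
          simp
        nlinarith [cut_nonneg R₁ x, cut_le_one R₁ x, abs_nonneg (lap h x)]
      have c3 : |∑ i, pd i h x * pd i (cut R₁) x| ≤ N * (C / R₁) * ε := by
        refine (Finset.abs_sum_le_sum_abs _ _).trans ?_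
        have : ∀ i ∈ Finset.univ, |pd i h x * pd i (cut R₁) x| ≤ ε * (C / R₁) := by
          intro i _
          rw [abs_mul]
          exact mul_le_mul (b1 i x) (hcut' x i i).1 (abs_nonneg _) hε.le
        refine (Finset.sum_le_sum this).trans (le_of_eq ?_)
        simp; ring
      have c4 : |h x * lap (cut R₁) x| ≤ N * (C / R₁ ^ 2) * ε := by
        rw [abs_mul]
        have : |lap (cut R₁) x| ≤ N * (C / R₁ ^ 2) := by
          rw [lap_eq_sum_pd]
          refine (Finset.abs_sum_le_sum_abs _ _).trans ?_
          refine (Finset.sum_le_sum fun i _ => (hcut' x i i).2).trans ?_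
          simp
        calc |h x| * |lap (cut R₁) x| ≤ ε * (N * (C / R₁ ^ 2)) :=
              mul_le_mul (b0 x) this (abs_nonneg _) hε.le
          _ = _ := by ring
      have : lap g x - (lap h x * cut R₁ x + 2 * ∑ i, pd i h x * pd i (cut R₁) x
          + h x * lap (cut R₁) x) - lap φ x = (lap g x - lap φ x) - lap h x * cut R₁ x
          - 2 * ∑ i, pd i h x * pd i (cut R₁) x - h x * lap (cut R₁) x := by ring
      rw [this]
      rw [abs_le] at *
      constructor <;> linarith
  have key' : ∀ k : ℕ, ∃ ψ : Eu N → ℝ, ContDiff ℝ (⊤ : ℕ∞) ψ ∧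
      (∀ x, 2 * R₁ ≤ ‖x‖ → ψ x = 0) ∧ (∀ x : Eu N, x n = 0 → ψ x = 0) ∧
      (∀ x, |ψ x - φ x| ≤ 2 * (1 / ((k : ℝ) + 1))) ∧
      ∀ x, |lap ψ x - lap φ x| ≤
        (N + (N + 2 * (N * (C / R₁)) + N * (C / R₁ ^ 2))) * (1 / ((k : ℝ) + 1)) := by
    intro k
    refine key _ (by positivity) ?_
    rw [div_le_one (by positivity)]; linarith [(Nat.cast_nonneg k : (0 : ℝ) ≤ k)]
  choose ψ h1 h2 h3 h4 h5 using key'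
  have hlapR : ∀ k x, 2 * R₁ + 1 ≤ ‖x‖ → lap (ψ k) x = 0 := by
    intro k x hx
    have : ψ k =ᶠ[𝓝 x] fun _ => 0 := by
      have : ∀ᶠ y : Eu N in 𝓝 x, 2 * R₁ < ‖y‖ :=
        continuous_norm.continuousAt.eventually (lt_mem_nhds (by linarith))
      filter_upwards [this] with y hy using h2 k y hy.le
    rw [lap_congr this, lap_eq_sum_pd]
    refine Finset.sum_eq_zero fun i _ => ?_
    have : pd i (fun _ : Eu N => (0 : ℝ)) = fun _ => 0 := by funext y; exact pd_const 0 i y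
    rw [this, pd_const]
  have t1 := (tendsto_setIntegral_mul_sq (hs n) hV hφ.continuous (fun k => (h1 k).continuous)
    h4 h2).const_mul p
  have t2 := tendsto_setIntegral_mul_sq (hs n) (continuous_const (y := (1 : ℝ)))
    (contDiff_lap (m := 0) hφ (by norm_num)).continuous
    (fun k => (contDiff_lap (m := 0) (h1 k) (by simpa using two_le_infty)).continuous) h5 hlapR
  simp only [one_mul] at t2
  exact le_of_tendsto_of_tendsto' t1 t2 fun k =>
    hstab (ψ k) (h1 k) (hasCompactSupport_of_radius (h2 k)) (h3 k)

/-- Real Schwartz functions. -/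
abbrev Sch (N : ℕ) := SchwartzMap (Eu N) ℝ

/-- Partial derivative of a Schwartz function. -/
noncomputable def spd (i : Fin N) (f : Sch N) : Sch N :=
  LineDeriv.lineDerivOp (EuclideanSpace.single i (1 : ℝ)) f

theorem spd_apply (i : Fin N) (f : Sch N) (x : Eu N) : spd i f x = pd i f x :=
  SchwartzMap.lineDerivOp_apply_eq_fderiv _ f x

theorem spd_coe (i : Fin N) (f : Sch N) : (spd i f : Eu N → ℝ) = pd i f :=
  funext (spd_apply i f)

/-- Laplacian of a Schwartz function. -/
noncomputable def slap (f : Sch N) : Sch N := ∑ i, spd i (spd i f)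

theorem slap_apply (f : Sch N) (x : Eu N) : slap f x = lap f x := by
  rw [lap_eq_sum_pd, slap, _root_.sum_apply]
  exact Finset.sum_congr rfl fun i _ => by rw [spd_apply, spd_coe]

theorem sch_mul_integrable (f g : Sch N) : Integrable (fun x => f x * g x) := by
  have h := (SchwartzMap.smulLeftCLM ℝ (f : Eu N → ℝ) g).integrable (μ := volume)
  refine h.congr (Eventually.of_forall fun x => ?_)
  exact SchwartzMap.smulLeftCLM_apply_apply f.hasTemperateGrowth g x

theorem sch_integral_pd (f g : Sch N) (i : Fin N) :
    ∫ x, pd i (pd i f) x * g x = - ∫ x, pd i f x * pd i g x := by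
  have h := SchwartzMap.integral_mul_lineDerivOp_right_eq_neg_left (μ := volume)
    (spd i f) g (EuclideanSpace.single i (1 : ℝ))
  have h1 : ∀ x, LineDeriv.lineDerivOp (EuclideanSpace.single i (1 : ℝ)) (spd i f) x
      = pd i (pd i f) x := fun x => by
    rw [← spd_coe, ← spd_apply]; rfl
  have h2 : ∀ x, LineDeriv.lineDerivOp (EuclideanSpace.single i (1 : ℝ)) g x = pd i g x :=
    fun x => spd_apply i g x
  simp only [h1, h2, spd_apply] at h
  linarith

/-- The form `ε ∫ f g + ∫ ∇f · ∇g`. -/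
noncomputable def aform (ε : ℝ) (f g : Sch N) : ℝ :=
  ε * (∫ x, f x * g x) + ∑ i, ∫ x, pd i f x * pd i g x

theorem aform_comm (ε : ℝ) (f g : Sch N) : aform ε f g = aform ε g f := by
  simp only [aform, mul_comm]

theorem integral_lap_mul (f g : Sch N) :
    ∫ x, lap f x * g x = - ∑ i, ∫ x, pd i f x * pd i g x := by
  simp only [lap_eq_sum_pd, Finset.sum_mul]
  rw [integral_finsetSum, ← Finset.sum_neg_distrib]
  · exact Finset.sum_congr rfl fun i _ => sch_integral_pd f g i
  · intro i _
    have := sch_mul_integrable (spd i (spd i f)) g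
    simpa only [spd_apply, spd_coe] using this

theorem sch_lap_mul_integrable (f g : Sch N) : Integrable (fun x => lap f x * g x) := by
  simpa only [slap_apply] using sch_mul_integrable (slap f) g

theorem aform_eq (ε : ℝ) (f g : Sch N) :
    aform ε f g = ∫ x, (ε * f x - lap f x) * g x := by
  have h : ∀ x, (ε * f x - lap f x) * g x = ε * (f x * g x) - lap f x * g x := fun x => by ring
  simp only [h]
  rw [integral_sub ((sch_mul_integrable f g).const_mul ε) (sch_lap_mul_integrable f g),
    integral_const_mul, integral_lap_mul, aform]
  ring

theorem aform_le (ε : ℝ) (hε : 0 ≤ ε) (f g : Sch N) :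
    aform ε f g ≤ (aform ε f f + aform ε g g) / 2 := by
  have h : ∀ f g : Sch N, ∫ x, f x * g x ≤ ((∫ x, f x * f x) + ∫ x, g x * g x) / 2 := by
    intro f g
    rw [← integral_add (sch_mul_integrable f f) (sch_mul_integrable g g), ← integral_div]
    refine integral_mono (sch_mul_integrable f g)
      (((sch_mul_integrable f f).add (sch_mul_integrable g g)).div_const 2) fun x => ?_
    nlinarith [sq_nonneg (f x - g x)]
  have h2 : ∀ i, ∫ x, pd i f x * pd i g x ≤
      ((∫ x, pd i f x * pd i f x) + ∫ x, pd i g x * pd i g x) / 2 := by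
    intro i
    simpa only [spd_apply] using h (spd i f) (spd i g)
  have h3 := Finset.sum_le_sum fun i (_ : i ∈ Finset.univ) => h2 i
  rw [← Finset.sum_div, Finset.sum_add_distrib] at h3
  unfold aform
  nlinarith [h f g]

theorem sch_energy (ε : ℝ) (hε : 0 ≤ ε) (f : Sch N) :
    ε ^ 2 * ∫ x, f x ^ 2 ≤ ∫ x, (ε * f x - lap f x) ^ 2 ∧
    ∫ x, lap f x ^ 2 ≤ ∫ x, (ε * f x - lap f x) ^ 2 := by
  have i1 : Integrable (fun x => f x ^ 2) := by simpa only [sq] using sch_mul_integrable f f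
  have i2 := sch_lap_mul_integrable f f
  have i3 : Integrable (fun x => lap f x ^ 2) := by
    simpa only [sq, slap_apply] using sch_mul_integrable (slap f) (slap f)
  have e1 : ∀ x, (ε * f x - lap f x) ^ 2
      = ε ^ 2 * f x ^ 2 - 2 * ε * (lap f x * f x) + lap f x ^ 2 := fun x => by ring
  have e2 : ∫ x, (ε * f x - lap f x) ^ 2
      = ε ^ 2 * (∫ x, f x ^ 2) - 2 * ε * (∫ x, lap f x * f x) + ∫ x, lap f x ^ 2 := by
    simp only [e1]
    have j : Integrable (fun x => ε ^ 2 * f x ^ 2 - 2 * ε * (lap f x * f x)) :=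
      (i1.const_mul _).sub (i2.const_mul _)
    rw [integral_add j i3, integral_sub (i1.const_mul _) (i2.const_mul _), integral_const_mul,
      integral_const_mul]
  have h1 : ∫ x, lap f x * f x ≤ 0 := by
    rw [integral_lap_mul, neg_nonpos]
    exact Finset.sum_nonneg fun i _ => integral_nonneg fun x => mul_self_nonneg _
  have h2 : 0 ≤ ∫ x, f x ^ 2 := integral_nonneg fun x => sq_nonneg _
  have h3 : 0 ≤ ∫ x, lap f x ^ 2 := integral_nonneg fun x => sq_nonneg _
  rw [e2]
  constructor <;> nlinarith [mul_nonneg (sq_nonneg ε) h2, mul_nonneg hε (neg_nonneg.mpr h1)]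

/-- Solvability of the resolvent equation in the Schwartz class. -/
theorem exists_resolvent {ε : ℝ} (hε : 0 < ε) (f : Sch N) :
    ∃ h : Sch N, ∀ x, ε * h x - lap h x = f x := by
  set m : Eu N → ℝ := fun x => ε⁻¹ * (1 + ‖(2 * π / √ε) • x‖ ^ 2) ^ (-1 : ℝ) with hm
  have hmT : m.HasTemperateGrowth := by
    have h1 := (Function.hasTemperateGrowth_one_add_norm_sq_rpow (Eu N) (-1)).comp
      (((2 * π / √ε) • ContinuousLinearMap.id ℝ (Eu N)).hasTemperateGrowth)
    exact (Function.HasTemperateGrowth.const (ε⁻¹)).mul h1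
  have hmeq : ∀ x, ε * m x + (2 * π) ^ 2 * (‖x‖ ^ 2 * m x) = 1 := by
    intro x
    simp only [hm]
    rw [Real.rpow_neg_one, norm_smul, mul_pow, Real.norm_eq_abs, sq_abs, div_pow,
      Real.sq_sqrt hε.le]
    have : 0 < 1 + (2 * π) ^ 2 / ε * ‖x‖ ^ 2 := by positivity
    field_simp
  set fc : SchwartzMap (Eu N) ℂ := SchwartzMap.postcompCLM Complex.ofRealCLM f with hfc
  set H : SchwartzMap (Eu N) ℂ := fourierMultiplierCLM ℂ m fc with hH
  have hnT : (fun x : Eu N => ‖x‖ ^ 2).HasTemperateGrowth := by fun_prop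
  have hLap : ε • H - Laplacian.laplacian H = fc := by
    rw [laplacian_eq_fourierMultiplierCLM, hH,
      fourierMultiplierCLM_fourierMultiplierCLM_apply (by exact hnT) hmT]
    simp only [fourierMultiplierCLM_apply]
    rw [neg_smul, sub_neg_eq_add, ← FourierTransform.fourierInv_smul,
      ← FourierTransform.fourierInv_smul, ← FourierTransform.fourierInv_add]
    conv_rhs => rw [← FourierTransform.fourierInv_fourier_eq (F := SchwartzMap (Eu N) ℂ) fc]
    congr 1
    ext x
    have hnm : ((fun x : Eu N => ‖x‖ ^ 2) * m).HasTemperateGrowth := hnT.mul hmT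
    rw [_root_.add_apply, _root_.smul_apply, _root_.smul_apply,
      SchwartzMap.smulLeftCLM_apply_apply hmT, SchwartzMap.smulLeftCLM_apply_apply hnm,
      Pi.mul_apply, smul_smul, smul_smul, ← add_smul, hmeq x, one_smul]
  have hre : ∀ (G : SchwartzMap (Eu N) ℂ) (v : Eu N),
      LineDeriv.lineDerivOp v (SchwartzMap.postcompCLM Complex.reCLM G)
        = SchwartzMap.postcompCLM Complex.reCLM (LineDeriv.lineDerivOp v G) := by
    intro G v
    ext x
    rw [SchwartzMap.lineDerivOp_apply_eq_fderiv, SchwartzMap.postcompCLM_apply,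
      SchwartzMap.lineDerivOp_apply_eq_fderiv]
    have h1 := (Complex.reCLM.hasFDerivAt (x := G x)).comp x (G.hasFDerivAt x)
    have h2 : (fun y => Complex.reCLM (G y)) = ⇑(SchwartzMap.postcompCLM Complex.reCLM G) := rfl
    rw [← h2]
    have h3 := h1.fderiv
    simp only [Function.comp_def] at h3
    rw [h3]
    rfl
  refine ⟨SchwartzMap.postcompCLM Complex.reCLM H, fun x => ?_⟩
  have h1 := DFunLike.congr_fun hLap x
  rw [_root_.sub_apply, _root_.smul_apply,
    SchwartzMap.laplacian_eq_sum (EuclideanSpace.basisFun (Fin N) ℝ), _root_.sum_apply] at h1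
  have h2 := congrArg Complex.re h1
  rw [← slap_apply, slap, _root_.sum_apply]
  simp only [spd, hre, SchwartzMap.postcompCLM_apply, Complex.reCLM_apply]
  simp only [EuclideanSpace.basisFun_apply, Complex.sub_re, Complex.re_sum, Complex.smul_re,
    smul_eq_mul] at h2
  rw [h2, hfc]
  simp [SchwartzMap.postcompCLM_apply]

/-- Reflection across the boundary hyperplane. -/
noncomputable def refl (n : Fin N) : Eu N ≃ₗᵢ[ℝ] Eu N :=
  ((ℝ ∙ (EuclideanSpace.single n (1 : ℝ) : Eu N))ᗮ).reflection

theorem refl_apply (n : Fin N) (x : Eu N) :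
    refl n x = x - (2 * x n) • EuclideanSpace.single n (1 : ℝ) := by
  unfold refl
  rw [Submodule.reflection_orthogonal_apply, Submodule.reflection_singleton_apply]
  simp [EuclideanSpace.inner_single_left, two_smul, two_mul, add_smul]

theorem refl_refl (n : Fin N) (x : Eu N) : refl n (refl n x) = x :=
  Submodule.reflection_reflection _ x

theorem refl_coord (n : Fin N) (x : Eu N) : refl n x n = - x n := by
  simp [refl_apply]; ring

theorem refl_eq_self {n : Fin N} {x : Eu N} (h : x n = 0) : refl n x = x := by
  simp [refl_apply, h]

theorem refl_single (n i : Fin N) : refl n (EuclideanSpace.single i (1 : ℝ))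
    = (if i = n then (-1 : ℝ) else 1) • EuclideanSpace.single i (1 : ℝ) := by
  rw [refl_apply]
  split_ifs with h
  · subst h; simp; module
  · have : (EuclideanSpace.single i (1 : ℝ) : Eu N) n = 0 := by
      simp only [PiLp.single_apply]; rw [if_neg (Ne.symm h)]
    rw [this]; simp

theorem pd_comp_refl (n i : Fin N) (f : Eu N → ℝ) (x : Eu N) :
    pd i (fun y => f (refl n y)) x = (if i = n then (-1 : ℝ) else 1) * pd i f (refl n x) := by
  unfold pd
  have h := (refl n).toContinuousLinearEquiv.comp_right_fderiv (f := f) (x := x)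
  have h2 : (fun y => f (refl n y)) = f ∘ (refl n).toContinuousLinearEquiv := rfl
  rw [h2, h, ContinuousLinearMap.comp_apply]
  have h3 : ((refl n).toContinuousLinearEquiv : Eu N →L[ℝ] Eu N) (EuclideanSpace.single i (1 : ℝ))
    = (if i = n then (-1 : ℝ) else 1) • EuclideanSpace.single i (1 : ℝ) := refl_single n i
  rw [h3, map_smul]
  rfl

theorem lap_comp_refl (n : Fin N) (f : Eu N → ℝ) (x : Eu N) :
    lap (fun y => f (refl n y)) x = lap f (refl n x) := by
  simp only [lap_eq_sum_pd]
  refine Finset.sum_congr rfl fun i _ => ?_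
  have : pd i (fun y => f (refl n y)) =
      fun y => (if i = n then (-1 : ℝ) else 1) * pd i f (refl n y) := by
    funext y; exact pd_comp_refl n i f y
  rw [this, pd_const_mul, pd_comp_refl]
  split_ifs <;> ring

/-- Oddness with respect to the boundary hyperplane. -/
def IsOdd (n : Fin N) (f : Eu N → ℝ) : Prop := ∀ x, f (refl n x) = - f x

theorem exists_odd_resolvent (n : Fin N) {ε : ℝ} (hε : 0 < ε) (f : Sch N) (hf : IsOdd n f) :
    ∃ h : Sch N, IsOdd n h ∧ ∀ x, ε * h x - lap h x = f x := by
  obtain ⟨h, hh⟩ := exists_resolvent hε f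
  set h' : Sch N :=
    SchwartzMap.compCLMOfContinuousLinearEquiv ℝ (refl n).toContinuousLinearEquiv h with hh'
  have e1 : ∀ x, h' x = h (refl n x) := fun x => rfl
  have e1' : (h' : Eu N → ℝ) = fun x => h (refl n x) := rfl
  set g : Sch N := (1 / 2 : ℝ) • (h - h') with hg
  have e2 : ∀ x, g x = 1 / 2 * (h x - h (refl n x)) := fun x => rfl
  have e3 : ∀ x, lap g x = 1 / 2 * (lap h x - lap h (refl n x)) := by
    intro x
    have hgfun : (g : Eu N → ℝ) = fun y => 1 / 2 * (h y - h' y) := rfl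
    have hlap : lap g x = 1 / 2 * lap (fun y => h y - h' y) x := by
      rw [hgfun]
      simp only [lap_eq_sum_pd, Finset.mul_sum]
      refine Finset.sum_congr rfl fun i _ => ?_
      have : pd i (fun y => 1 / 2 * (h y - h' y)) = fun y => 1 / 2 * pd i (fun y => h y - h' y) y := by
        funext y; exact pd_const_mul _ i
      rw [this, pd_const_mul]
    rw [hlap, lap_sub (h.smooth 2) (h'.smooth 2), e1', lap_comp_refl]
  refine ⟨g, fun x => ?_, fun x => ?_⟩
  · rw [e2, e2, refl_refl]; ring
  · rw [e2, e3]
    have h1 := hh x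
    have h2 := hh (refl n x)
    rw [hf x] at h2
    linarith

theorem le_of_log_convex {M : ℕ → ℝ} {K : ℝ} (h0 : 0 ≤ M 0) (hM : ∀ j, M j ^ 2 ≤ M 0 * M (2 * j))
    (hK : ∀ j, M (2 * j) ≤ K) : M 1 ≤ M 0 := by
  by_contra! hlt
  rcases h0.eq_or_lt with h00 | h00
  · have := hM 1
    rw [← h00, zero_mul] at this
    have h1 : M 1 = 0 := by nlinarith
    linarith
  set r := M 1 / M 0 with hr
  have hr1 : 1 < r := by rw [hr, lt_div_iff₀ h00]; linarith
  have key : ∀ k : ℕ, r ^ (2 ^ k) * M 0 ≤ M (2 ^ k) := by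
    intro k
    induction k with
    | zero => simp [hr, h00.ne']
    | succ k ih =>
      have h1 := hM (2 ^ k)
      have h2 : 0 < r ^ (2 ^ k) * M 0 := by positivity
      have h3 : (r ^ (2 ^ k) * M 0) ^ 2 ≤ M 0 * M (2 * 2 ^ k) :=
        (pow_le_pow_left₀ h2.le ih 2).trans h1
      have h4 : (r ^ (2 ^ k) * M 0) ^ 2 = M 0 * (r ^ (2 ^ (k + 1)) * M 0) := by
        rw [pow_succ 2 k, pow_mul r]; ring
      rw [h4] at h3
      rw [pow_succ', ]
      rw [pow_succ'] at h3
      exact le_of_mul_le_mul_left h3 h00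
  obtain ⟨k, hk⟩ := pow_unbounded_of_one_lt (K / M 0) hr1
  have h5 : r ^ k ≤ r ^ (2 ^ (k + 1)) :=
    pow_le_pow_right₀ hr1.le ((Nat.lt_two_pow_self).le.trans
      (Nat.pow_le_pow_right (by norm_num) (Nat.le_succ k)))
  have h6 := key (k + 1)
  have h7 := hK (2 ^ k)
  rw [← pow_succ'] at h7
  rw [div_lt_iff₀ h00] at hk
  nlinarith

theorem integral_mul_sq_le {W f g : Eu N → ℝ} (h1 : Integrable fun x => W x * (f x * f x))
    (h2 : Integrable fun x => W x * (f x * g x)) (h3 : Integrable fun x => W x * (g x * g x))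
    (hW : ∀ x, 0 ≤ W x) :
    (∫ x, W x * (f x * g x)) ^ 2 ≤ (∫ x, W x * (f x * f x)) * ∫ x, W x * (g x * g x) := by
  set A := ∫ x, W x * (f x * f x)
  set B := ∫ x, W x * (f x * g x)
  set D := ∫ x, W x * (g x * g x)
  have key : ∀ t : ℝ, 0 ≤ A * (t * t) + (2 * B) * t + D := by
    intro t
    have : A * (t * t) + (2 * B) * t + D = ∫ x, W x * (t * f x + g x) ^ 2 := by
      have e : ∀ x, W x * (t * f x + g x) ^ 2
          = (t * t) * (W x * (f x * f x)) + (2 * t) * (W x * (f x * g x)) + W x * (g x * g x) :=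
        fun x => by ring
      simp only [e]
      have i : Integrable fun x => (t * t) * (W x * (f x * f x)) + (2 * t) * (W x * (f x * g x)) :=
        (h1.const_mul _).add (h2.const_mul _)
      rw [integral_add i h3, integral_add (h1.const_mul _) (h2.const_mul _), integral_const_mul,
        integral_const_mul]
      ring
    rw [this]
    exact integral_nonneg fun x => mul_nonneg (hW x) (sq_nonneg _)
  have := discrim_le_zero key
  unfold discrim at this
  nlinarith

/-- If `W² ≤ (-Δ)²` on odd functions then `W ≤ -Δ` on odd functions. -/
theorem odd_sqrt_inequality {n : Fin N} {W : Eu N → ℝ} (hW : ContDiff ℝ (⊤ : ℕ∞) W)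
    (hWc : HasCompactSupport W) (hW0 : ∀ x, 0 ≤ W x) (hWe : ∀ x, W (refl n x) = W x)
    (hRel : ∀ h : Sch N, IsOdd n h → ∫ x, (W x * h x) ^ 2 ≤ ∫ x, lap h x ^ 2)
    (φ : Sch N) (hφ : IsOdd n φ) :
    ∫ x, W x * φ x ^ 2 ≤ ∑ i, ∫ x, pd i φ x ^ 2 := by
  set w : Sch N := hWc.toSchwartzMap hW with hw
  have hwx : ∀ x, w x = W x := fun x => rfl
  set mulW : Sch N → Sch N := fun f => SchwartzMap.smulLeftCLM ℝ (w : Eu N → ℝ) f with hmulW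
  have hmul : ∀ f x, mulW f x = W x * f x := fun f x =>
    SchwartzMap.smulLeftCLM_apply_apply w.hasTemperateGrowth f x
  have hint : ∀ f g : Sch N, Integrable fun x => W x * (f x * g x) := by
    intro f g
    refine (sch_mul_integrable (mulW f) g).congr (Eventually.of_forall fun x => ?_)
    simp only [hmul]; ring
  have main : ∀ ε : ℝ, 0 < ε →
      ∫ x, W x * φ x ^ 2 ≤ ε * (∫ x, φ x ^ 2) + ∑ i, ∫ x, pd i φ x ^ 2 := by
    intro ε hε
    have hres : ∀ f : {f : Sch N // IsOdd n f}, ∃ h : {f : Sch N // IsOdd n f},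
        ∀ x, ε * h.1 x - lap h.1 x = W x * f.1 x := by
      rintro ⟨f, hf⟩
      obtain ⟨h, h1, h2⟩ := exists_odd_resolvent n hε (mulW f) (fun x => by
        rw [hmul, hmul, hWe, hf x]; ring)
      exact ⟨⟨h, h1⟩, fun x => by rw [h2 x, hmul]⟩
    choose T hT using hres
    set F : ℕ → {f : Sch N // IsOdd n f} := fun k => T^[k] ⟨φ, hφ⟩ with hF
    have hF0 : (F 0).1 = φ := rfl
    have hFs : ∀ k x, ε * (F (k + 1)).1 x - lap (F (k + 1)).1 x = W x * (F k).1 x := by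
      intro k x
      have : F (k + 1) = T (F k) := by simp only [hF, Function.iterate_succ_apply']
      rw [this]; exact hT _ x
    set MM : ℕ → ℕ → ℝ := fun i j => ∫ x, W x * ((F i).1 x * (F j).1 x) with hMM
    have hcomm : ∀ i j, MM i j = MM j i := by
      intro i j; simp only [hMM]
      exact integral_congr_ae (Eventually.of_forall fun x => by ring)
    have haf : ∀ k (g : Sch N), aform ε (F (k + 1)).1 g = ∫ x, W x * ((F k).1 x * g x) := by
      intro k g
      rw [aform_eq]
      exact integral_congr_ae (Eventually.of_forall fun x => by
        simp only [hFs]; ring)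
    have hshift : ∀ i j, MM i (j + 1) = MM (i + 1) j := by
      intro i j
      have h1 := haf i (F (j + 1)).1
      have h2 := haf j (F (i + 1)).1
      rw [aform_comm] at h1
      rw [hcomm (i + 1) j]
      simp only [hMM]
      rw [← h1, ← h2]
    have hsum : ∀ j i, MM i j = MM 0 (i + j) := by
      intro j i
      induction i generalizing j with
      | zero => rw [zero_add]
      | succ i ih => rw [← hshift, ih]; congr 1; ring
    set B := ∫ x, (W x * φ x) ^ 2 with hB
    have hWF : ∀ k, ∫ x, (W x * (F k).1 x) ^ 2 ≤ B := by
      intro k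
      induction k with
      | zero => exact le_rfl
      | succ k ih =>
        refine le_trans ((hRel _ (F (k + 1)).2).trans ((sch_energy ε hε.le _).2)) ?_
        simpa only [hFs] using ih
    have hB0 : 0 ≤ B := integral_nonneg fun x => sq_nonneg _
    have hFF : ∀ k, ∫ x, (F k).1 x ^ 2 ≤ (∫ x, φ x ^ 2) + B / ε ^ 2 := by
      intro k
      have h0 : 0 ≤ ∫ x, φ x ^ 2 := integral_nonneg fun x => sq_nonneg _
      cases k with
      | zero =>
        have : 0 ≤ B / ε ^ 2 := by positivity
        rw [hF0]; linarith
      | succ k =>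
        have h1 := (sch_energy ε hε.le (F (k + 1)).1).1
        simp only [hFs] at h1
        have h2 : ∫ x, (F (k + 1)).1 x ^ 2 ≤ B / ε ^ 2 := by
          rw [le_div_iff₀ (by positivity)]; linarith [hWF k]
        linarith
    have hbound : ∀ j, MM 0 (2 * j) ≤ (((∫ x, φ x ^ 2) + B / ε ^ 2) + B) / 2 := by
      intro j
      have h1 : MM 0 (2 * j) = MM j j := by rw [hsum j j, two_mul]
      rw [h1]
      have i1 : Integrable fun x => (F j).1 x ^ 2 := by
        simpa only [sq] using sch_mul_integrable (F j).1 (F j).1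
      have i2 : Integrable fun x => (W x * (F j).1 x) ^ 2 := by
        have := sch_mul_integrable (mulW (F j).1) (mulW (F j).1)
        simpa only [sq, hmul] using this
      have h2 : MM j j ≤ ((∫ x, (F j).1 x ^ 2) + ∫ x, (W x * (F j).1 x) ^ 2) / 2 := by
        rw [← integral_add i1 i2, ← integral_div]
        refine integral_mono (hint _ _) ((i1.add i2).div_const 2) fun x => ?_
        simp only
        nlinarith [sq_nonneg ((F j).1 x - W x * (F j).1 x)]
      linarith [hFF j, hWF j]
    have hlog : MM 0 1 ≤ MM 0 0 := by
      refine le_of_log_convex (M := MM 0) ?_ (fun j => ?_) hbound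
      · exact integral_nonneg fun x => mul_nonneg (hW0 x) (mul_self_nonneg _)
      · have h1 := integral_mul_sq_le (hint (F 0).1 (F 0).1) (hint (F 0).1 (F j).1)
          (hint (F j).1 (F j).1) hW0
        have h2 : MM 0 (2 * j) = MM j j := by rw [hsum j j, two_mul]
        rw [h2]; exact h1
    have h1 : MM 0 0 = aform ε (F 1).1 φ := (haf 0 φ).symm
    have h2 : aform ε (F 1).1 (F 1).1 = MM 0 1 := haf 0 (F 1).1
    have h3 := aform_le ε hε.le (F 1).1 φ
    have h4 : MM 0 0 ≤ aform ε φ φ := by linarith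
    simpa only [hMM, hF0, aform, sq] using h4
  have hφ0 : 0 ≤ ∫ x, φ x ^ 2 := integral_nonneg fun x => sq_nonneg _
  refine le_of_forall_pos_le_add fun δ hδ => ?_
  have := main (δ / ((∫ x, φ x ^ 2) + 1)) (by positivity)
  have h2 : δ / ((∫ x, φ x ^ 2) + 1) * (∫ x, φ x ^ 2) ≤ δ := by
    rw [div_mul_eq_mul_div, div_le_iff₀ (by positivity)]; nlinarith
  linarith

theorem volume_hyperplane (n : Fin N) : volume {x : Eu N | x n = 0} = 0 := by
  have h := Measure.addHaar_submodule (volume : Measure (Eu N))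
    (LinearMap.ker (EuclideanSpace.proj n : Eu N →L[ℝ] ℝ).toLinearMap) ?_
  · convert h using 2
    ext x; simp
  · intro htop
    have : EuclideanSpace.single n (1 : ℝ) ∈
        LinearMap.ker (EuclideanSpace.proj n : Eu N →L[ℝ] ℝ).toLinearMap := by
      rw [htop]; trivial
    simp at this

theorem integral_eq_two_mul_of_even {n : Fin N} {F : Eu N → ℝ} (hF : Integrable F)
    (he : ∀ x, F (refl n x) = F x) : ∫ x, F x = 2 * ∫ x in hs n, F x := by
  have hm := (isOpen_hs n).measurableSet
  have h1 := integral_add_compl hm hF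
  have h2 : ∫ x in (hs n)ᶜ, F x = ∫ x in (refl n) ⁻¹' (hs n), F x := by
    refine setIntegral_congr_set ?_
    have h3 : ∀ᵐ x : Eu N, x n ≠ 0 := by
      rw [ae_iff]; simpa using volume_hyperplane n
    filter_upwards [h3] with x hx
    refine propext ⟨fun h => ?_, fun h => ?_⟩
    · have h4 : ¬ 0 < x n := h
      change 0 < refl n x n
      rw [refl_coord]
      have := lt_of_le_of_ne (not_lt.mp h4) hx
      linarith
    · have h4 : 0 < refl n x n := h
      rw [refl_coord] at h4
      change ¬ 0 < x n
      linarith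
  have h3 : ∫ x in (refl n) ⁻¹' (hs n), F x = ∫ x in hs n, F x := by
    rw [← ((refl n).measurePreserving).setIntegral_preimage_emb
      (refl n).toHomeomorph.measurableEmbedding F (hs n)]
    exact setIntegral_congr_fun ((refl n).continuous.measurable hm) (fun x _ => (he x).symm)
  rw [← h1, h2, h3]; ring

theorem tendsto_integral_lap_cut (n : Fin N) (h : Sch N) :
    Tendsto (fun k : ℕ => ∫ x in hs n, lap (fun y => h y * cut ((k : ℝ) + 1) y) x ^ 2) atTop
      (𝓝 (∫ x in hs n, lap h x ^ 2)) := by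
  obtain ⟨C, hC, hb⟩ := exists_cut_bound (N := N)
  have hsm : ∀ m : ℕ∞, ContDiff ℝ m h := fun m => h.smooth m
  have hh2 : ContDiff ℝ 2 h := h.smooth 2
  have hc2 : ∀ R : ℝ, ContDiff ℝ 2 (cut R : Eu N → ℝ) := fun R => (contDiff_cut R).of_le two_le_infty
  set B : Eu N → ℝ := fun x => |lap h x| + ∑ i, 2 * C * |pd i h x| + N * C * |h x| with hB
  have hlapeq : (slap h : Eu N → ℝ) = lap h := funext (slap_apply h)
  have hBm : MemLp B 2 (volume : Measure (Eu N)) := by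
    have e1 : MemLp (fun x => |lap h x|) 2 (volume : Measure (Eu N)) := by
      rw [← hlapeq]; exact ((slap h).memLp 2).norm
    have e2 : MemLp (fun x => ∑ i, 2 * C * |pd i h x|) 2 (volume : Measure (Eu N)) := by
      refine memLp_finsetSum _ fun i _ => ?_
      rw [← spd_coe]
      exact (((spd i h).memLp 2).norm).const_mul (2 * C)
    have e3 : MemLp (fun x => N * C * |h x|) 2 (volume : Measure (Eu N)) :=
      ((h.memLp 2).norm).const_mul (N * C)
    exact (e1.add e2).add e3
  refine tendsto_integral_of_dominated_convergence (fun x => B x ^ 2) (fun k => ?_) ?_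
    (fun k => Eventually.of_forall fun x => ?_) (Eventually.of_forall fun x => ?_)
  · refine Continuous.aestronglyMeasurable ?_
    exact (contDiff_lap (m := 0) (hh2.mul (hc2 _)) (by simp)).continuous.pow 2
  · exact hBm.integrable_sq.integrableOn
  · have hR : (0 : ℝ) < (k : ℝ) + 1 := by positivity
    have hR1 : (1 : ℝ) ≤ (k : ℝ) + 1 := by linarith [(Nat.cast_nonneg k : (0 : ℝ) ≤ k)]
    rw [Real.norm_eq_abs, abs_pow]
    refine pow_le_pow_left₀ (abs_nonneg _) ?_ 2
    rw [lap_mul hh2.contDiffAt (hc2 _).contDiffAt, Finset.mul_sum]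
    have hb1 : ∀ i, |pd i (cut ((k : ℝ) + 1)) x| ≤ C := fun i =>
      (hb _ hR x i i).1.trans (div_le_self hC.le hR1)
    have hb2 : |lap (cut ((k : ℝ) + 1)) x| ≤ N * C := by
      rw [lap_eq_sum_pd]
      refine (Finset.abs_sum_le_sum_abs _ _).trans ?_
      calc _ ≤ ∑ i : Fin N, C := Finset.sum_le_sum fun i _ =>
            (hb _ hR x i i).2.trans (div_le_self hC.le (one_le_pow₀ hR1))
        _ = N * C := by simp
    refine (abs_add_le _ _).trans (add_le_add ((abs_add_le _ _).trans (add_le_add ?_ ?_)) ?_)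
    · rw [abs_mul, abs_of_nonneg (cut_nonneg _ _)]
      exact mul_le_of_le_one_right (abs_nonneg _) (cut_le_one _ _)
    · refine (Finset.abs_sum_le_sum_abs _ _).trans (Finset.sum_le_sum fun i _ => ?_)
      rw [abs_mul, abs_mul, abs_of_pos (two_pos : (0 : ℝ) < 2)]
      have := mul_le_mul_of_nonneg_left (hb1 i) (abs_nonneg (pd i h x))
      nlinarith
    · rw [abs_mul, mul_comm]
      exact mul_le_mul_of_nonneg_right hb2 (abs_nonneg _)
  · refine tendsto_const_nhds.congr' ?_
    have : ∀ᶠ k : ℕ in atTop, ‖x‖ < k := tendsto_natCast_atTop_atTop.eventually_gt_atTop _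
    filter_upwards [this] with k hk
    congr 1
    refine lap_congr ?_
    have : ∀ᶠ y in 𝓝 x, ‖y‖ < k := continuous_norm.continuousAt.eventually_lt_const hk
    filter_upwards [this] with y hy
    rw [cut_eq_one (by positivity) (by linarith), mul_one]

/-- Stability in the form of a Rellich inequality on odd Schwartz functions. -/
theorem odd_rellich {n : Fin N} {V W : Eu N → ℝ} (hV : Continuous V)
    (hstab : ∀ φ : Eu N → ℝ, ContDiff ℝ (⊤ : ℕ∞) φ → HasCompactSupport φ →
      (∀ x, x n = 0 → φ x = 0) → ∫ x in hs n, (V x * φ x) ^ 2 ≤ ∫ x in hs n, lap φ x ^ 2)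
    (hW : Continuous W) (hWc : HasCompactSupport W) (hWe : ∀ x, W (refl n x) = W x)
    (hWV : ∀ x ∈ hs n, |W x| ≤ V x) (h : Sch N) (hodd : IsOdd n h) :
    ∫ x, (W x * h x) ^ 2 ≤ ∫ x, lap h x ^ 2 := by
  have hh2 : ContDiff ℝ 2 h := h.smooth 2
  have hhc : Continuous h := h.continuous
  have hm := (isOpen_hs n).measurableSet
  have hi1 : Integrable fun x => (W x * h x) ^ 2 := by
    refine Continuous.integrable_of_hasCompactSupport (by fun_prop) ?_
    refine hWc.mono fun x hx => ?_
    simp only [Function.mem_support] at hx ⊢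
    intro h0; exact hx (by simp [h0])
  have hlapeq : (slap h : Eu N → ℝ) = lap h := funext (slap_apply h)
  have hi2 : Integrable fun x => lap h x ^ 2 := by
    rw [← hlapeq]; exact ((slap h).memLp 2).integrable_sq
  have hlo : ∀ x, lap h (refl n x) = - lap h x := by
    intro x
    rw [← lap_comp_refl]
    rw [show (fun y => h (refl n y)) = fun y => (-1) * h y from funext fun y => by rw [hodd y]; ring]
    simp only [lap_eq_sum_pd]
    rw [← Finset.sum_neg_distrib]
    refine Finset.sum_congr rfl fun i _ => ?_
    rw [show pd i (fun y => (-1) * h y) = fun y => (-1) * pd i h y from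
      funext fun y => pd_const_mul _ _, pd_const_mul]; ring
  rw [integral_eq_two_mul_of_even hi1 (fun x => by rw [hWe, hodd x]; ring),
    integral_eq_two_mul_of_even hi2 (fun x => by rw [hlo]; ring)]
  refine mul_le_mul_of_nonneg_left ?_ zero_le_two
  obtain ⟨R, hR0, hR⟩ := exists_radius_of_hasCompactSupport hWc
  refine ge_of_tendsto (tendsto_integral_lap_cut n h) ?_
  have : ∀ᶠ k : ℕ in atTop, R < k := tendsto_natCast_atTop_atTop.eventually_gt_atTop _
  filter_upwards [this] with k hk
  have hk0 : (0 : ℝ) < (k : ℝ) + 1 := by positivity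
  have hcs : HasCompactSupport fun y => h y * cut ((k : ℝ) + 1) y :=
    (hasCompactSupport_cut hk0).mul_left
  have hsm : ContDiff ℝ (⊤ : ℕ∞) fun y => h y * cut ((k : ℝ) + 1) y :=
    (h.smooth ⊤).mul (contDiff_cut _)
  refine le_trans ?_ (hstab _ hsm hcs ?_)
  · refine setIntegral_mono_on hi1.integrableOn ?_ hm fun x hx => ?_
    · refine (Continuous.integrable_of_hasCompactSupport ?_ ?_).integrableOn
      · have := hsm.continuous; fun_prop
      · refine hcs.mono fun x hx => ?_
        simp only [Function.mem_support] at hx ⊢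
        intro h0; exact hx (by simp [h0])
    · by_cases hxR : ‖x‖ ≤ (k : ℝ) + 1
      · rw [cut_eq_one hk0 hxR, mul_one, mul_pow, mul_pow, ← sq_abs (W x)]
        have := hWV x hx
        gcongr
      · rw [hR x (by linarith)]; simp; positivity
  · intro x hx
    have h1 := hodd x
    rw [refl_eq_self hx] at h1
    have : h x = 0 := by linarith
    rw [this, zero_mul]

theorem exists_smooth_below {n : Fin N} {V : Eu N → ℝ} (hV : Continuous V)
    (hVpos : ∀ x ∈ hs n, 0 < V x) {δ ε : ℝ} (hδ : 0 < δ) (hε : 0 < ε) :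
    ∃ g : Eu N → ℝ, ContDiff ℝ (⊤ : ℕ∞) g ∧
      ∀ x : Eu N, δ ≤ x n → 0 < g x ∧ V x - ε < g x ∧ g x < V x := by
  obtain ⟨g, hg⟩ := exists_contMDiffMap_forall_mem_convex_of_local_const
    (n := (⊤ : ℕ∞)) (modelWithCornersSelf ℝ (Eu N)) (F := ℝ)
    (t := fun x : Eu N => {y : ℝ | δ ≤ x n → y ∈ Ioo (max 0 (V x - ε)) (V x)})
    (fun x => by
      by_cases h : δ ≤ x n
      · simp only [h, true_imp_iff]
        exact convex_Ioo _ _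
      · simpa [h] using convex_univ)
    (fun x => by
      by_cases h : δ ≤ x n
      · have h1 : max 0 (V x - ε) < V x := max_lt (hVpos x (lt_of_lt_of_le hδ h)) (by linarith)
        obtain ⟨c, hc1, hc2⟩ := exists_between h1
        refine ⟨c, ?_⟩
        have e1 : ∀ᶠ y in 𝓝 x, max 0 (V y - ε) < c :=
          (by fun_prop : ContinuousAt (fun y => max 0 (V y - ε)) x).eventually_lt_const hc1
        have e2 : ∀ᶠ y in 𝓝 x, c < V y := hV.continuousAt.eventually_const_lt hc2
        filter_upwards [e1, e2] with y h1 h2 _ using ⟨h1, h2⟩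
      · refine ⟨0, ?_⟩
        have e1 : ∀ᶠ y : Eu N in 𝓝 x, y n < δ :=
          (by fun_prop : ContinuousAt (fun y : Eu N => y n) x).eventually_lt_const (not_le.mp h)
        filter_upwards [e1] with y h1 h2 using absurd h2 (not_le.mpr h1))
  refine ⟨g, g.contMDiff.contDiff, fun x hx => ?_⟩
  have := hg x hx
  exact ⟨(le_max_left _ _).trans_lt this.1, (le_max_right _ _).trans_lt this.1, this.2⟩

theorem exists_smooth_even_weight {n : Fin N} {V : Eu N → ℝ} (hV : Continuous V)
    (hVpos : ∀ x ∈ hs n, 0 < V x) {δ ε R : ℝ} (hδ : 0 < δ) (hε : 0 < ε) (hR : 0 < R) :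
    ∃ W : Eu N → ℝ, ContDiff ℝ (⊤ : ℕ∞) W ∧ HasCompactSupport W ∧ (∀ x, 0 ≤ W x) ∧
      (∀ x, W (refl n x) = W x) ∧ (∀ x ∈ hs n, W x ≤ V x) ∧
      ∀ x : Eu N, δ ≤ x n → ‖x‖ ≤ R → V x - ε ≤ W x := by
  obtain ⟨g, hg, hgx⟩ := exists_smooth_below hV hVpos (half_pos hδ) hε
  set s : Eu N → ℝ := fun x => Real.smoothTransition (2 / δ * x n - 1) with hs'
  have hs0 : ∀ x : Eu N, x n ≤ δ / 2 → s x = 0 := by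
    intro x hx
    refine Real.smoothTransition.zero_of_nonpos ?_
    have : 2 / δ * x n ≤ 2 / δ * (δ / 2) := by gcongr
    have h2 : 2 / δ * (δ / 2) = 1 := by field_simp
    linarith
  have hs1 : ∀ x : Eu N, δ ≤ x n → s x = 1 := by
    intro x hx
    refine Real.smoothTransition.one_of_one_le ?_
    have : 2 / δ * δ ≤ 2 / δ * x n := by gcongr
    have h2 : 2 / δ * δ = 2 := by field_simp
    linarith
  have hss : ContDiff ℝ (⊤ : ℕ∞) s := by
    refine Real.smoothTransition.contDiff.comp ?_
    fun_prop
  set W₀ : Eu N → ℝ := fun x => cut R x * s x * g x with hW₀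
  have hW₀s : ContDiff ℝ (⊤ : ℕ∞) W₀ := ((contDiff_cut R).mul hss).mul hg
  have hW₀c : HasCompactSupport W₀ := by
    refine (hasCompactSupport_cut hR).mono fun x hx => ?_
    simp only [Function.mem_support, hW₀] at hx ⊢
    intro h; exact hx (by simp [h])
  have hW₀0 : ∀ x : Eu N, x n ≤ δ / 2 → W₀ x = 0 := fun x hx => by simp [hW₀, hs0 x hx]
  have hcs : ∀ x, 0 ≤ cut R x * s x ∧ cut R x * s x ≤ 1 := fun x =>
    ⟨mul_nonneg (cut_nonneg _ _) (Real.smoothTransition.nonneg _),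
      mul_le_one₀ (cut_le_one _ _) (Real.smoothTransition.nonneg _)
        (Real.smoothTransition.le_one _)⟩
  have hW₀n : ∀ x, 0 ≤ W₀ x := by
    intro x
    rcases le_total (x n) (δ / 2) with h | h
    · rw [hW₀0 x h]
    · exact mul_nonneg (hcs x).1 (hgx x h).1.le
  have hin : ∀ x : Eu N, 0 ≤ x n → W₀ (refl n x) = 0 := by
    intro x hx
    refine hW₀0 _ ?_
    rw [refl_coord]; linarith
  refine ⟨fun x => W₀ x + W₀ (refl n x), ?_, ?_, fun x => add_nonneg (hW₀n _) (hW₀n _), ?_, ?_, ?_⟩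
  · exact hW₀s.add (hW₀s.comp (refl n).contDiff)
  · exact hW₀c.add (hW₀c.comp_homeomorph (refl n).toHomeomorph)
  · intro x; simp only [refl_refl]; ring
  · intro x hx
    have hx' : 0 < x n := hx
    simp only [hin x hx'.le, add_zero]
    rcases le_total (x n) (δ / 2) with h | h
    · rw [hW₀0 x h]; exact (hVpos x hx).le
    · exact (mul_le_of_le_one_left (hgx x h).1.le (hcs x).2).trans (hgx x h).2.2.le
  · intro x hx hxR
    simp only [hin x (by linarith), add_zero]
    simp only [hW₀, hs1 x hx, cut_eq_one hR hxR, one_mul]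
    exact (hgx x (by linarith)).2.1.le

/-- Stability implies a first order inequality, for smooth functions supported inside. -/
theorem first_order_smooth {n : Fin N} {V : Eu N → ℝ} (hV : Continuous V)
    (hVpos : ∀ x ∈ hs n, 0 < V x)
    (hstab : ∀ φ : Eu N → ℝ, ContDiff ℝ (⊤ : ℕ∞) φ → HasCompactSupport φ →
      (∀ x, x n = 0 → φ x = 0) → ∫ x in hs n, (V x * φ x) ^ 2 ≤ ∫ x in hs n, lap φ x ^ 2)
    {φ : Eu N → ℝ} (hφ : ContDiff ℝ (⊤ : ℕ∞) φ) (hc : HasCompactSupport φ) {δ : ℝ} (hδ : 0 < δ)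
    (h0 : ∀ x : Eu N, x n < δ → φ x = 0) :
    ∫ x in hs n, V x * φ x ^ 2 ≤ ∫ x in hs n, ∑ i, pd i φ x ^ 2 := by
  have hm := (isOpen_hs n).measurableSet
  obtain ⟨R, hR0, hR⟩ := exists_radius_of_hasCompactSupport hc
  have hφcont := hφ.continuous
  have hcsq : ∀ U : Eu N → ℝ, Continuous U → Integrable fun x => U x * φ x ^ 2 := by
    intro U hU
    refine Continuous.integrable_of_hasCompactSupport (by fun_prop) (hc.mono fun x hx => ?_)
    simp only [Function.mem_support] at hx ⊢
    intro h; exact hx (by simp [h])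
  have main : ∀ ε : ℝ, 0 < ε → ∫ x in hs n, V x * φ x ^ 2
      ≤ ε * (∫ x in hs n, φ x ^ 2) + ∫ x in hs n, ∑ i, pd i φ x ^ 2 := by
    intro ε hε
    obtain ⟨W, hW, hWc, hW0, hWe, hWV, hWε⟩ := exists_smooth_even_weight hV hVpos hδ hε hR0
    set ψ : Eu N → ℝ := fun x => φ x - φ (refl n x) with hψ
    have hψs : ContDiff ℝ (⊤ : ℕ∞) ψ := hφ.sub (hφ.comp (refl n).contDiff)
    have hψc : HasCompactSupport ψ := hc.sub (hc.comp_homeomorph (refl n).toHomeomorph)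
    set Ψ : Sch N := hψc.toSchwartzMap hψs with hΨ
    have hΨx : ∀ x, Ψ x = ψ x := fun x => rfl
    have hΨe : (Ψ : Eu N → ℝ) = ψ := rfl
    have hodd : IsOdd n Ψ := by
      intro x; simp only [hΨx, hψ, refl_refl]; ring
    have hψin : ∀ x ∈ hs n, ψ x = φ x := by
      intro x hx
      have hx' : 0 < x n := hx
      have : φ (refl n x) = 0 := h0 _ (by rw [refl_coord]; linarith)
      simp [hψ, this]
    have hpdin : ∀ x ∈ hs n, ∀ i, pd i ψ x = pd i φ x := by
      intro x hx i
      exact pd_congr (((isOpen_hs n).eventually_mem hx).mono hψin) i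
    have hodd2 : ∀ i x, pd i Ψ (refl n x) ^ 2 = pd i Ψ x ^ 2 := by
      intro i x
      have h1 := pd_comp_refl n i Ψ x
      rw [show (fun y => Ψ (refl n y)) = fun y => - Ψ y from funext hodd, pd_neg] at h1
      split_ifs at h1
      · have : pd i Ψ (refl n x) = pd i Ψ x := by linarith
        rw [this]
      · have : pd i Ψ (refl n x) = - pd i Ψ x := by linarith
        rw [this]; ring
    have hpi : ∀ i, Integrable fun x => pd i Ψ x ^ 2 := by
      intro i; rw [← spd_coe]; exact ((spd i Ψ).memLp 2).integrable_sq
    have key := odd_sqrt_inequality hW hWc hW0 hWe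
      (fun h hh => odd_rellich hV hstab hW.continuous hWc hWe
        (fun x hx => by rw [abs_of_nonneg (hW0 x)]; exact hWV x hx) h hh) Ψ hodd
    have hWi : Integrable fun x => W x * Ψ x ^ 2 := by
      refine Continuous.integrable_of_hasCompactSupport ?_ ?_
      · have := hW.continuous
        have := Ψ.continuous
        fun_prop
      · refine hWc.mono fun x hx => ?_
        simp only [Function.mem_support] at hx ⊢
        intro h; exact hx (by simp [h])
    rw [integral_eq_two_mul_of_even hWi (fun x => by rw [hWe, hodd x]; ring)] at key
    rw [Finset.sum_congr rfl fun i _ => integral_eq_two_mul_of_even (n := n) (hpi i) (hodd2 i),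
      ← Finset.mul_sum] at key
    have key2 : ∫ x in hs n, W x * φ x ^ 2 ≤ ∫ x in hs n, ∑ i, pd i φ x ^ 2 := by
      have e1 : ∫ x in hs n, W x * φ x ^ 2 = ∫ x in hs n, W x * Ψ x ^ 2 :=
        setIntegral_congr_fun hm fun x hx => by simp only [hΨx, hψin x hx]
      have e2 : ∫ x in hs n, ∑ i, pd i φ x ^ 2 = ∑ i, ∫ x in hs n, pd i Ψ x ^ 2 := by
        rw [← integral_finsetSum _ fun i _ => (hpi i).integrableOn]
        exact setIntegral_congr_fun hm fun x hx => by simp only [hΨe, hpdin x hx]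
      rw [e1, e2]; linarith
    have key3 : ∫ x in hs n, V x * φ x ^ 2 ≤ ∫ x in hs n, (ε * φ x ^ 2 + W x * φ x ^ 2) := by
      refine setIntegral_mono_on (hcsq V hV).integrableOn
        (((hcsq (fun _ => ε) continuous_const).add (hcsq W hW.continuous)).integrableOn) hm ?_
      intro x hx
      by_cases hx0 : φ x = 0
      · simp [hx0]
      · have h1 : δ ≤ x n := by by_contra h; exact hx0 (h0 x (not_le.mp h))
        have h2 : ‖x‖ ≤ R := by by_contra h; exact hx0 (hR x (not_le.mp h).le)
        have := hWε x h1 h2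
        rw [← add_mul]
        exact mul_le_mul_of_nonneg_right (by linarith) (sq_nonneg _)
    rw [integral_add (hcsq (fun _ => ε) continuous_const).integrableOn
      (hcsq W hW.continuous).integrableOn, integral_const_mul] at key3
    linarith
  refine le_of_forall_pos_le_add fun η hη => ?_
  set I := ∫ x in hs n, φ x ^ 2 with hI
  have hI0 : 0 ≤ I := integral_nonneg fun x => sq_nonneg _
  refine (main (η / (I + 1)) (by positivity)).trans ?_
  have : η / (I + 1) * I ≤ η := by
    rw [div_mul_eq_mul_div, div_le_iff₀ (by positivity)]; nlinarith
  linarith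

theorem first_order_C1 {n : Fin N} {V : Eu N → ℝ} (hV : Continuous V)
    (hVpos : ∀ x ∈ hs n, 0 < V x)
    (hstab : ∀ φ : Eu N → ℝ, ContDiff ℝ (⊤ : ℕ∞) φ → HasCompactSupport φ →
      (∀ x, x n = 0 → φ x = 0) → ∫ x in hs n, (V x * φ x) ^ 2 ≤ ∫ x in hs n, lap φ x ^ 2)
    {φ : Eu N → ℝ} (hφ : ContDiff ℝ 1 φ) (hc : HasCompactSupport φ) {δ : ℝ} (hδ : 0 < δ)
    (h0 : ∀ x : Eu N, x n < δ → φ x = 0) :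
    ∫ x in hs n, V x * φ x ^ 2 ≤ ∫ x in hs n, ∑ i, pd i φ x ^ 2 := by
  obtain ⟨R, hR0, hR⟩ := exists_radius_of_hasCompactSupport hc
  set d : ℝ := min 1 (δ / 2) with hd
  have hd0 : 0 < d := lt_min one_pos (half_pos hδ)
  have hex : ∀ k : ℕ, ∃ g : Eu N → ℝ, ContDiff ℝ (⊤ : ℕ∞) g ∧
      (∀ x, |g x - φ x| ≤ d * (1 / ((k : ℝ) + 1))) ∧
      (∀ i x, |pd i g x - pd i φ x| ≤ d * (1 / ((k : ℝ) + 1))) ∧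
      ∀ x, (∀ y, dist y x < d * (1 / ((k : ℝ) + 1)) → φ y = 0) → g x = 0 := fun k =>
    exists_smooth_approx_one hφ hc (by positivity)
  choose g hg hg0 hg1 hgs using hex
  have hle : ∀ k : ℕ, d * (1 / ((k : ℝ) + 1)) ≤ d := by
    intro k
    refine mul_le_of_le_one_right hd0.le ?_
    rw [div_le_one (by positivity)]; linarith [(Nat.cast_nonneg k : (0 : ℝ) ≤ k)]
  have hgR : ∀ k x, R + 1 ≤ ‖x‖ → g k x = 0 := by
    intro k x hx
    refine hgs k x fun y hy => hR y ?_
    have h1 : ‖x - y‖ < 1 := by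
      rw [← dist_eq_norm, dist_comm]; exact hy.trans_le ((hle k).trans (min_le_left _ _))
    have := norm_sub_norm_le x y
    linarith
  have hgδ : ∀ k (x : Eu N), x n < δ / 2 → g k x = 0 := by
    intro k x hx
    refine hgs k x fun y hy => h0 y ?_
    have h1 : ‖(y - x) n‖ ≤ ‖y - x‖ := PiLp.norm_apply_le _ _
    rw [← dist_eq_norm y x] at h1
    have h2 := (abs_le.mp h1).2
    have h3 : dist y x < δ / 2 := hy.trans_le ((hle k).trans (min_le_right _ _))
    simp only [PiLp.sub_apply] at h2
    linarith
  have hgpR : ∀ k i x, R + 2 ≤ ‖x‖ → pd i (g k) x = 0 := by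
    intro k i x hx
    have : ∀ᶠ y in 𝓝 x, R + 1 < ‖y‖ :=
      continuous_norm.continuousAt.eventually_const_lt (by linarith)
    rw [pd_congr (this.mono fun y hy => hgR k y hy.le) i, pd_const]
  have hpc : ∀ i, Continuous (pd i φ) := fun i =>
    (contDiff_pd (m := 0) hφ (by norm_num) i).continuous
  have hgpc : ∀ k i, Continuous (pd i (g k)) := fun k i => (contDiff_pd_top (hg k) i).continuous
  have hsumeq : ∀ f : Eu N → ℝ, (∀ i, Continuous (pd i f)) → (∀ i, HasCompactSupport (pd i f)) →
      ∫ x in hs n, ∑ i, pd i f x ^ 2 = ∑ i, ∫ x in hs n, (fun _ => (1 : ℝ)) x * pd i f x ^ 2 := by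
    intro f hf hfc
    simp only [one_mul]
    refine integral_finsetSum _ fun i _ => ?_
    refine (Continuous.integrable_of_hasCompactSupport ((hf i).pow 2) ?_).integrableOn
    refine (hfc i).mono fun x hx => ?_
    simp only [Function.mem_support] at hx ⊢
    intro h; exact hx (by simp [h])
  have l1 := tendsto_setIntegral_mul_sq (hs n) hV hφ.continuous (fun k => (hg k).continuous)
    hg0 hgR
  have l2 : ∀ i ∈ Finset.univ, Tendsto (fun k => ∫ x in hs n, (fun _ => (1 : ℝ)) x * pd i (g k) x ^ 2)
      atTop (𝓝 (∫ x in hs n, (fun _ => (1 : ℝ)) x * pd i φ x ^ 2)) := fun i _ => tendsto_setIntegral_mul_sq (hs n) (W := fun _ => (1 : ℝ))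
    continuous_const (hpc i) (fun k => hgpc k i) (fun k => hg1 k i) (fun k => hgpR k i)
  have l3 := tendsto_finsetSum Finset.univ l2
  rw [hsumeq φ hpc fun i => hasCompactSupport_pd hc i]
  refine le_of_tendsto_of_tendsto l1 l3 (Eventually.of_forall fun k => ?_)
  have hgc := hasCompactSupport_of_radius (hgR k)
  simp only
  rw [← hsumeq (g k) (hgpc k) fun i => hasCompactSupport_pd hgc i]
  exact first_order_smooth hV hVpos hstab (hg k) hgc (half_pos hδ) (hgδ k)

theorem exists_truncation {ε : ℝ} (hε : 0 < ε) : ∃ γ : ℝ → ℝ, ContDiff ℝ 1 γ ∧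
    (∀ t, t ≤ ε → γ t = 0) ∧ (∀ t, 0 ≤ t → 0 ≤ γ t ∧ γ t ≤ t ∧ t ≤ γ t + 2 * ε) ∧
    ∀ t, |deriv γ t| ≤ 1 := by
  set k : ℝ → ℝ := fun s => min 1 (max 0 (s / ε - 1)) with hk
  have hkc : Continuous k := by fun_prop
  have hk0 : ∀ s, 0 ≤ k s := fun s => le_min zero_le_one (le_max_left _ _)
  have hk1 : ∀ s, k s ≤ 1 := fun s => min_le_left _ _
  have hkz : ∀ s, s ≤ ε → k s = 0 := by
    intro s hs
    have : s / ε ≤ 1 := (div_le_one hε).mpr hs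
    simp only [hk]
    rw [max_eq_left (by linarith), min_eq_right zero_le_one]
  have hko : ∀ s, 2 * ε ≤ s → k s = 1 := by
    intro s hs
    have : 2 ≤ s / ε := (le_div_iff₀ hε).mpr hs
    simp only [hk]
    exact min_eq_left (le_max_of_le_right (by linarith))
  have hi : ∀ a b : ℝ, IntervalIntegrable k volume a b := fun a b => hkc.intervalIntegrable _ _
  have hder : ∀ t, HasDerivAt (fun t => ∫ s in (0 : ℝ)..t, k s) (k t) t := fun t =>
    intervalIntegral.integral_hasDerivAt_right (hi _ _)
      hkc.stronglyMeasurable.stronglyMeasurableAtFilter hkc.continuousAt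
  have hderiv : deriv (fun t => ∫ s in (0 : ℝ)..t, k s) = k := funext fun t => (hder t).deriv
  have hnn : ∀ t, 0 ≤ t → 0 ≤ ∫ s in (0 : ℝ)..t, k s := fun t ht =>
    intervalIntegral.integral_nonneg ht fun s _ => hk0 s
  refine ⟨fun t => ∫ s in (0 : ℝ)..t, k s, ?_, ?_, ?_, ?_⟩
  · rw [contDiff_one_iff_deriv, hderiv]
    exact ⟨fun t => (hder t).differentiableAt, hkc⟩
  · intro t ht
    beta_reduce
    rw [intervalIntegral.integral_congr (g := fun _ => 0), intervalIntegral.integral_zero]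
    intro s hs
    refine hkz s ?_
    rcases hs with ⟨_, h2⟩
    exact h2.trans (max_le hε.le ht)
  · intro t ht
    refine ⟨hnn t ht, ?_, ?_⟩
    · have := intervalIntegral.integral_mono_on ht (hi 0 t)
        (intervalIntegrable_const (c := (1 : ℝ))) fun s _ => hk1 s
      simpa using this
    · rcases le_total t (2 * ε) with h | h
      · linarith [hnn t ht]
      · beta_reduce
        rw [← intervalIntegral.integral_add_adjacent_intervals (hi 0 (2 * ε)) (hi (2 * ε) t)]
        rw [intervalIntegral.integral_congr (a := 2 * ε) (b := t) (g := fun _ => 1)]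
        · have := hnn (2 * ε) (by linarith)
          simp; linarith
        · intro s hs
          rw [uIcc_of_le h] at hs
          exact hko s hs.1
  · intro t
    rw [hderiv, abs_of_nonneg (hk0 t)]; exact hk1 t

/-- Stability implies a first order inequality. -/
theorem first_order {n : Fin N} {V : Eu N → ℝ} (hV : Continuous V)
    (hVpos : ∀ x ∈ hs n, 0 < V x)
    (hstab : ∀ φ : Eu N → ℝ, ContDiff ℝ (⊤ : ℕ∞) φ → HasCompactSupport φ →
      (∀ x, x n = 0 → φ x = 0) → ∫ x in hs n, (V x * φ x) ^ 2 ≤ ∫ x in hs n, lap φ x ^ 2)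
    {φ : Eu N → ℝ} (hφc : ContinuousOn φ (chs n)) (hφ : ContDiffOn ℝ 1 φ (hs n))
    (hnn : ∀ x ∈ hs n, 0 ≤ φ x) (h0 : ∀ x : Eu N, x n = 0 → φ x = 0) {R : ℝ}
    (hR : ∀ x ∈ hs n, R ≤ ‖x‖ → φ x = 0)
    (hbd : ∀ i, ∃ C, ∀ x ∈ hs n, |pd i φ x| ≤ C) :
    ∫ x in hs n, V x * φ x ^ 2 ≤ ∫ x in hs n, ∑ i, pd i φ x ^ 2 := by
  have hm := (isOpen_hs n).measurableSet
  have hat : ∀ x ∈ hs n, ContDiffAt ℝ 1 φ x := fun x hx =>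
    hφ.contDiffAt ((isOpen_hs n).mem_nhds hx)
  have hpc : ∀ i, ContinuousOn (pd i φ) (hs n) := fun i =>
    (hφ.continuousOn_fderiv_of_isOpen (isOpen_hs n) (by norm_num)).clm_apply continuousOn_const
  have hRp : ∀ i, ∀ x ∈ hs n, R + 1 ≤ ‖x‖ → pd i φ x = 0 := by
    intro i x hx hxR
    have e1 : ∀ᶠ y in 𝓝 x, R < ‖y‖ :=
      continuous_norm.continuousAt.eventually_const_lt (by linarith)
    have e2 : φ =ᶠ[𝓝 x] fun _ => 0 := by
      filter_upwards [e1, (isOpen_hs n).mem_nhds hx] with y h1 h2 using hR y h2 h1.le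
    rw [pd_congr e2 i, pd_const]
  have hgn : Nice n fun x => ∑ i, pd i φ x ^ 2 := by
    refine Nice.sum fun i _ => ⟨(hpc i).pow 2, ?_, R + 1, fun x hx h => by simp [hRp i x hx h]⟩
    obtain ⟨C, hC⟩ := hbd i
    refine ⟨C ^ 2, fun x hx => ?_⟩
    rw [abs_pow]; exact pow_le_pow_left₀ (abs_nonneg _) (hC x hx) 2
  have hVφ : Nice n fun x => V x * φ x :=
    nice_of_continuousOn (hV.continuousOn.mul hφc) (R := R) fun x hx h => by simp [hR x hx h]
  have hVφ2 : Nice n fun x => V x * φ x ^ 2 :=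
    nice_of_continuousOn (hV.continuousOn.mul (hφc.pow 2)) (R := R)
      fun x hx h => by simp [hR x hx h]
  have main : ∀ ε : ℝ, 0 < ε → ∫ x in hs n, V x * φ x ^ 2
      ≤ 4 * ε * (∫ x in hs n, V x * φ x) + ∫ x in hs n, ∑ i, pd i φ x ^ 2 := by
    intro ε hε
    obtain ⟨γ, hγ, hγ0, hγ1, hγ2⟩ := exists_truncation hε
    set ψ : Eu N → ℝ := (hs n).indicator fun x => γ (φ x) with hψ
    obtain ⟨δ, hδ, hδψ⟩ : ∃ δ, 0 < δ ∧ ∀ x : Eu N, x n < δ → ψ x = 0 := by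
      set K : Set (Eu N) := {x | x ∈ chs n ∩ Metric.closedBall 0 R ∧ φ x ∈ Ici ε} with hK
      have hKc : IsCompact K := by
        have h1 : IsCompact (chs n ∩ Metric.closedBall (0 : Eu N) R) :=
          (isCompact_closedBall _ _).inter_left (isClosed_chs n)
        refine h1.of_isClosed_subset ?_ fun x hx => hx.1
        exact (hφc.mono inter_subset_left).preimage_isClosed_of_isClosed
          ((isClosed_chs n).inter Metric.isClosed_closedBall) isClosed_Ici
      have hzero : ∀ δ, (∀ x ∈ K, δ ≤ x n) → ∀ x : Eu N, x n < δ → ψ x = 0 := by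
        intro δ hδ x hx
        by_cases hxs : x ∈ hs n
        · rw [hψ, indicator_of_mem hxs]
          refine hγ0 _ ?_
          by_contra hlt
          push Not at hlt
          have : ‖x‖ ≤ R := by
            by_contra h
            rw [hR x hxs (not_le.mp h).le] at hlt; linarith
          have := hδ x ⟨⟨hs_subset_chs n hxs, by simpa using this⟩, hlt.le⟩
          linarith
        · rw [hψ, indicator_of_notMem hxs]
      rcases K.eq_empty_or_nonempty with he | hne
      · exact ⟨1, one_pos, hzero 1 (by simp [he])⟩
      · obtain ⟨x₀, hx₀, hmin⟩ := hKc.exists_isMinOn hne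
          (f := fun x : Eu N => x n) (by fun_prop)
        refine ⟨x₀ n, ?_, hzero _ fun x hx => hmin hx⟩
        have h1 : 0 ≤ x₀ n := hx₀.1.1
        refine lt_of_le_of_ne h1 fun h => ?_
        have h2 : ε ≤ φ x₀ := hx₀.2
        rw [h0 x₀ h.symm] at h2
        linarith
    have hloc : ∀ x ∈ hs n, ψ =ᶠ[𝓝 x] fun y => γ (φ y) := fun x hx => by
      filter_upwards [(isOpen_hs n).mem_nhds hx] with y hy
      rw [hψ, indicator_of_mem hy]
    have hψc : ContDiff ℝ 1 ψ := by
      rw [contDiff_iff_contDiffAt]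
      intro x
      by_cases hx : x ∈ hs n
      · exact (hγ.contDiffAt.comp x (hat x hx)).congr_of_eventuallyEq (hloc x hx)
      · have hx' : x n < δ := lt_of_le_of_lt (not_lt.mp hx) hδ
        have e1 : ∀ᶠ y : Eu N in 𝓝 x, y n < δ :=
          (by fun_prop : ContinuousAt (fun y : Eu N => y n) x).eventually_lt_const hx'
        exact (contDiffAt_const (c := (0 : ℝ))).congr_of_eventuallyEq
          (e1.mono fun y hy => hδψ y hy)
    have hψs : HasCompactSupport ψ := by
      refine hasCompactSupport_of_radius (R := R) fun x hx => ?_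
      by_cases hxs : x ∈ hs n
      · rw [hψ, indicator_of_mem hxs, hR x hxs hx]; exact hγ0 0 hε.le
      · rw [hψ, indicator_of_notMem hxs]
    have key := first_order_C1 hV hVpos hstab hψc hψs hδ hδψ
    have k1 : ∫ x in hs n, ∑ i, pd i ψ x ^ 2 ≤ ∫ x in hs n, ∑ i, pd i φ x ^ 2 := by
      refine setIntegral_mono_on ?_ hgn.integrableOn hm fun x hx => Finset.sum_le_sum fun i _ => ?_
      · refine (Continuous.integrable_of_hasCompactSupport ?_ ?_).integrableOn
        · exact continuous_finsetSum _ fun i _ =>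
            (contDiff_pd (m := 0) hψc (by norm_num) i).continuous.pow 2
        · obtain ⟨R', _, hR'⟩ := exists_radius_of_hasCompactSupport hψs
          refine hasCompactSupport_of_radius (R := R' + 1) fun x hx => ?_
          refine Finset.sum_eq_zero fun i _ => ?_
          have e1 : ∀ᶠ y in 𝓝 x, R' < ‖y‖ :=
            continuous_norm.continuousAt.eventually_const_lt (by linarith)
          rw [pd_congr (e1.mono fun y hy => hR' y hy.le) i, pd_const]; norm_num
      · rw [pd_congr (hloc x hx) i, pd_comp ((hat x hx).differentiableAt (by norm_num))
          ((hγ.differentiable (by norm_num)) (φ x)).hasDerivAt i, mul_pow]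
        refine mul_le_of_le_one_left (sq_nonneg _) ?_
        rw [← sq_abs]; exact pow_le_one₀ (abs_nonneg _) (hγ2 _)
    have k2 : ∫ x in hs n, V x * φ x ^ 2
        ≤ ∫ x in hs n, (4 * ε * (V x * φ x) + V x * ψ x ^ 2) := by
      have hVψ : IntegrableOn (fun x => V x * ψ x ^ 2) (hs n) := by
        refine (Continuous.integrable_of_hasCompactSupport ?_ ?_).integrableOn
        · have := hψc.continuous; fun_prop
        · refine hψs.mono fun x hx => ?_
          simp only [Function.mem_support] at hx ⊢
          intro h; exact hx (by simp [h])
      refine setIntegral_mono_on hVφ2.integrableOn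
        ((hVφ.const_mul (4 * ε)).integrableOn.add hVψ) hm fun x hx => ?_
      rw [hψ, indicator_of_mem hx]
      obtain ⟨h1, h2, h3⟩ := hγ1 _ (hnn x hx)
      have h4 := hVpos x hx
      have h5 : φ x ^ 2 ≤ 4 * ε * φ x + γ (φ x) ^ 2 := by nlinarith
      nlinarith
    have hVψ : IntegrableOn (fun x => V x * ψ x ^ 2) (hs n) := by
      refine (Continuous.integrable_of_hasCompactSupport ?_ ?_).integrableOn
      · have := hψc.continuous; fun_prop
      · refine hψs.mono fun x hx => ?_
        simp only [Function.mem_support] at hx ⊢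
        intro h; exact hx (by simp [h])
    rw [integral_add (hVφ.const_mul (4 * ε)).integrableOn hVψ, integral_const_mul] at k2
    linarith
  refine le_of_forall_pos_le_add fun η hη => ?_
  set I := ∫ x in hs n, V x * φ x with hI
  have hI0 : 0 ≤ I := setIntegral_nonneg hm fun x hx => mul_nonneg (hVpos x hx).le (hnn x hx)
  refine (main (η / (4 * (I + 1))) (by positivity)).trans ?_
  have : 4 * (η / (4 * (I + 1))) * I ≤ η := by
    rw [show 4 * (η / (4 * (I + 1))) * I = η * I / (I + 1) by field_simp,
      div_le_iff₀ (by positivity)]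
    nlinarith
  linarith

/-- A classical stable solution of the Navier problem on the half space `hs n`. -/
structure Sol (n : Fin N) (p : ℝ) (u : Eu N → ℝ) : Prop where
  hp : 1 < p
  smooth : ContDiff ℝ 4 u
  pos : ∀ x ∈ hs n, 0 < u x
  eqn : ∀ x ∈ hs n, lap (lap u) x = u x ^ p
  bdry : ∀ x : Eu N, x n = 0 → u x = 0
  bdry_lap : ∀ x : Eu N, x n = 0 → lap u x = 0
  stab : ∀ φ : Eu N → ℝ, ContDiff ℝ 2 φ → HasCompactSupport φ → (∀ x : Eu N, x n = 0 → φ x = 0) →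
    p * ∫ x in hs n, u x ^ (p - 1) * φ x ^ 2 ≤ ∫ x in hs n, lap φ x ^ 2

theorem integral_sum_pd_eq_zero {n : Fin N} {F : Fin N → Eu N → ℝ}
    (hF : ∀ i, ContinuousOn (F i) (chs n)) (hF0 : ∀ i (x : Eu N), x n = 0 → F i x = 0) {R : ℝ}
    (hR : ∀ i, ∀ x ∈ hs n, R ≤ ‖x‖ → F i x = 0)
    (hd : ∀ i, ∀ x ∈ hs n, DifferentiableAt ℝ (F i) x)
    (hF' : ∀ i, Nice n (pd i (F i))) :
    ∫ x in hs n, ∑ i, pd i (F i) x = 0 := by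
  rw [integral_finsetSum _ fun i _ => (hF' i).integrableOn]
  exact Finset.sum_eq_zero fun i _ => integral_pd_eq_zero i (hF i) (hF0 i) (hR i)
    (fun x hx => hasDerivAt_line_of_hasFDerivAt (hd i x hx) i) (hF' i).bdd

theorem nice_of_continuous {n : Fin N} {f : Eu N → ℝ} (hf : Continuous f)
    (hc : HasCompactSupport f) : Nice n f := by
  obtain ⟨R, _, hR⟩ := exists_radius_of_hasCompactSupport hc
  exact nice_of_continuousOn hf.continuousOn (R := R) fun x _ h => hR x h

theorem integral_sum_pd_eq_zero_of_contDiff {n : Fin N} {F : Fin N → Eu N → ℝ}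
    (hF : ∀ i, ContDiff ℝ 1 (F i)) (hF0 : ∀ i (x : Eu N), x n = 0 → F i x = 0)
    (hc : ∀ i, HasCompactSupport (F i)) :
    ∫ x in hs n, ∑ i, pd i (F i) x = 0 := by
  have hN : ∀ i, Nice n (pd i (F i)) := fun i =>
    nice_of_continuous (contDiff_pd (m := 0) (hF i) (by norm_num) i).continuous
      (hasCompactSupport_pd (hc i) i)
  rw [integral_finsetSum _ fun i _ => (hN i).integrableOn]
  refine Finset.sum_eq_zero fun i _ => ?_
  obtain ⟨R, _, hR⟩ := exists_radius_of_hasCompactSupport (hc i)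
  exact integral_pd_eq_zero i (hF i).continuous.continuousOn (hF0 i) (R := R)
    (fun x _ h => hR x h)
    (fun x hx => hasDerivAt_line_of_hasFDerivAt ((hF i).differentiable (by norm_num) x) i) (hN i).bdd

theorem pd_pow {f : Eu N → ℝ} {x : Eu N} (hf : DifferentiableAt ℝ f x) (k : ℕ) (i : Fin N) :
    pd i (fun y => f y ^ (k + 1)) x = (k + 1) * f x ^ k * pd i f x := by
  have := pd_comp hf (γ := fun t => t ^ (k + 1)) (γ' := (k + 1) * f x ^ k)
    (by simpa using hasDerivAt_pow (k + 1) (f x)) i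
  exact this

theorem pd_pd_pow {f : Eu N → ℝ} (hf : ContDiff ℝ 2 f) (k : ℕ) (i : Fin N) (x : Eu N) :
    pd i (pd i fun y => f y ^ (k + 2)) x
      = (k + 2) * (k + 1) * f x ^ k * pd i f x ^ 2 + (k + 2) * f x ^ (k + 1) * pd i (pd i f) x := by
  have hd : Differentiable ℝ f := hf.differentiable (by norm_num)
  have hd2 : Differentiable ℝ (pd i f) :=
    (contDiff_pd (m := 1) hf (by norm_num) i).differentiable (by norm_num)
  have h1 : pd i (fun y => f y ^ (k + 2)) = fun y => (k + 2) * (f y ^ (k + 1) * pd i f y) := by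
    funext y
    have := pd_pow (hd y) (k + 1) i
    rw [this]; push_cast; ring
  rw [h1, pd_const_mul, pd_mul ((hd x).fun_pow _) (hd2 x), pd_pow (hd x)]
  ring

/-- Derivative bounds for powers of the cutoff. -/
theorem exists_cut_pow_bound (k : ℕ) : ∃ C : ℝ, 0 < C ∧ ∀ R : ℝ, 0 < R → ∀ x : Eu N,
    ∑ i, pd i (fun y => cut R y ^ (k + 2)) x ^ 2 ≤ C * R⁻¹ ^ 2 * (cut R x ^ (k + 1)) ^ 2 ∧
    |lap (fun y => cut R y ^ (k + 2)) x| ≤ C * R⁻¹ ^ 2 * cut R x ^ k := by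
  obtain ⟨C, hC, hb⟩ := exists_cut_bound (N := N)
  refine ⟨1 + N * ((k + 2) ^ 2 * C ^ 2) + N * ((k + 2) * (k + 1) * C ^ 2 + (k + 2) * C), by positivity,
    fun R hR x => ?_⟩
  have hρ : 0 < R⁻¹ := inv_pos.mpr hR
  have hc2 : ContDiff ℝ 2 (cut R : Eu N → ℝ) := (contDiff_cut R).of_le two_le_infty
  have hcd : Differentiable ℝ (cut R : Eu N → ℝ) := hc2.differentiable (by norm_num)
  have hz0 := cut_nonneg R x
  have hz1 := cut_le_one R x
  have b1 : ∀ i, |pd i (cut R) x| ≤ C * R⁻¹ := fun i => (hb R hR x i i).1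
  have b2 : ∀ i, |pd i (pd i (cut R)) x| ≤ C * R⁻¹ ^ 2 := fun i => by
    have := (hb R hR x i i).2
    rwa [div_eq_mul_inv, ← inv_pow] at this
  have b3 : ∀ i, pd i (cut R) x ^ 2 ≤ C ^ 2 * R⁻¹ ^ 2 := fun i => by
    rw [← sq_abs, ← mul_pow]; exact pow_le_pow_left₀ (abs_nonneg _) (b1 i) 2
  constructor
  · have : ∀ i ∈ Finset.univ, pd i (fun y => cut R y ^ (k + 2)) x ^ 2
        ≤ (k + 2) ^ 2 * C ^ 2 * (R⁻¹ ^ 2 * (cut R x ^ (k + 1)) ^ 2) := by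
      intro i _
      have h1 := pd_pow (hcd x) (k + 1) i
      push_cast at h1
      rw [show k + 2 = k + 1 + 1 from rfl, h1]
      calc ((k + 1 + 1 : ℝ) * cut R x ^ (k + 1) * pd i (cut R) x) ^ 2
          = (k + 2 : ℝ) ^ 2 * (cut R x ^ (k + 1)) ^ 2 * pd i (cut R) x ^ 2 := by ring
        _ ≤ (k + 2 : ℝ) ^ 2 * (cut R x ^ (k + 1)) ^ 2 * (C ^ 2 * R⁻¹ ^ 2) := by
            gcongr; exact b3 i
        _ = _ := by ring
    refine (Finset.sum_le_sum this).trans ?_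
    rw [Finset.sum_const, Finset.card_univ, Fintype.card_fin, nsmul_eq_mul]
    rw [mul_assoc _ (R⁻¹ ^ 2), ← mul_assoc]
    refine mul_le_mul_of_nonneg_right ?_ (by positivity)
    have : 0 ≤ (N : ℝ) * ((k + 2) * (k + 1) * C ^ 2 + (k + 2) * C) := by positivity
    linarith
  · rw [lap_eq_sum_pd]
    refine (Finset.abs_sum_le_sum_abs _ _).trans ?_
    have : ∀ i ∈ Finset.univ, |pd i (pd i fun y => cut R y ^ (k + 2)) x|
        ≤ ((k + 2) * (k + 1) * C ^ 2 + (k + 2) * C) * (R⁻¹ ^ 2 * cut R x ^ k) := by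
      intro i _
      rw [pd_pd_pow hc2]
      refine (abs_add_le _ _).trans ?_
      have e1 : |(k + 2 : ℝ) * (k + 1) * cut R x ^ k * pd i (cut R) x ^ 2|
          ≤ (k + 2) * (k + 1) * cut R x ^ k * (C ^ 2 * R⁻¹ ^ 2) := by
        rw [abs_of_nonneg (by positivity)]
        gcongr; exact b3 i
      have e2 : |(k + 2 : ℝ) * cut R x ^ (k + 1) * pd i (pd i (cut R)) x|
          ≤ (k + 2) * cut R x ^ k * (C * R⁻¹ ^ 2) := by
        rw [abs_mul, abs_of_nonneg (by positivity : (0 : ℝ) ≤ (k + 2 : ℝ) * cut R x ^ (k + 1))]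
        have : cut R x ^ (k + 1) ≤ cut R x ^ k := pow_le_pow_of_le_one hz0 hz1 (by omega)
        gcongr; exact b2 i
      calc _ ≤ _ := add_le_add e1 e2
        _ = _ := by ring
    refine (Finset.sum_le_sum this).trans ?_
    rw [Finset.sum_const, Finset.card_univ, Fintype.card_fin, nsmul_eq_mul]
    rw [mul_assoc _ (R⁻¹ ^ 2), ← mul_assoc]
    refine mul_le_mul_of_nonneg_right ?_ (by positivity)
    have : 0 ≤ (N : ℝ) * ((k + 2) ^ 2 * C ^ 2) := by positivity
    linarith

/-- Green's second identity for two functions vanishing on the boundary. -/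
theorem green {n : Fin N} {f g : Eu N → ℝ} (hf : ContDiff ℝ 2 f) (hg : ContDiff ℝ 2 g)
    (hc : HasCompactSupport g) (hf0 : ∀ x : Eu N, x n = 0 → f x = 0)
    (hg0 : ∀ x : Eu N, x n = 0 → g x = 0) :
    ∫ x in hs n, (f x * lap g x - g x * lap f x) = 0 := by
  have hf1 : ∀ i, ContDiff ℝ 1 (pd i f) := fun i => contDiff_pd hf (by norm_num) i
  have hg1 : ∀ i, ContDiff ℝ 1 (pd i g) := fun i => contDiff_pd hg (by norm_num) i
  have hf' : ContDiff ℝ 1 f := hf.of_le (by norm_num)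
  have hg' : ContDiff ℝ 1 g := hg.of_le (by norm_num)
  have hdiv := integral_sum_pd_eq_zero_of_contDiff (n := n)
    (F := fun i x => f x * pd i g x - g x * pd i f x)
    (fun i => (hf'.mul (hg1 i)).sub (hg'.mul (hf1 i)))
    (fun i x hx => by rw [hf0 x hx, hg0 x hx]; ring)
    (fun i => ((hasCompactSupport_pd hc i).mul_left (f := f)).sub (hc.mul_right (f' := pd i f)))
  rw [← hdiv]
  refine integral_congr_ae (Eventually.of_forall fun x => ?_)
  simp only [lap_eq_sum_pd, Finset.mul_sum, ← Finset.sum_sub_distrib]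
  refine Finset.sum_congr rfl fun i _ => ?_
  have d1 := hf'.differentiable (by norm_num) x
  have d2 := hg'.differentiable (by norm_num) x
  have d3 := (hf1 i).differentiable (by norm_num) x
  have d4 := (hg1 i).differentiable (by norm_num) x
  rw [pd_sub (d1.fun_mul d4) (d2.fun_mul d3), pd_mul d1 d4, pd_mul d2 d3]
  ring

section Energy

variable {n : Fin N} {p : ℝ} {u : Eu N → ℝ}

theorem Sol.contDiff_lap (h : Sol n p u) : ContDiff ℝ 2 (lap u) :=
  HalfSpace.contDiff_lap h.smooth (by norm_num)

theorem Sol.contDiff_two (h : Sol n p u) : ContDiff ℝ 2 u := h.smooth.of_le (by norm_num)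

theorem lap_sq {f : Eu N → ℝ} (hf : ContDiff ℝ 2 f) (x : Eu N) :
    lap (fun y => f y * f y) x = 2 * f x * lap f x + 2 * ∑ i, pd i f x ^ 2 := by
  rw [lap_mul hf.contDiffAt hf.contDiffAt]
  rw [Finset.sum_congr rfl fun i _ => (sq (pd i f x)).symm]
  ring

/-- Testing the equation with `u η²`. -/
theorem Sol.energy_identity (h : Sol n p u) {η : Eu N → ℝ} (hη : ContDiff ℝ 2 η)
    (hc : HasCompactSupport η) :
    ∫ x in hs n, ((lap u x * η x) ^ 2 - u x ^ (p + 1) * η x ^ 2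
      + 2 * (lap u x * η x) * (2 * ∑ i, pd i u x * pd i η x + u x * lap η x)
      + 2 * (u x * lap u x) * ∑ i, pd i η x ^ 2) = 0 := by
  have hu2 := h.contDiff_two
  have hηη : ContDiff ℝ 2 fun y => η y * η y := hη.mul hη
  have hg : ContDiff ℝ 2 fun y => u y * (η y * η y) := hu2.mul hηη
  have hgc : HasCompactSupport fun y => u y * (η y * η y) := (hc.mul_right).mul_left
  rw [← green (n := n) h.contDiff_lap hg hgc h.bdry_lap (fun x hx => by rw [h.bdry x hx, zero_mul])]
  refine setIntegral_congr_fun (isOpen_hs n).measurableSet fun x hx => ?_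
  have hux := h.pos x hx
  rw [h.eqn x hx, lap_mul hu2.contDiffAt hηη.contDiffAt, lap_sq hη,
    Real.rpow_add_one hux.ne']
  have hd : Differentiable ℝ η := hη.differentiable (by norm_num)
  have : ∑ i, pd i u x * pd i (fun y => η y * η y) x = 2 * η x * ∑ i, pd i u x * pd i η x := by
    rw [Finset.mul_sum]
    refine Finset.sum_congr rfl fun i _ => ?_
    rw [pd_mul (hd x) (hd x)]; ring
  rw [this]; ring

/-- Stability tested with `u η`. -/
theorem Sol.stab_identity (h : Sol n p u) {η : Eu N → ℝ} (hη : ContDiff ℝ 2 η)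
    (hc : HasCompactSupport η) :
    p * ∫ x in hs n, u x ^ (p + 1) * η x ^ 2
      ≤ ∫ x in hs n, ((lap u x * η x)
        + (2 * ∑ i, pd i u x * pd i η x + u x * lap η x)) ^ 2 := by
  have hu2 := h.contDiff_two
  have := h.stab (fun y => u y * η y) (hu2.mul hη) hc.mul_left
    (fun x hx => by rw [h.bdry x hx, zero_mul])
  have e1 : ∫ x in hs n, u x ^ (p - 1) * (u x * η x) ^ 2 = ∫ x in hs n, u x ^ (p + 1) * η x ^ 2 := by
    refine setIntegral_congr_fun (isOpen_hs n).measurableSet fun x hx => ?_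
    have hux := h.pos x hx
    rw [show p + 1 = (p - 1) + (2 : ℕ) by push_cast; ring, Real.rpow_add_natCast hux.ne']
    ring
  rw [e1] at this
  refine this.trans (le_of_eq ?_)
  refine integral_congr_ae (Eventually.of_forall fun x => ?_)
  simp only
  rw [lap_mul hu2.contDiffAt hη.contDiffAt]
  ring

theorem Sol.gradient_identity (h : Sol n p u) {ξ : Eu N → ℝ} (hξ : ContDiff ℝ 2 ξ)
    (hc : HasCompactSupport ξ) :
    ∫ x in hs n, ((∑ i, pd i u x ^ 2) * ξ x + u x * lap u x * ξ x - u x ^ 2 / 2 * lap ξ x) = 0 := by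
  have hu2 := h.contDiff_two
  have hu1 : ContDiff ℝ 1 u := hu2.of_le (by norm_num)
  have hξ1 : ContDiff ℝ 1 ξ := hξ.of_le (by norm_num)
  have hpu : ∀ i, ContDiff ℝ 1 (pd i u) := fun i => contDiff_pd hu2 (by norm_num) i
  have hpξ : ∀ i, ContDiff ℝ 1 (pd i ξ) := fun i => contDiff_pd hξ (by norm_num) i
  have hdiv := integral_sum_pd_eq_zero_of_contDiff (n := n)
    (F := fun i x => u x * (pd i u x * ξ x - 1 / 2 * (u x * pd i ξ x)))
    (fun i => hu1.mul (((hpu i).mul hξ1).sub (contDiff_const.mul (hu1.mul (hpξ i)))))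
    (fun i x hx => by rw [h.bdry x hx, zero_mul])
    (fun i => (hc.mul_left.sub ((hasCompactSupport_pd hc i).mul_left.mul_left)).mul_left)
  rw [← hdiv]
  refine integral_congr_ae (Eventually.of_forall fun x => ?_)
  simp only [lap_eq_sum_pd, Finset.mul_sum, Finset.sum_mul, ← Finset.sum_sub_distrib,
    ← Finset.sum_add_distrib]
  refine Finset.sum_congr rfl fun i _ => ?_
  have d1 := hu1.differentiable (by norm_num) x
  have d2 := hξ1.differentiable (by norm_num) x
  have d3 := (hpu i).differentiable (by norm_num) x
  have d4 := (hpξ i).differentiable (by norm_num) x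
  rw [pd_mul d1 ((d3.fun_mul d2).fun_sub ((d1.fun_mul d4).const_mul _)),
    pd_sub (d3.fun_mul d2) ((d1.fun_mul d4).const_mul _), pd_const_mul,
    pd_mul d3 d2, pd_mul d1 d4]
  ring

theorem young_cut (hp : 1 < p) {k : ℕ} (hk : 8 / (p - 1) ≤ 2 * k) {a z ρ ε : ℝ} (ha : 0 < a)
    (hz0 : 0 ≤ z) (hz1 : z ≤ 1) (hρ : 0 < ρ) (hε : 0 < ε) :
    a ^ 2 * (z ^ k) ^ 2 * ρ ^ 4
      ≤ ε * (a ^ (p + 1) * (z ^ (k + 2)) ^ 2) + ε ^ (-(2 / (p - 1))) * ρ ^ (4 * (p + 1) / (p - 1)) := by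
  have hp' : 0 < p - 1 := by linarith
  have hrhs : 0 ≤ ε ^ (-(2 / (p - 1))) * ρ ^ (4 * (p + 1) / (p - 1)) := by positivity
  have hlhs : 0 ≤ ε * (a ^ (p + 1) * (z ^ (k + 2)) ^ 2) := by positivity
  by_cases hcase : a ^ 2 * (z ^ k) ^ 2 * ρ ^ 4 ≤ ε * (a ^ (p + 1) * (z ^ (k + 2)) ^ 2)
  · linarith
  · push Not at hcase
    have hk0 : k ≠ 0 := by
      rintro rfl
      have : 0 < 8 / (p - 1) := by positivity
      simp at hk; linarith
    have hz : 0 < z := by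
      rcases hz0.eq_or_lt with h | h
      · subst h; rw [zero_pow hk0] at hcase; simp at hcase
      · exact h
    have h1 : ε * a ^ (p - 1) * z ^ 4 < ρ ^ 4 := by
      have e1 : a ^ (p + 1) = a ^ (p - 1) * a ^ 2 := by
        rw [show p + 1 = (p - 1) + (2 : ℕ) by push_cast; ring, Real.rpow_add_natCast ha.ne']
      rw [e1] at hcase
      have e2 : 0 < a ^ 2 * (z ^ k) ^ 2 := by positivity
      have e3 : a ^ 2 * (z ^ k) ^ 2 * (ε * a ^ (p - 1) * z ^ 4) < a ^ 2 * (z ^ k) ^ 2 * ρ ^ 4 := by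
        calc _ = ε * (a ^ (p - 1) * a ^ 2 * (z ^ (k + 2)) ^ 2) := by ring
          _ < _ := hcase
      exact lt_of_mul_lt_mul_left e3 e2.le
    set q : ℝ := 2 / (p - 1) with hq
    have hq0 : 0 < q := by positivity
    have h2 : (ε * a ^ (p - 1) * z ^ 4) ^ q ≤ (ρ ^ 4) ^ q :=
      Real.rpow_le_rpow (by positivity) h1.le hq0.le
    rw [Real.mul_rpow (by positivity) (by positivity), Real.mul_rpow hε.le (by positivity),
      ← Real.rpow_mul ha.le, show (p - 1) * q = (2 : ℕ) by rw [hq]; push_cast; field_simp,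
      Real.rpow_natCast] at h2
    have h3 : (z ^ k) ^ 2 ≤ (z ^ 4) ^ q := by
      rw [← pow_mul, ← Real.rpow_natCast, ← Real.rpow_natCast, ← Real.rpow_mul hz.le]
      refine Real.rpow_le_rpow_of_exponent_ge hz hz1 ?_
      push_cast
      have : 4 * q = 8 / (p - 1) := by rw [hq]; ring
      linarith
    have h4 : ρ ^ (4 * (p + 1) / (p - 1)) = (ρ ^ 4) ^ q * ρ ^ 4 := by
      rw [← Real.rpow_natCast ρ 4, ← Real.rpow_mul hρ.le, ← Real.rpow_add hρ]
      congr 1; rw [hq]; push_cast; field_simp; ring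
    rw [h4, Real.rpow_neg hε.le]
    have h5 : 0 < ε ^ q := by positivity
    have h6 : a ^ 2 * (z ^ k) ^ 2 ≤ (ε ^ q)⁻¹ * (ρ ^ 4) ^ q := by
      rw [inv_mul_eq_div, le_div_iff₀ h5]
      calc a ^ 2 * (z ^ k) ^ 2 * ε ^ q ≤ a ^ 2 * (z ^ 4) ^ q * ε ^ q := by gcongr
        _ = ε ^ q * a ^ 2 * (z ^ 4) ^ q := by ring
        _ ≤ _ := h2
    calc a ^ 2 * (z ^ k) ^ 2 * ρ ^ 4 ≤ (ε ^ q)⁻¹ * (ρ ^ 4) ^ q * ρ ^ 4 := by gcongr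
      _ = (ε ^ q)⁻¹ * ((ρ ^ 4) ^ q * ρ ^ 4) := by ring
      _ ≤ _ := by linarith

end Energy

section Energy

variable {n : Fin N} {p : ℝ} {u : Eu N → ℝ}

theorem sum_mul_sq_le (a b : Fin N → ℝ) : (∑ i, a i * b i) ^ 2 ≤ (∑ i, a i ^ 2) * ∑ i, b i ^ 2 :=
  Finset.sum_mul_sq_le_sq_mul_sq _ _ _

theorem setIntegral_closedBall_le {n : Fin N} {c R : ℝ} (hc : 0 ≤ c) (hR : 0 < R) :
    ∫ x in hs n, (Metric.closedBall (0 : Eu N) (2 * R)).indicator (fun _ => c) x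
      ≤ c * (2 ^ N * (volume (Metric.ball (0 : Eu N) 1)).toReal * R ^ N) := by
  have h1 : ∫ x in hs n, (Metric.closedBall (0 : Eu N) (2 * R)).indicator (fun _ => c) x
      ≤ ∫ x, (Metric.closedBall (0 : Eu N) (2 * R)).indicator (fun _ => c) x := by
    refine setIntegral_le_integral ?_ (Eventually.of_forall fun x => indicator_nonneg (fun _ _ => hc) x)
    exact (integrable_indicator_iff Metric.isClosed_closedBall.measurableSet).mpr
      (integrableOn_const measure_closedBall_lt_top.ne)
  refine h1.trans (le_of_eq ?_)
  rw [integral_indicator Metric.isClosed_closedBall.measurableSet, setIntegral_const, smul_eq_mul,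
    measureReal_def, Measure.addHaar_closedBall _ _ (by positivity), ENNReal.toReal_mul,
    ENNReal.toReal_ofReal (by positivity), finrank_euclideanSpace_fin]
  ring

theorem energy_pointwise {C ε ρ U L z0 z1 z2 g B D l S : ℝ} (hε : 0 < ε)
    (hzz : z1 ^ 2 = z0 * z2)
    (hg : 0 ≤ g) (hD : D ≤ C * ρ ^ 2 * z1 ^ 2) (hl : |l| ≤ C * ρ ^ 2 * z0)
    (hS : S ^ 2 ≤ g * D) (hB : B = 2 * S + U * l) :
    2 * |U * L| * D + B ^ 2 ≤ ε * (L * z2) ^ 2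
      + (C ^ 2 / ε + 2 * C ^ 2) * (U ^ 2 * z0 ^ 2 * ρ ^ 4) + 8 * C * (ρ ^ 2 * g * z1 ^ 2) := by
  have h1 : 2 * |U * L| * D ≤ ε * (L * z2) ^ 2 + C ^ 2 / ε * (U ^ 2 * z0 ^ 2 * ρ ^ 4) := by
    have e1 : 2 * |U * L| * D ≤ 2 * |U * L| * (C * ρ ^ 2 * (z0 * z2)) := by
      rw [← hzz]; gcongr
    refine e1.trans ?_
    have e2 : 0 ≤ (ε * (|L| * z2) - C * (|U| * z0 * ρ ^ 2)) ^ 2 / ε := by positivity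
    have e3 : (ε * (|L| * z2) - C * (|U| * z0 * ρ ^ 2)) ^ 2 / ε
        = ε * (L * z2) ^ 2 + C ^ 2 / ε * (U ^ 2 * z0 ^ 2 * ρ ^ 4)
          - 2 * |U * L| * (C * ρ ^ 2 * (z0 * z2)) := by
      rw [abs_mul, ← sq_abs U, mul_pow L, ← sq_abs L]; field_simp; ring
    linarith
  have h2 : B ^ 2 ≤ 2 * C ^ 2 * (U ^ 2 * z0 ^ 2 * ρ ^ 4) + 8 * C * (ρ ^ 2 * g * z1 ^ 2) := by
    have e1 : B ^ 2 ≤ 8 * S ^ 2 + 2 * (U * l) ^ 2 := by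
      rw [hB]; nlinarith [sq_nonneg (2 * S - U * l)]
    have e2 : g * D ≤ g * (C * ρ ^ 2 * z1 ^ 2) := by gcongr
    have e3 : l ^ 2 ≤ (C * ρ ^ 2 * z0) ^ 2 := by
      rw [← sq_abs]; exact pow_le_pow_left₀ (abs_nonneg _) hl 2
    have e4 : U ^ 2 * l ^ 2 ≤ U ^ 2 * (C * ρ ^ 2 * z0) ^ 2 := by gcongr
    nlinarith
  linarith

theorem gradient_pointwise {C ε ρ U L z0 z1 z2 l : ℝ} (hε : 0 < ε)
    (hzz : z1 ^ 2 = z0 * z2) (hl : |l| ≤ C * ρ ^ 2 * z0 ^ 2) :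
    ρ ^ 2 * (-(U * L * z1 ^ 2) + U ^ 2 / 2 * l) ≤ ε * (L * z2) ^ 2
      + (1 / ε + C) * (U ^ 2 * z0 ^ 2 * ρ ^ 4) := by
  have h1 : ρ ^ 2 * (-(U * L * z1 ^ 2)) ≤ ε * (L * z2) ^ 2 + 1 / ε * (U ^ 2 * z0 ^ 2 * ρ ^ 4) := by
    have e2 : 0 ≤ (2 * ε * (L * z2) + U * z0 * ρ ^ 2) ^ 2 / (4 * ε) := by positivity
    have e3 : (2 * ε * (L * z2) + U * z0 * ρ ^ 2) ^ 2 / (4 * ε)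
        = ε * (L * z2) ^ 2 + 1 / (4 * ε) * (U ^ 2 * z0 ^ 2 * ρ ^ 4)
          + ρ ^ 2 * (U * L * (z0 * z2)) := by
      field_simp; ring
    have e4 : 1 / (4 * ε) * (U ^ 2 * z0 ^ 2 * ρ ^ 4) ≤ 1 / ε * (U ^ 2 * z0 ^ 2 * ρ ^ 4) := by
      refine mul_le_mul_of_nonneg_right ?_ (by positivity)
      exact one_div_le_one_div_of_le hε (by linarith)
    rw [hzz]; linarith
  have h2 : ρ ^ 2 * (U ^ 2 / 2 * l) ≤ C * (U ^ 2 * z0 ^ 2 * ρ ^ 4) := by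
    have e1 : l ≤ C * ρ ^ 2 * z0 ^ 2 := (le_abs_self l).trans hl
    have e2 : 0 ≤ C * ρ ^ 2 * z0 ^ 2 := (abs_nonneg l).trans hl
    calc ρ ^ 2 * (U ^ 2 / 2 * l) ≤ ρ ^ 2 * (U ^ 2 / 2 * (C * ρ ^ 2 * z0 ^ 2)) := by gcongr
      _ ≤ ρ ^ 2 * (U ^ 2 * (C * ρ ^ 2 * z0 ^ 2)) := by
        have : U ^ 2 / 2 ≤ U ^ 2 := by nlinarith [sq_nonneg U]
        gcongr
      _ = _ := by ring
  calc _ = ρ ^ 2 * (-(U * L * z1 ^ 2)) + ρ ^ 2 * (U ^ 2 / 2 * l) := by ring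
    _ ≤ _ := by linarith

theorem nice_mul_cut {f g : Eu N → ℝ} (hf : Continuous f) (hg : Continuous g)
    (hgc : HasCompactSupport g) : Nice n fun x => f x * g x :=
  nice_of_continuous (hf.mul hg) hgc.mul_left

set_option maxHeartbeats 1000000 in
/-- The basic energy estimate. -/
theorem Sol.energy_estimate (h : Sol n p u) : ∃ k : ℕ, ∃ C : ℝ, 0 < C ∧ ∀ R : ℝ, 0 < R →
    ∫ x in hs n, (lap u x * cut R x ^ (k + 2)) ^ 2 ≤ C * (R⁻¹ ^ (4 * (p + 1) / (p - 1)) * R ^ N) ∧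
    ∫ x in hs n, u x ^ (p + 1) * (cut R x ^ (k + 2)) ^ 2
      ≤ C * (R⁻¹ ^ (4 * (p + 1) / (p - 1)) * R ^ N) := by
  have hp := h.hp
  have hp' : 0 < p - 1 := by linarith
  obtain ⟨k, hk⟩ := exists_nat_ge (8 / (p - 1))
  have hk2 : 8 / (p - 1) ≤ 2 * k := by
    have : (0 : ℝ) ≤ k := Nat.cast_nonneg k
    linarith
  obtain ⟨Ca, hCa, hba⟩ := exists_cut_pow_bound (N := N) k
  obtain ⟨Cb, hCb, hbb⟩ := exists_cut_pow_bound (N := N) (2 * k)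
  set κ : ℝ := 2 / (p - 1) + 4 with hκ
  have hκ0 : 0 < κ := by positivity
  set ε : ℝ := 1 / (4 * κ) with hε
  have hε0 : 0 < ε := by positivity
  set ε' : ℝ := 1 / (4 * κ * (8 * Ca)) with hε'
  have hε'0 : 0 < ε' := by positivity
  set C1 : ℝ := Ca ^ 2 / ε + 2 * Ca ^ 2 with hC1
  set C3 : ℝ := 1 / ε' + Cb with hC3
  set C4 : ℝ := C1 + 8 * Ca * C3 with hC4
  have hC40 : 0 < C4 := by positivity
  set K : ℝ := 2 * C4 / (p - 1) with hK
  have hK0 : 0 < K := by positivity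
  set δ : ℝ := 1 / (2 * K) with hδ
  have hδ0 : 0 < δ := by positivity
  set VN : ℝ := 2 ^ N * (volume (Metric.ball (0 : Eu N) 1)).toReal with hVN
  have hVN0 : 0 ≤ VN := by positivity
  set M : ℝ := 2 * (δ ^ (-(2 / (p - 1))) * VN) with hM
  have hM0 : 0 ≤ M := by positivity
  refine ⟨k, (2 * κ * C4 + K) * M + 1, by positivity, fun R hR => ?_⟩
  have hρ : 0 < R⁻¹ := inv_pos.mpr hR
  set ρ := R⁻¹ with hρdef
  have hu2 := h.contDiff_two
  have hL2 := h.contDiff_lap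
  have huc : Continuous u := hu2.continuous
  have hLc : Continuous (lap u) := hL2.continuous
  have hupc : Continuous fun x => u x ^ (p + 1) :=
    huc.rpow_const fun x => Or.inr (by linarith)
  have hcc : Continuous (cut R : Eu N → ℝ) := (contDiff_cut R).continuous
  have hcs := hasCompactSupport_cut (N := N) hR
  have hpc : ∀ i, Continuous (pd i u) := fun i =>
    (contDiff_pd (m := 0) hu2 (by norm_num) i).continuous
  have hη : ∀ m : ℕ, ContDiff ℝ 2 fun y : Eu N => cut R y ^ m := fun m =>
    ((contDiff_cut R).pow m).of_le two_le_infty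
  have hcsp : ∀ m : ℕ, HasCompactSupport fun y : Eu N => cut R y ^ (m + 1) := by
    intro m
    refine hcs.mono fun x hx => ?_
    simp only [Function.mem_support] at hx ⊢
    intro h0; exact hx (by simp [h0])
  have hk0 : k ≠ 0 := by
    rintro rfl
    have : 0 < 8 / (p - 1) := by positivity
    simp at hk; linarith
  have hsq : ∀ m : ℕ, m ≠ 0 → HasCompactSupport fun y : Eu N => (cut R y ^ m) ^ 2 := by
    intro m hm
    refine hcs.mono fun x hx => ?_
    simp only [Function.mem_support] at hx ⊢
    intro h0; exact hx (by simp [h0, hm])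
  set q : Eu N → ℝ := fun x => (lap u x * cut R x ^ (k + 2)) ^ 2 with hq
  set a : Eu N → ℝ := fun x => u x ^ (p + 1) * (cut R x ^ (k + 2)) ^ 2 with ha
  set t : Eu N → ℝ := fun x => u x ^ 2 * (cut R x ^ k) ^ 2 * ρ ^ 4 with ht
  set g : Eu N → ℝ := fun x => ρ ^ 2 * (∑ i, pd i u x ^ 2) * (cut R x ^ (k + 1)) ^ 2 with hg
  have iq : IntegrableOn q (hs n) := by
    have := nice_mul_cut (n := n) (hLc.pow 2) ((hcc.pow (k + 2)).pow 2) (hsq _ (by omega))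
    exact this.integrableOn.congr_fun (fun x _ => (mul_pow _ _ _).symm) (isOpen_hs n).measurableSet
  have ia : IntegrableOn a (hs n) :=
    (nice_mul_cut (n := n) hupc ((hcc.pow (k + 2)).pow 2) (hsq _ (by omega))).integrableOn
  have it : IntegrableOn t (hs n) := by
    exact ((nice_mul_cut (n := n) (huc.pow 2) ((hcc.pow k).pow 2) (hsq _ hk0)).integrableOn).mul_const _
  have ig : IntegrableOn g (hs n) :=
    (nice_mul_cut (n := n) (continuous_const.mul (continuous_finsetSum _ fun i _ => (hpc i).pow 2))
      ((hcc.pow (k + 1)).pow 2) (hsq _ (by omega))).integrableOn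
  set η : Eu N → ℝ := fun y => cut R y ^ (k + 2) with hηdef
  have hηc : HasCompactSupport η := hcsp (k + 1)
  have hηp : ∀ i, Continuous (pd i η) := fun i =>
    (contDiff_pd (m := 0) (hη (k + 2)) (by norm_num) i).continuous
  have hηl : Continuous (lap η) := (HalfSpace.contDiff_lap (m := 0) (hη (k + 2)) (by norm_num)).continuous
  set ξ : Eu N → ℝ := fun y => cut R y ^ (2 * k + 2) with hξdef
  have hξl : Continuous (lap ξ) :=
    (HalfSpace.contDiff_lap (m := 0) (hη (2 * k + 2)) (by norm_num)).continuous
  have I1 := h.energy_identity (hη (k + 2)) hηc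
  have I3 := h.stab_identity (hη (k + 2)) hηc
  have I2 := h.gradient_identity (hη (2 * k + 2)) (hcsp (2 * k + 1))
  set E1 : Eu N → ℝ := fun x => ((lap u x * η x) ^ 2 - u x ^ (p + 1) * η x ^ 2
      + 2 * (lap u x * η x) * (2 * ∑ i, pd i u x * pd i η x + u x * lap η x)
      + 2 * (u x * lap u x) * ∑ i, pd i η x ^ 2) with hE1
  set E2 : Eu N → ℝ := fun x => ((∑ i, pd i u x ^ 2) * ξ x + u x * lap u x * ξ x
    - u x ^ 2 / 2 * lap ξ x) with hE2
  have hzero : ∀ x : Eu N, 2 * R ≤ ‖x‖ → ∀ m : ℕ,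
      (fun y : Eu N => cut R y ^ (m + 1)) =ᶠ[𝓝 x] fun _ => (0 : ℝ) := by
    intro x hx m
    filter_upwards [cut_eventually_zero hR hx] with y hy
    rw [hy]; simp
  have iE1 : IntegrableOn E1 (hs n) := by
    refine (nice_of_continuousOn (R := 2 * R) (Continuous.continuousOn ?_) fun x _ hx => ?_).integrableOn
    · have c1 : Continuous η := (hη (k + 2)).continuous
      have c2 : Continuous fun x => ∑ i, pd i u x * pd i η x :=
        continuous_finsetSum _ fun i _ => (hpc i).mul (hηp i)
      have c3 : Continuous fun x => ∑ i, pd i η x ^ 2 :=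
        continuous_finsetSum _ fun i _ => (hηp i).pow 2
      fun_prop
    · have e0 := hzero x hx (k + 1)
      have e1 : η x = 0 := e0.self_of_nhds
      have e2 : ∀ i, pd i η x = 0 := fun i => by rw [pd_congr e0 i, pd_const]
      simp only [hE1, e1, e2]
      norm_num
  have iE2 : IntegrableOn E2 (hs n) := by
    refine (nice_of_continuousOn (R := 2 * R) (Continuous.continuousOn ?_) fun x _ hx => ?_).integrableOn
    · have c1 : Continuous ξ := (hη (2 * k + 2)).continuous
      have c2 : Continuous fun x => ∑ i, pd i u x ^ 2 :=
        continuous_finsetSum _ fun i _ => (hpc i).pow 2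
      fun_prop
    · have e0 := hzero x hx (2 * k + 1)
      have e1 : ξ x = 0 := e0.self_of_nhds
      have e2 : lap ξ x = 0 := by 
        have c0 : ∀ i, pd i (fun _ : Eu N => (0 : ℝ)) = fun _ => 0 := fun i =>
          funext fun y => pd_const 0 i y
        rw [lap_congr e0, lap_eq_sum_pd]
        exact Finset.sum_eq_zero fun i _ => by rw [c0, c0]
      simp only [hE2, e1, e2]
      norm_num
  have pw : ∀ x, 2 * |u x * lap u x| * ∑ i, pd i η x ^ 2
      + (2 * ∑ i, pd i u x * pd i η x + u x * lap η x) ^ 2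
      ≤ ε * q x + C1 * t x + 8 * Ca * g x := by
    intro x
    obtain ⟨b1, b2⟩ := hba R hR x
    exact energy_pointwise hε0
      (by ring) (Finset.sum_nonneg fun i _ => sq_nonneg _)
      b1 b2 (sum_mul_sq_le _ _) rfl
  have iS : IntegrableOn (fun x => ε * q x + C1 * t x + 8 * Ca * g x) (hs n) :=
    ((iq.const_mul ε).add (it.const_mul C1)).add (ig.const_mul (8 * Ca))
  have iεq : IntegrableOn (fun x => ε * q x) (hs n) := iq.const_mul ε
  have iCt : IntegrableOn (fun x => C1 * t x) (hs n) := it.const_mul C1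
  have iqt : IntegrableOn (fun x => ε * q x + C1 * t x) (hs n) := iεq.add iCt
  have igC : IntegrableOn (fun x => 8 * Ca * g x) (hs n) := ig.const_mul _
  have vS : ∫ x in hs n, (ε * q x + C1 * t x + 8 * Ca * g x)
      = ε * (∫ x in hs n, q x) + C1 * (∫ x in hs n, t x) + 8 * Ca * ∫ x in hs n, g x := by
    rw [integral_add iqt igC, integral_add iεq iCt]
    simp only [integral_const_mul]
  set Q := ∫ x in hs n, q x with hQ
  set A := ∫ x in hs n, a x with hA
  set T := ∫ x in hs n, t x with hT
  set G := ∫ x in hs n, g x with hG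
  set S := ε * Q + C1 * T + 8 * Ca * G with hS
  have iaS : IntegrableOn (fun x => a x + (ε * q x + C1 * t x + 8 * Ca * g x)) (hs n) := ia.add iS
  have i2S : IntegrableOn (fun x => 2 * (ε * q x + C1 * t x + 8 * Ca * g x)) (hs n) :=
    iS.const_mul 2
  have ia2S : IntegrableOn (fun x => a x + 2 * (ε * q x + C1 * t x + 8 * Ca * g x)) (hs n) :=
    ia.add i2S
  have J1 : p * A ≤ A + S := by
    refine I3.trans ?_
    have : ∫ x in hs n, ((lap u x * η x) + (2 * ∑ i, pd i u x * pd i η x + u x * lap η x)) ^ 2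
        ≤ ∫ x in hs n, (E1 x + (a x + (ε * q x + C1 * t x + 8 * Ca * g x))) := by
      refine integral_mono_of_nonneg (Eventually.of_forall fun x => sq_nonneg _)
        (iE1.add iaS) (Eventually.of_forall fun x => ?_)
      have h1 := pw x
      have h2 : 0 ≤ ∑ i, pd i η x ^ 2 := Finset.sum_nonneg fun i _ => sq_nonneg _
      have h3 := neg_abs_le (u x * lap u x)
      have h4 : -(2 * (u x * lap u x) * ∑ i, pd i η x ^ 2)
          ≤ 2 * |u x * lap u x| * ∑ i, pd i η x ^ 2 := by nlinarith
      simp only [hE1, ha]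
      have : cut R x ^ (k + 2) = η x := rfl
      rw [this]
      linarith
    refine this.trans (le_of_eq ?_)
    rw [integral_add iE1 iaS, integral_add ia iS, vS, I1, zero_add]
  have J2 : Q ≤ 2 * A + 4 * S := by
    have : ∫ x in hs n, 1 / 2 * q x
        ≤ ∫ x in hs n, (E1 x + (a x + 2 * (ε * q x + C1 * t x + 8 * Ca * g x))) := by
      refine integral_mono_of_nonneg (Eventually.of_forall fun x => by positivity)
        (iE1.add ia2S) (Eventually.of_forall fun x => ?_)
      have h1 := pw x
      have h2 : 0 ≤ ∑ i, pd i η x ^ 2 := Finset.sum_nonneg fun i _ => sq_nonneg _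
      have h3 := neg_abs_le (u x * lap u x)
      have h4 : -(2 * (u x * lap u x) * ∑ i, pd i η x ^ 2)
          ≤ 2 * |u x * lap u x| * ∑ i, pd i η x ^ 2 := by nlinarith
      have h6 : 0 ≤ 2 * |u x * lap u x| * ∑ i, pd i η x ^ 2 := by positivity
      have h5 := sq_nonneg (lap u x * η x
        + 2 * (2 * ∑ i, pd i u x * pd i η x + u x * lap η x))
      simp only [hE1, ha]
      have e1 : cut R x ^ (k + 2) = η x := rfl
      have e2 : q x = (lap u x * η x) ^ 2 := rfl
      rw [e1]
      generalize hBdef : 2 * ∑ i, pd i u x * pd i η x + u x * lap η x = B at h1 h5 ⊢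
      rw [e2] at h1 ⊢
      nlinarith
    rw [integral_add iE1 ia2S, integral_add ia i2S,
      integral_const_mul, integral_const_mul, vS, I1, zero_add] at this
    linarith
  have iρE : IntegrableOn (fun x => ρ ^ 2 * E2 x) (hs n) := iE2.const_mul _
  have iε'q : IntegrableOn (fun x => ε' * q x) (hs n) := iq.const_mul _
  have iC3t : IntegrableOn (fun x => C3 * t x) (hs n) := it.const_mul _
  have iqt' : IntegrableOn (fun x => ε' * q x + C3 * t x) (hs n) := iε'q.add iC3t
  have J3 : G ≤ ε' * Q + C3 * T := by
    have : G ≤ ∫ x in hs n, (ρ ^ 2 * E2 x + (ε' * q x + C3 * t x)) := by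
      refine integral_mono_of_nonneg (Eventually.of_forall fun x => ?_)
        (iρE.add iqt')
        (Eventually.of_forall fun x => ?_)
      · have : 0 ≤ ∑ i, pd i u x ^ 2 := Finset.sum_nonneg fun i _ => sq_nonneg _
        simp only [hg, Pi.zero_apply]; positivity
      · obtain ⟨_, b2⟩ := hbb R hR x
        have hl : |lap ξ x| ≤ Cb * ρ ^ 2 * (cut R x ^ k) ^ 2 := by
          rw [← pow_mul, mul_comm k 2]; exact b2
        have := gradient_pointwise (U := u x) (L := lap u x) (z1 := cut R x ^ (k + 1))
          (z2 := cut R x ^ (k + 2)) hε'0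
          (by ring) hl
        have e1 : ξ x = (cut R x ^ (k + 1)) ^ 2 := by
          rw [← pow_mul]; simp only [hξdef]; congr 1; ring
        simp only [hg, hE2, e1]
        change _ ≤ _ + (ε' * (lap u x * cut R x ^ (k + 2)) ^ 2
          + C3 * (u x ^ 2 * (cut R x ^ k) ^ 2 * ρ ^ 4))
        linarith
    rw [integral_add iρE iqt', integral_add iε'q iC3t] at this
    simp only [integral_const_mul] at this
    rw [I2] at this
    linarith
  have iδa : IntegrableOn (fun x => δ * a x) (hs n) := ia.const_mul _
  have J4 : T ≤ δ * A + δ ^ (-(2 / (p - 1))) * ρ ^ (4 * (p + 1) / (p - 1)) * (VN * R ^ N) := by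
    set c := δ ^ (-(2 / (p - 1))) * ρ ^ (4 * (p + 1) / (p - 1)) with hc
    have hc0 : 0 ≤ c := by positivity
    have ii : IntegrableOn (fun x => (Metric.closedBall (0 : Eu N) (2 * R)).indicator
        (fun _ => c) x) (hs n) :=
      ((integrable_indicator_iff Metric.isClosed_closedBall.measurableSet).mpr
        (integrableOn_const measure_closedBall_lt_top.ne)).integrableOn
    have : T ≤ ∫ x in hs n, (δ * a x
        + (Metric.closedBall (0 : Eu N) (2 * R)).indicator (fun _ => c) x) := by
      refine setIntegral_mono_on it (iδa.add ii) (isOpen_hs n).measurableSet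
        fun x hx => ?_
      by_cases hxR : ‖x‖ ≤ 2 * R
      · rw [indicator_of_mem (by simpa using hxR)]
        exact young_cut hp hk2 (h.pos x hx) (cut_nonneg _ _) (cut_le_one _ _) hρ hδ0
      · rw [indicator_of_notMem (by simpa using hxR)]
        have : cut R x = 0 := cut_eq_zero hR (not_le.mp hxR).le
        simp [ht, ha, this, hk0]
    rw [integral_add iδa ii, integral_const_mul] at this
    have h2 := setIntegral_closedBall_le (n := n) hc0 hR
    linarith
  have hQ0 : 0 ≤ Q := integral_nonneg fun x => sq_nonneg _
  have hT0 : 0 ≤ T := integral_nonneg fun x => by simp only [ht, Pi.zero_apply]; positivity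
  have S1 : S ≤ 1 / (2 * κ) * Q + C4 * T := by
    have : 8 * Ca * G ≤ 8 * Ca * (ε' * Q + C3 * T) := by gcongr
    have e1 : 8 * Ca * ε' = 1 / (4 * κ) := by rw [hε']; field_simp
    have e2 : 1 / (4 * κ) + 1 / (4 * κ) = 1 / (2 * κ) := by field_simp; norm_num
    calc S ≤ ε * Q + C1 * T + 8 * Ca * (ε' * Q + C3 * T) := by linarith
      _ = (1 / (4 * κ) + 8 * Ca * ε') * Q + C4 * T := by rw [hε, hC4]; ring
      _ = _ := by rw [e1, e2]
  have hAS : A ≤ S / (p - 1) := by rw [le_div_iff₀ hp']; linarith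
  have S2 : Q ≤ κ * S := by
    have : κ * S = 2 * (S / (p - 1)) + 4 * S := by rw [hκ]; ring
    linarith
  have S3 : Q ≤ 2 * κ * C4 * T := by
    have h1 : κ * S ≤ κ * (1 / (2 * κ) * Q + C4 * T) := by gcongr
    have h2 : κ * (1 / (2 * κ) * Q + C4 * T) = Q / 2 + κ * C4 * T := by field_simp
    linarith
  have S4 : A ≤ K * T := by
    have h1 : S ≤ 2 * C4 * T := by
      have : 1 / (2 * κ) * Q ≤ 1 / (2 * κ) * (2 * κ * C4 * T) := by gcongr
      have h2 : 1 / (2 * κ) * (2 * κ * C4 * T) = C4 * T := by field_simp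
      linarith
    calc A ≤ S / (p - 1) := hAS
      _ ≤ 2 * C4 * T / (p - 1) := by gcongr
      _ = K * T := by rw [hK]; ring
  set X := ρ ^ (4 * (p + 1) / (p - 1)) * R ^ N with hX
  have hX0 : 0 ≤ X := by positivity
  have S5 : T ≤ M * X := by
    have h1 : δ * A ≤ δ * (K * T) := by gcongr
    have h2 : δ * (K * T) = T / 2 := by rw [hδ]; field_simp
    have h3 : δ ^ (-(2 / (p - 1))) * ρ ^ (4 * (p + 1) / (p - 1)) * (VN * R ^ N) = M / 2 * X := by
      rw [hM, hX]; ring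
    linarith
  constructor
  · calc Q ≤ 2 * κ * C4 * T := S3
      _ ≤ 2 * κ * C4 * (M * X) := by gcongr
      _ ≤ ((2 * κ * C4 + K) * M + 1) * X := by
        have : 0 ≤ K * M * X := by positivity
        linarith
  · calc A ≤ K * T := S4
      _ ≤ K * (M * X) := by gcongr
      _ ≤ ((2 * κ * C4 + K) * M + 1) * X := by
        have : 0 ≤ 2 * κ * C4 * M * X := by positivity
        linarith

end Energy

section HalfBall

/-- The closed half ball of radius `R`. -/
def hb (n : Fin N) (R : ℝ) : Set (Eu N) := hs n ∩ Metric.closedBall 0 R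

theorem mem_hb {n : Fin N} {R : ℝ} {x : Eu N} : x ∈ hb n R ↔ x ∈ hs n ∧ ‖x‖ ≤ R := by
  simp [hb]

theorem measurableSet_hb (n : Fin N) (R : ℝ) : MeasurableSet (hb n R) :=
  (isOpen_hs n).measurableSet.inter Metric.isClosed_closedBall.measurableSet

theorem integrableOn_hb {f : Eu N → ℝ} (hf : Continuous f) (n : Fin N) (R : ℝ) :
    IntegrableOn f (hb n R) :=
  (hf.continuousOn.integrableOn_compact (isCompact_closedBall 0 R)).mono_set inter_subset_right

theorem setIntegral_hb_le {n : Fin N} {f F : Eu N → ℝ} {R : ℝ} (hf : Continuous f)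
    (hF : IntegrableOn F (hs n)) (hF0 : ∀ x ∈ hs n, 0 ≤ F x) (hfF : ∀ x ∈ hb n R, f x ≤ F x) :
    ∫ x in hb n R, f x ≤ ∫ x in hs n, F x := by
  refine (setIntegral_mono_on (integrableOn_hb hf n R) (hF.mono_set inter_subset_left)
    (measurableSet_hb n R) hfF).trans ?_
  refine setIntegral_mono_set hF ?_ (LE.le.eventuallyLE inter_subset_left)
  filter_upwards [ae_restrict_mem (isOpen_hs n).measurableSet] with x hx using hF0 x hx

theorem setIntegral_le_hb {n : Fin N} {f F : Eu N → ℝ} {R : ℝ} (hf : Continuous f)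
    (hF : IntegrableOn F (hs n)) (hF0 : ∀ x ∈ hs n, R < ‖x‖ → F x ≤ 0)
    (hfF : ∀ x ∈ hb n R, F x ≤ f x) :
    ∫ x in hs n, F x ≤ ∫ x in hb n R, f x := by
  have h1 : ∫ x in hb n R, f x = ∫ x in hs n, (Metric.closedBall (0 : Eu N) R).indicator f x := by
    rw [setIntegral_indicator Metric.isClosed_closedBall.measurableSet]; rfl
  rw [h1]
  refine setIntegral_mono_on hF ?_ (isOpen_hs n).measurableSet fun x hx => ?_
  · exact ((integrable_indicator_iff Metric.isClosed_closedBall.measurableSet).mpr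
      (hf.continuousOn.integrableOn_compact (isCompact_closedBall 0 R))).integrableOn
  · by_cases hxR : ‖x‖ ≤ R
    · rw [indicator_of_mem (by simpa using hxR)]
      exact hfF x (mem_hb.mpr ⟨hx, hxR⟩)
    · rw [indicator_of_notMem (by simpa using hxR)]
      exact hF0 x hx (not_le.mp hxR)

theorem setIntegral_hb_nonneg {n : Fin N} {f : Eu N → ℝ} {R : ℝ} (h : ∀ x ∈ hs n, 0 ≤ f x) :
    0 ≤ ∫ x in hb n R, f x :=
  setIntegral_nonneg (measurableSet_hb n R) fun x hx => h x hx.1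

theorem eq_zero_of_setIntegral_hb_nonpos {n : Fin N} {f : Eu N → ℝ} (hf : Continuous f)
    (hf0 : ∀ x ∈ hs n, 0 ≤ f x) (h : ∀ R : ℝ, 0 < R → ∫ x in hb n R, f x ≤ 0) :
    ∀ x ∈ hs n, f x = 0 := by
  intro x hx
  by_contra hne
  have hpos : 0 < f x := (hf0 x hx).lt_of_ne' hne
  set R := ‖x‖ + 1 with hR
  have hRx : 0 < R := by positivity
  have h0 : ∫ x in hb n R, f x = 0 := le_antisymm (h R hRx) (setIntegral_hb_nonneg hf0)
  rw [setIntegral_eq_zero_iff_of_nonneg_ae] at h0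
  · have hO : IsOpen (hs n ∩ Metric.ball 0 R ∩ {y | 0 < f y}) :=
      ((isOpen_hs n).inter Metric.isOpen_ball).inter (isOpen_lt continuous_const hf)
    have hm : 0 < volume (hs n ∩ Metric.ball 0 R ∩ {y | 0 < f y}) :=
      hO.measure_pos volume ⟨x, ⟨hx, by simp [hR]⟩, hpos⟩
    have h1 : ∀ᵐ y, y ∈ hb n R → f y = 0 := (ae_restrict_iff' (measurableSet_hb n R)).mp h0
    have h2 : volume (hs n ∩ Metric.ball 0 R ∩ {y | 0 < f y}) = 0 := by
      refine measure_mono_null ?_ h1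
      rintro y ⟨⟨hy, hyR⟩, hyp⟩ hcon
      exact (hyp : 0 < f y).ne' (hcon ⟨hy, Metric.ball_subset_closedBall hyR⟩)
    exact hm.ne' h2
  · filter_upwards [ae_restrict_mem (measurableSet_hb n R)] with y hy using hf0 y hy.1
  · exact integrableOn_hb hf n R

theorem eq_zero_of_tendsto_hb {n : Fin N} {f : Eu N → ℝ} (hf : Continuous f)
    (hf0 : ∀ x ∈ hs n, 0 ≤ f x) {C a : ℝ} (ha : 0 < a)
    (h : ∀ R : ℝ, 1 ≤ R → ∫ x in hb n R, f x ≤ C * R ^ (-a)) :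
    ∀ x ∈ hs n, f x = 0 := by
  refine eq_zero_of_setIntegral_hb_nonpos hf hf0 fun R _ => ?_
  have ht : Tendsto (fun r : ℝ => C * r ^ (-a)) atTop (𝓝 0) := by
    simpa using (tendsto_rpow_neg_atTop ha).const_mul C
  refine ge_of_tendsto ht ?_
  filter_upwards [eventually_ge_atTop (max R 1)] with r hr
  refine le_trans ?_ (h r ((le_max_right _ _).trans hr))
  refine setIntegral_mono_set (integrableOn_hb hf n r) ?_ (LE.le.eventuallyLE ?_)
  · filter_upwards [ae_restrict_mem (measurableSet_hb n r)] with y hy using hf0 y hy.1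
  · exact inter_subset_inter_right _ (Metric.closedBall_subset_closedBall ((le_max_left _ _).trans hr))

end HalfBall

section Fundamental

/-- The comparison function `(1 + |x|²)^(-(N-2)/2)`. -/
noncomputable def bubble (x : Eu N) : ℝ := (1 + ‖x‖ ^ 2) ^ (-((N : ℝ) - 2) / 2)

theorem one_add_sq_pos (x : Eu N) : 0 < 1 + ‖x‖ ^ 2 := by positivity

theorem contDiff_one_add_sq : ContDiff ℝ 2 fun x : Eu N => 1 + ‖x‖ ^ 2 :=
  contDiff_const.add (contDiff_norm_sq ℝ)

theorem contDiff_bubble : ContDiff ℝ 2 (bubble : Eu N → ℝ) :=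
  contDiff_one_add_sq.rpow_const_of_ne fun x => (one_add_sq_pos x).ne'

theorem pd_one_add_sq (i : Fin N) (x : Eu N) : pd i (fun y => 1 + ‖y‖ ^ 2) x = 2 * x i := by
  refine pd_eq_of_hasDerivAt (contDiff_one_add_sq.contDiffAt.differentiableAt (by norm_num)) ?_
  have h1 : HasDerivAt (fun t : ℝ => x + t • EuclideanSpace.single i (1 : ℝ))
      (EuclideanSpace.single i (1 : ℝ)) 0 := by
    simpa using ((hasDerivAt_id (0 : ℝ)).smul_const (EuclideanSpace.single i (1 : ℝ))).const_add x
  simpa [EuclideanSpace.inner_single_right] using h1.norm_sq.const_add 1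

theorem pd_rpow_one_add_sq (a : ℝ) (i : Fin N) (x : Eu N) :
    pd i (fun y => (1 + ‖y‖ ^ 2) ^ a) x = a * (1 + ‖x‖ ^ 2) ^ (a - 1) * (2 * x i) := by
  rw [pd_comp (f := fun y : Eu N => 1 + ‖y‖ ^ 2) (γ := fun t => t ^ a)
    (contDiff_one_add_sq.contDiffAt.differentiableAt (by norm_num))
    (Real.hasDerivAt_rpow_const (Or.inl (one_add_sq_pos x).ne')), pd_one_add_sq]

theorem pd_coord (i : Fin N) (x : Eu N) : pd i (fun y => y i) x = 1 := by
  refine pd_eq_of_hasDerivAt (by fun_prop) ?_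
  simpa using (hasDerivAt_id (0 : ℝ)).const_add (x i)

theorem lap_bubble (x : Eu N) :
    lap bubble x = -(N * ((N : ℝ) - 2)) * (1 + ‖x‖ ^ 2) ^ (-((N : ℝ) + 2) / 2) := by
  set s := 1 + ‖x‖ ^ 2 with hs
  have hs0 : 0 < s := one_add_sq_pos x
  have h1 : ∀ i, pd i bubble = fun y : Eu N => (-((N : ℝ) - 2)) * ((1 + ‖y‖ ^ 2) ^ (-(N : ℝ) / 2) * y i) := by
    intro i; funext y
    unfold bubble
    rw [pd_rpow_one_add_sq, show -((N : ℝ) - 2) / 2 - 1 = -(N : ℝ) / 2 by ring]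
    ring
  have h2 : ∀ i, pd i (pd i bubble) x = (-((N : ℝ) - 2)) * (s ^ (-((N : ℝ) + 2) / 2)
      * (s - N * x i ^ 2)) := by
    intro i
    have hd : DifferentiableAt ℝ (fun y : Eu N => (1 + ‖y‖ ^ 2) ^ (-(N : ℝ) / 2)) x :=
      (contDiff_one_add_sq.rpow_const_of_ne fun x => (one_add_sq_pos x).ne').contDiffAt.differentiableAt
        (by norm_num)
    rw [h1, pd_const_mul, pd_mul hd (by fun_prop), pd_rpow_one_add_sq, pd_coord,
      show -(N : ℝ) / 2 - 1 = -((N : ℝ) + 2) / 2 by ring, ← hs,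
      show -(N : ℝ) / 2 = -((N : ℝ) + 2) / 2 + 1 by ring, Real.rpow_add_one hs0.ne']
    ring
  rw [lap_eq_sum_pd, Finset.sum_congr rfl fun i _ => h2 i, ← Finset.mul_sum, ← Finset.mul_sum,
    Finset.sum_sub_distrib, ← Finset.mul_sum, ← EuclideanSpace.real_norm_sq_eq]
  simp only [Finset.sum_const, Finset.card_univ, Fintype.card_fin, nsmul_eq_mul]
  rw [hs]; ring

theorem bubble_pos (x : Eu N) : 0 < bubble x := Real.rpow_pos_of_pos (one_add_sq_pos x) _

theorem rpow_one_add_sq_le {a R : ℝ} (ha : 0 ≤ a) (hR : 0 < R) {x : Eu N} (hx : R ≤ ‖x‖) :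
    (1 + ‖x‖ ^ 2) ^ (-a / 2) ≤ R ^ (-a) := by
  have h1 : R ^ 2 ≤ 1 + ‖x‖ ^ 2 := by nlinarith
  calc (1 + ‖x‖ ^ 2) ^ (-a / 2) ≤ (R ^ 2) ^ (-a / 2) :=
        Real.rpow_le_rpow_of_nonpos (by positivity) h1 (by linarith)
    _ = R ^ (-a) := by
        rw [← Real.rpow_natCast, ← Real.rpow_mul hR.le]; congr 1; push_cast; ring

theorem abs_pd_bubble_le (hN : 2 ≤ N) {R : ℝ} (hR : 0 < R) {x : Eu N} (hx : R ≤ ‖x‖) (i : Fin N) :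
    |pd i bubble x| ≤ N * R ^ (-((N : ℝ) - 1)) := by
  have hN' : (2 : ℝ) ≤ N := by exact_mod_cast hN
  have hs0 := one_add_sq_pos x
  unfold bubble
  rw [pd_rpow_one_add_sq]
  have h1 : |x i| ≤ (1 + ‖x‖ ^ 2) ^ ((1 : ℝ) / 2) := by
    rw [← Real.sqrt_eq_rpow]
    refine Real.abs_le_sqrt ?_
    have := EuclideanSpace.real_norm_sq_eq x
    have h2 : x i ^ 2 ≤ ∑ j, x j ^ 2 :=
      Finset.single_le_sum (f := fun j => x j ^ 2) (fun j _ => sq_nonneg _) (Finset.mem_univ i)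
    linarith
  have h2 := rpow_one_add_sq_le (a := (N : ℝ) - 1) (by linarith) hR hx
  rw [abs_mul, abs_mul, abs_mul, abs_of_nonneg (Real.rpow_nonneg hs0.le _)]
  have e : |-((N : ℝ) - 2) / 2| * |(2 : ℝ)| = N - 2 := by
    rw [← abs_mul, show -((N : ℝ) - 2) / 2 * 2 = -((N : ℝ) - 2) by ring, abs_neg, abs_of_nonneg]
    linarith
  calc _ = (|-((N : ℝ) - 2) / 2| * |(2 : ℝ)|) * ((1 + ‖x‖ ^ 2) ^ (-((N : ℝ) - 2) / 2 - 1) * |x i|) := by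
        ring
    _ ≤ N * ((1 + ‖x‖ ^ 2) ^ (-((N : ℝ) - 2) / 2 - 1) * (1 + ‖x‖ ^ 2) ^ ((1 : ℝ) / 2)) := by
        rw [e]; gcongr; linarith
    _ = N * (1 + ‖x‖ ^ 2) ^ (-((N : ℝ) - 1) / 2) := by
        rw [← Real.rpow_add hs0]; congr 2; ring
    _ ≤ _ := by gcongr

end Fundamental

section Liouville

variable {n : Fin N}

theorem green_of_eventually_zero {f g : Eu N → ℝ} (hf : ContDiff ℝ 2 f) (hg : ContDiff ℝ 2 g)
    (hc : HasCompactSupport g) (hf0 : ∀ x : Eu N, x n = 0 → f =ᶠ[𝓝 x] fun _ => 0) :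
    ∫ x in hs n, (f x * lap g x - g x * lap f x) = 0 := by
  have hf1 : ∀ i, ContDiff ℝ 1 (pd i f) := fun i => contDiff_pd hf (by norm_num) i
  have hg1 : ∀ i, ContDiff ℝ 1 (pd i g) := fun i => contDiff_pd hg (by norm_num) i
  have hf' : ContDiff ℝ 1 f := hf.of_le (by norm_num)
  have hg' : ContDiff ℝ 1 g := hg.of_le (by norm_num)
  have key := integral_sum_pd_eq_zero_of_contDiff (n := n)
    (F := fun i y => f y * pd i g y - g y * pd i f y)
    (fun i => (hf'.mul (hg1 i)).sub (hg'.mul (hf1 i)))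
    (fun i x hx => by
      have e1 := (hf0 x hx).self_of_nhds
      simp only at e1 ⊢
      rw [e1, pd_congr (hf0 x hx) i, pd_const]; ring)
    (fun i => ((hasCompactSupport_pd hc i).mul_left).sub hc.mul_right)
  rw [← key]
  refine setIntegral_congr_fun (isOpen_hs n).measurableSet fun x _ => ?_
  have d : ∀ {h : Eu N → ℝ}, ContDiff ℝ 1 h → DifferentiableAt ℝ h x := fun hh =>
    hh.differentiable (by norm_num) x
  have hi : ∀ i, pd i (fun y => f y * pd i g y - g y * pd i f y) x
      = f x * pd i (pd i g) x - g x * pd i (pd i f) x := by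
    intro i
    rw [pd_sub ((d hf').fun_mul (d (hg1 i))) ((d hg').fun_mul (d (hf1 i))),
      pd_mul (d hf') (d (hg1 i)), pd_mul (d hg') (d (hf1 i))]
    ring
  rw [Finset.sum_congr rfl fun i _ => hi i, Finset.sum_sub_distrib, ← Finset.mul_sum,
    ← Finset.mul_sum, lap_eq_sum_pd, lap_eq_sum_pd]

theorem exists_bubble_cut_bound (hN : 3 ≤ N) : ∃ E : ℝ, 0 < E ∧ ∀ R : ℝ, 0 < R → ∀ x : Eu N,
    2 * ∑ i, pd i bubble x * pd i (cut R) x + bubble x * lap (cut R) x ≤ E * R ^ (-(N : ℝ)) := by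
  obtain ⟨C, hC, hb⟩ := exists_cut_bound (N := N)
  have hN0 : (3 : ℝ) ≤ N := by exact_mod_cast hN
  refine ⟨2 * (N * (N * C)) + N * C, by positivity, fun R hR x => ?_⟩
  rcases lt_or_ge ‖x‖ R with hx | hx
  · have e : cut R =ᶠ[𝓝 x] fun _ => (1 : ℝ) := by
      filter_upwards [continuous_norm.continuousAt.eventually (gt_mem_nhds hx)] with y hy
      exact cut_eq_one hR (le_of_lt hy)
    have c1 : ∀ i, pd i (fun _ : Eu N => (1 : ℝ)) = fun _ => 0 := fun i =>
      funext fun y => pd_const 1 i y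
    have e1 : ∀ i, pd i (cut R) x = 0 := fun i => by rw [pd_congr e i, pd_const]
    have e2 : lap (cut R) x = 0 := by
      rw [lap_congr e, lap_eq_sum_pd]
      exact Finset.sum_eq_zero fun i _ => by rw [c1, pd_const]
    simp only [e1, e2, mul_zero, Finset.sum_const_zero, add_zero]
    positivity
  · have b1 : ∑ i, pd i bubble x * pd i (cut R) x ≤ ∑ _i : Fin N, N * R ^ (-((N : ℝ) - 1)) * (C / R) := by
      refine Finset.sum_le_sum fun i _ => (le_abs_self _).trans ?_
      rw [abs_mul]
      exact mul_le_mul (abs_pd_bubble_le (by omega) hR hx i) (hb R hR x i i).1 (abs_nonneg _)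
        (by positivity)
    have b2 : lap (cut R) x ≤ ∑ _i : Fin N, C / R ^ 2 := by
      rw [lap_eq_sum_pd]
      exact Finset.sum_le_sum fun i _ => (le_abs_self _).trans (hb R hR x i i).2
    have b3 : bubble x ≤ R ^ (-((N : ℝ) - 2)) := rpow_one_add_sq_le (by linarith) hR hx
    have b0 := (bubble_pos x).le
    simp only [Finset.sum_const, Finset.card_univ, Fintype.card_fin, nsmul_eq_mul] at b1 b2
    have e1 : R ^ (-((N : ℝ) - 1)) = R ^ (-(N : ℝ)) * R := by
      rw [← Real.rpow_add_one hR.ne']; congr 1; ring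
    have e2 : R ^ (-((N : ℝ) - 2)) = R ^ (-(N : ℝ)) * R ^ 2 := by
      rw [← Real.rpow_add_natCast hR.ne']; congr 1; push_cast; ring
    have b4 : bubble x * lap (cut R) x ≤ R ^ (-((N : ℝ) - 2)) * (N * (C / R ^ 2)) :=
      (mul_le_mul_of_nonneg_left b2 b0).trans (mul_le_mul_of_nonneg_right b3 (by positivity))
    rw [e1] at b1
    rw [e2] at b4
    have e3 : N * (N * (R ^ (-(N : ℝ)) * R) * (C / R)) = N * (N * C) * R ^ (-(N : ℝ)) := by
      field_simp
    have e4 : R ^ (-(N : ℝ)) * R ^ 2 * (N * (C / R ^ 2)) = N * C * R ^ (-(N : ℝ)) := by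
      field_simp
    rw [e3] at b1
    rw [e4] at b4
    linarith

theorem eq_zero_of_subharmonic (hN : 3 ≤ N) {g : Eu N → ℝ} (hg : ContDiff ℝ 2 g)
    (hg0 : ∀ x ∈ hs n, 0 ≤ g x) (hlap : ∀ x ∈ hs n, 0 ≤ lap g x)
    (hbd : ∀ x : Eu N, x n = 0 → g =ᶠ[𝓝 x] fun _ => 0) {C a : ℝ} (ha : 0 < a)
    (hC : ∀ R : ℝ, 1 ≤ R → ∫ x in hb n R, g x ≤ C * R ^ ((N : ℝ) - a)) :
    ∀ x ∈ hs n, g x = 0 := by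
  obtain ⟨E, hE, hb⟩ := exists_bubble_cut_bound hN
  have hN0 : (3 : ℝ) ≤ N := by exact_mod_cast hN
  have hgc := hg.continuous
  have hbl : Continuous (lap (bubble : Eu N → ℝ)) :=
    (contDiff_lap (m := 0) contDiff_bubble (by norm_num)).continuous
  have hpos : ∀ x : Eu N, 0 < -lap bubble x := fun x => by
    rw [lap_bubble]
    have := Real.rpow_pos_of_pos (one_add_sq_pos x) (-((N : ℝ) + 2) / 2)
    have h2 : 0 < (N : ℝ) * (N - 2) := mul_pos (by linarith) (by linarith)
    nlinarith
  have key : ∀ x ∈ hs n, g x * (-lap bubble x) = 0 := by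
    refine eq_zero_of_tendsto_hb (C := E * (C * 2 ^ ((N : ℝ) - a))) (hgc.mul hbl.neg)
      (fun x hx => mul_nonneg (hg0 x hx) (hpos x).le) ha fun R hR => ?_
    have hR0 : 0 < R := by linarith
    have hc2 : ContDiff ℝ 2 (cut R : Eu N → ℝ) := (contDiff_cut R).of_le two_le_infty
    have hψ : ContDiff ℝ 2 fun y : Eu N => bubble y * cut R y := contDiff_bubble.mul hc2
    have hcs := hasCompactSupport_cut (N := N) hR0
    have hψc : HasCompactSupport fun y : Eu N => bubble y * cut R y := hcs.mul_left
    have hG := green_of_eventually_zero hg hψ hψc hbd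
    have hgl : Continuous (lap g) := (contDiff_lap (m := 0) hg (by norm_num)).continuous
    have hψl : Continuous (lap fun y : Eu N => bubble y * cut R y) :=
      (contDiff_lap (m := 0) hψ (by norm_num)).continuous
    set F1 : Eu N → ℝ := fun x => g x * lap (fun y => bubble y * cut R y) x
      - bubble x * cut R x * lap g x with hF1
    have i1 : IntegrableOn F1 (hs n) := by
      refine (nice_of_continuousOn (R := 2 * R) (Continuous.continuousOn ?_)
        fun x _ hx => ?_).integrableOn
      · exact (hgc.mul hψl).sub (hψ.continuous.mul hgl)
      · have e := cut_eventually_zero hR0 hx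
        have e' : (fun y => bubble y * cut R y) =ᶠ[𝓝 x] fun _ => 0 := by
          filter_upwards [e] with y hy
          rw [hy, mul_zero]
        have c0 : ∀ i, pd i (fun _ : Eu N => (0 : ℝ)) = fun _ => 0 := fun i =>
          funext fun y => pd_const 0 i y
        have e2 : lap (fun y => bubble y * cut R y) x = 0 := by
          rw [lap_congr e', lap_eq_sum_pd]
          exact Finset.sum_eq_zero fun i _ => by rw [c0, pd_const]
        simp only [hF1, e2, e.self_of_nhds]
        ring
    have i2 : IntegrableOn (fun x => g x * (-lap bubble x) * cut R x) (hs n) :=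
      (nice_mul_cut (n := n) (hgc.mul hbl.neg) hc2.continuous hcs).integrableOn
    calc ∫ x in HalfSpace.hb n R, g x * (-lap bubble x)
        ≤ ∫ x in hs n, g x * (-lap bubble x) * cut R x := by
          refine setIntegral_hb_le (hgc.mul hbl.neg) i2 (fun x hx => mul_nonneg (mul_nonneg (hg0 x hx)
            (hpos x).le) (cut_nonneg _ _)) fun x hx => ?_
          rw [cut_eq_one hR0 (mem_hb.mp hx).2, mul_one]
      _ = ∫ x in hs n, (g x * (-lap bubble x) * cut R x + F1 x) := by
          rw [integral_add i2 i1, hG, add_zero]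
      _ ≤ ∫ x in HalfSpace.hb n (2 * R), E * R ^ (-(N : ℝ)) * g x := by
          refine setIntegral_le_hb (continuous_const.mul hgc) (i2.add i1) (fun x hx hxR => ?_)
            fun x hx => ?_
          · have e := cut_eventually_zero hR0 hxR.le
            have e1 : ∀ i, pd i (cut R) x = 0 := pd_cut_eq_zero hR0 hxR.le
            have e2 : lap (cut R) x = 0 := by
              rw [lap_eq_sum_pd]
              exact Finset.sum_eq_zero fun i _ => pd_pd_cut_eq_zero hR0 hxR.le i i
            have e3 := e.self_of_nhds
            simp only [hF1]
            rw [lap_mul contDiff_bubble.contDiffAt hc2.contDiffAt]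
            simp [e1, e2, e3]
          · have hx' := (mem_hb.mp hx).1
            simp only [hF1]
            rw [lap_mul contDiff_bubble.contDiffAt hc2.contDiffAt]
            have h1 := mul_le_mul_of_nonneg_left (hb R hR0 x) (hg0 x hx')
            have h2 : 0 ≤ bubble x * cut R x * lap g x :=
              mul_nonneg (mul_nonneg (bubble_pos x).le (cut_nonneg _ _)) (hlap x hx')
            linarith
      _ = E * R ^ (-(N : ℝ)) * ∫ x in HalfSpace.hb n (2 * R), g x := integral_const_mul _ _
      _ ≤ E * R ^ (-(N : ℝ)) * (C * (2 * R) ^ ((N : ℝ) - a)) := by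
          gcongr; exact hC _ (by linarith)
      _ = _ := by
          rw [Real.mul_rpow (by norm_num) hR0.le, show -a = -(N : ℝ) + (N - a) by ring,
            Real.rpow_add hR0]
          ring
  intro x hx
  exact (mul_eq_zero.mp (key x hx)).resolve_right (hpos x).ne'

end Liouville

section Calculus

theorem eventually_differentiableAt {f : Eu N → ℝ} {x : Eu N} (hf : ContDiffAt ℝ 2 f x) :
    ∀ᶠ y in 𝓝 x, DifferentiableAt ℝ f y := by
  filter_upwards [hf.eventually (by simp)] with y hy using hy.differentiableAt (by norm_num)

theorem differentiableAt_pd {f : Eu N → ℝ} {x : Eu N} (hf : ContDiffAt ℝ 2 f x) (i : Fin N) :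
    DifferentiableAt ℝ (pd i f) x :=
  ((hf.fderiv_right (m := 1) (by norm_num)).clm_apply contDiffAt_const).differentiableAt
    (by norm_num)

theorem lap_add {f g : Eu N → ℝ} {x : Eu N} (hf : ContDiffAt ℝ 2 f x) (hg : ContDiffAt ℝ 2 g x) :
    lap (fun y => f y + g y) x = lap f x + lap g x := by
  rw [lap_eq_sum_pd, lap_eq_sum_pd, lap_eq_sum_pd, ← Finset.sum_add_distrib]
  refine Finset.sum_congr rfl fun i _ => ?_
  have e : pd i (fun y => f y + g y) =ᶠ[𝓝 x] fun y => pd i f y + pd i g y := by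
    filter_upwards [eventually_differentiableAt hf, eventually_differentiableAt hg] with y h1 h2
      using pd_add h1 h2 i
  rw [pd_congr e, pd_add (differentiableAt_pd hf i) (differentiableAt_pd hg i)]

theorem lap_const_mul (c : ℝ) (f : Eu N → ℝ) (x : Eu N) :
    lap (fun y => c * f y) x = c * lap f x := by
  rw [lap_eq_sum_pd, lap_eq_sum_pd, Finset.mul_sum]
  refine Finset.sum_congr rfl fun i _ => ?_
  have e : pd i (fun y => c * f y) = fun y => c * pd i f y := funext fun y => pd_const_mul c i
  rw [e, pd_const_mul]

theorem lap_comp {f : Eu N → ℝ} {γ γ₁ : ℝ → ℝ} {γ₂ : ℝ} {x : Eu N} (hf : ContDiffAt ℝ 2 f x)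
    (h1 : ∀ᶠ t in 𝓝 (f x), HasDerivAt γ (γ₁ t) t) (h2 : HasDerivAt γ₁ γ₂ (f x)) :
    lap (fun y => γ (f y)) x = γ₁ (f x) * lap f x + γ₂ * ∑ i, pd i f x ^ 2 := by
  rw [lap_eq_sum_pd, lap_eq_sum_pd, Finset.mul_sum, Finset.mul_sum, ← Finset.sum_add_distrib]
  refine Finset.sum_congr rfl fun i _ => ?_
  have hd := hf.differentiableAt (by norm_num)
  have e : pd i (fun y => γ (f y)) =ᶠ[𝓝 x] fun y => γ₁ (f y) * pd i f y := by
    filter_upwards [eventually_differentiableAt hf, hf.continuousAt.eventually h1] with y h3 h4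
      using pd_comp h3 h4 i
  rw [pd_congr e, pd_mul (f := fun y => γ₁ (f y)) (h2.differentiableAt.comp x hd) (differentiableAt_pd hf i),
    pd_comp hd h2]
  ring

end Calculus

section Convex

theorem hasDerivAt_max_pow (k : ℕ) (t : ℝ) :
    HasDerivAt (fun t : ℝ => max t 0 ^ (k + 2)) ((k + 2) * max t 0 ^ (k + 1)) t := by
  rcases lt_trichotomy t 0 with h | rfl | h
  · have e : (fun t : ℝ => max t 0 ^ (k + 2)) =ᶠ[𝓝 t] fun _ => 0 := by
      filter_upwards [gt_mem_nhds h] with s hs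
      rw [max_eq_right (le_of_lt hs)]; simp
    rw [max_eq_right h.le]
    simpa using (hasDerivAt_const t (0 : ℝ)).congr_of_eventuallyEq e
  · have : HasDerivAt (fun t : ℝ => max t 0 ^ (k + 2)) 0 0 := by
      rw [hasDerivAt_iff_isLittleO]
      simp only [max_self, ne_eq, Nat.add_eq_zero_iff, OfNat.ofNat_ne_zero, and_false, not_false_eq_true,
        zero_pow, sub_zero, smul_zero]
      have h1 : (fun t : ℝ => max t 0 ^ (k + 2)) =O[𝓝 0] fun t => t ^ (k + 2) := by
        refine Asymptotics.IsBigO.of_bound 1 (Eventually.of_forall fun t => ?_)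
        rw [norm_pow, norm_pow, one_mul]
        refine pow_le_pow_left₀ (norm_nonneg _) ?_ _
        rw [Real.norm_eq_abs, Real.norm_eq_abs, abs_of_nonneg (le_max_right _ _)]
        exact max_le (le_abs_self _) (abs_nonneg _)
      refine h1.trans_isLittleO ?_
      simpa using Asymptotics.isLittleO_pow_pow (𝕜 := ℝ) (show 1 < k + 2 by omega)
    simpa using this
  · have e : (fun t : ℝ => max t 0 ^ (k + 2)) =ᶠ[𝓝 t] fun t => t ^ (k + 2) := by
      filter_upwards [lt_mem_nhds h] with s hs
      rw [max_eq_left (le_of_lt hs)]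
    rw [max_eq_left h.le]
    have := (hasDerivAt_pow (k + 2) t).congr_of_eventuallyEq e
    simpa using this

/-- A convex function of class `C²` which vanishes on the negative axis and is bounded by `t²`. -/
noncomputable def bump (t : ℝ) : ℝ := max t 0 ^ 4 / (1 + t ^ 2)

/-- The derivative of `bump`. -/
noncomputable def bumpDeriv (t : ℝ) : ℝ :=
  (4 * max t 0 ^ 3 * (1 + t ^ 2) - max t 0 ^ 4 * (2 * t)) / (1 + t ^ 2) ^ 2

/-- The second derivative of `bump`. -/
noncomputable def bumpDeriv₂ (t : ℝ) : ℝ :=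
  ((12 * max t 0 ^ 2 * (1 + t ^ 2) - 2 * max t 0 ^ 4) * (1 + t ^ 2) ^ 2
    - (4 * max t 0 ^ 3 * (1 + t ^ 2) - max t 0 ^ 4 * (2 * t)) * (4 * t * (1 + t ^ 2)))
    / ((1 + t ^ 2) ^ 2) ^ 2

theorem hasDerivAt_one_add_sq (t : ℝ) : HasDerivAt (fun t : ℝ => 1 + t ^ 2) (2 * t) t := by
  simpa using (hasDerivAt_pow 2 t).const_add 1

theorem hasDerivAt_bump (t : ℝ) : HasDerivAt bump (bumpDeriv t) t := by
  have h : HasDerivAt bump _ t :=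
    (hasDerivAt_max_pow 2 t).fun_div (hasDerivAt_one_add_sq t) (by positivity)
  refine h.congr_deriv ?_
  unfold bumpDeriv
  norm_num

theorem hasDerivAt_bumpDeriv (t : ℝ) : HasDerivAt bumpDeriv (bumpDeriv₂ t) t := by
  have h3 := hasDerivAt_max_pow 1 t
  have h4 := hasDerivAt_max_pow 2 t
  have hs := hasDerivAt_one_add_sq t
  have hid : HasDerivAt (fun s : ℝ => 2 * s) 2 t := by
    simpa using (hasDerivAt_id t).const_mul (2 : ℝ)
  have h0 : (1 + t ^ 2) ^ 2 ≠ 0 := by positivity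
  have h : HasDerivAt bumpDeriv _ t :=
    (((h3.const_mul 4).fun_mul hs).fun_sub (h4.fun_mul hid)).fun_div (hs.fun_pow 2) h0
  refine h.congr_deriv ?_
  unfold bumpDeriv₂
  congr 1
  push_cast
  ring

theorem bump_nonneg (t : ℝ) : 0 ≤ bump t := by unfold bump; positivity

theorem bump_le (t : ℝ) : bump t ≤ max t 0 ^ 2 := by
  unfold bump
  rw [div_le_iff₀ (by positivity)]
  have h1 : max t 0 ^ 2 ≤ t ^ 2 := by
    rcases le_total t 0 with h | h
    · rw [max_eq_right h]; simpa using sq_nonneg t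
    · rw [max_eq_left h]
  nlinarith [sq_nonneg (max t 0)]

theorem bump_eq_zero {t : ℝ} (h : t ≤ 0) : bump t = 0 := by
  simp [bump, max_eq_right h]

theorem nonpos_of_bump_eq_zero {t : ℝ} (h : bump t = 0) : t ≤ 0 := by
  by_contra! ht
  have : 0 < bump t := by
    unfold bump; rw [max_eq_left ht.le]; positivity
  exact this.ne' h

theorem bumpDeriv_nonneg (t : ℝ) : 0 ≤ bumpDeriv t := by
  unfold bumpDeriv
  rcases le_total t 0 with h | h
  · simp [max_eq_right h]
  · rw [max_eq_left h]
    refine div_nonneg ?_ (by positivity)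
    have : 4 * t ^ 3 * (1 + t ^ 2) - t ^ 4 * (2 * t) = 4 * t ^ 3 + 2 * t ^ 5 := by ring
    rw [this]; positivity

theorem bumpDeriv_eq_zero {t : ℝ} (h : t ≤ 0) : bumpDeriv t = 0 := by
  simp [bumpDeriv, max_eq_right h]

theorem bumpDeriv₂_nonneg (t : ℝ) : 0 ≤ bumpDeriv₂ t := by
  unfold bumpDeriv₂
  rcases le_total t 0 with h | h
  · simp [max_eq_right h]
  · rw [max_eq_left h]
    refine div_nonneg ?_ (by positivity)
    have : (12 * t ^ 2 * (1 + t ^ 2) - 2 * t ^ 4) * (1 + t ^ 2) ^ 2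
      - (4 * t ^ 3 * (1 + t ^ 2) - t ^ 4 * (2 * t)) * (4 * t * (1 + t ^ 2))
      = (1 + t ^ 2) * (12 * t ^ 2 + 6 * t ^ 4 + 2 * t ^ 6) := by ring
    rw [this]; positivity

theorem contDiff_bump : ContDiff ℝ 2 bump := by
  have hd : deriv bump = bumpDeriv := funext fun t => (hasDerivAt_bump t).deriv
  have hd2 : deriv bumpDeriv = bumpDeriv₂ := funext fun t => (hasDerivAt_bumpDeriv t).deriv
  have h1 : ContDiff ℝ 1 bumpDeriv := by
    rw [contDiff_one_iff_deriv, hd2]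
    refine ⟨fun t => (hasDerivAt_bumpDeriv t).differentiableAt, ?_⟩
    unfold bumpDeriv₂
    exact Continuous.div (by fun_prop) (by fun_prop) fun t => by positivity
  rw [show (2 : WithTop ℕ∞) = 1 + 1 by norm_num, contDiff_succ_iff_deriv, hd]
  exact ⟨fun t => (hasDerivAt_bump t).differentiableAt, by simp, h1⟩

end Convex

section Comparison

variable {n : Fin N} {p : ℝ} {u : Eu N → ℝ}

theorem Sol.continuous (h : Sol n p u) : Continuous u := h.smooth.continuous

theorem Sol.continuous_lap (h : Sol n p u) : Continuous (lap u) := h.contDiff_lap.continuous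

theorem Sol.continuous_rpow (h : Sol n p u) {a : ℝ} (ha : 0 ≤ a) : Continuous fun x => u x ^ a :=
  h.continuous.rpow_const fun _ => Or.inr ha

theorem Sol.energy_ball (h : Sol n p u) : ∃ C : ℝ, 0 < C ∧ ∀ R : ℝ, 0 < R →
    ∫ x in hb n R, lap u x ^ 2 ≤ C * R ^ ((N : ℝ) - 4 * (p + 1) / (p - 1)) ∧
    ∫ x in hb n R, u x ^ (p + 1) ≤ C * R ^ ((N : ℝ) - 4 * (p + 1) / (p - 1)) := by
  obtain ⟨k, C, hC, hb⟩ := h.energy_estimate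
  have hp := h.hp
  refine ⟨C, hC, fun R hR => ?_⟩
  obtain ⟨h1, h2⟩ := hb R hR
  have e : R⁻¹ ^ (4 * (p + 1) / (p - 1)) * R ^ N = R ^ ((N : ℝ) - 4 * (p + 1) / (p - 1)) := by
    rw [Real.inv_rpow hR.le, ← Real.rpow_neg hR.le, ← Real.rpow_natCast, ← Real.rpow_add hR]
    congr 1; ring
  rw [e] at h1 h2
  have hcc : Continuous (cut R : Eu N → ℝ) := (contDiff_cut R).continuous
  have hsq : HasCompactSupport fun y : Eu N => (cut R y ^ (k + 2)) ^ 2 := by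
    refine (hasCompactSupport_cut hR).mono fun x hx => ?_
    simp only [Function.mem_support] at hx ⊢
    intro h0; exact hx (by simp [h0])
  refine ⟨(setIntegral_hb_le (h.continuous_lap.pow 2) ?_ (fun x _ => sq_nonneg _) fun x hx => ?_).trans h1,
    (setIntegral_hb_le (h.continuous_rpow (by linarith)) ?_ (fun x hx => ?_) fun x hx => ?_).trans h2⟩
  · have := nice_mul_cut (n := n) (h.continuous_lap.pow 2) ((hcc.pow (k + 2)).pow 2) hsq
    exact this.integrableOn.congr_fun (fun x _ => (mul_pow _ _ _).symm) (isOpen_hs n).measurableSet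
  · rw [cut_eq_one hR (mem_hb.mp hx).2]; simp
  · exact (nice_mul_cut (n := n) (h.continuous_rpow (by linarith)) ((hcc.pow (k + 2)).pow 2)
      hsq).integrableOn
  · have := h.pos x hx; positivity
  · rw [cut_eq_one hR (mem_hb.mp hx).2]; simp

theorem contDiffAt_rpow (h : Sol n p u) {x : Eu N} (hx : x ∈ hs n) (a : ℝ) :
    ContDiffAt ℝ 2 (fun y => u y ^ a) x :=
  h.contDiff_two.contDiffAt.rpow_const_of_ne (h.pos x hx).ne'

/-- The comparison inequality between a solution and its Laplacian. -/
theorem Sol.le_neg_lap (h : Sol n p u) (hN : 3 ≤ N) : ∀ x ∈ hs n,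
    √(2 / (p + 1)) * u x ^ ((p + 1) / 2) ≤ -lap u x := by
  have hp := h.hp
  set l := √(2 / (p + 1)) with hl
  have hl0 : 0 < l := Real.sqrt_pos.mpr (div_pos two_pos (by linarith))
  have hll : l ^ 2 * ((p + 1) / 2) = 1 := by
    rw [hl, Real.sq_sqrt (by positivity)]; field_simp
  set w : Eu N → ℝ := fun x => l * u x ^ ((p + 1) / 2) + lap u x with hw
  have hwc : Continuous w :=
    (continuous_const.mul (h.continuous_rpow (by linarith))).add h.continuous_lap
  have hw2 : ∀ x ∈ hs n, ContDiffAt ℝ 2 w x := fun x hx =>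
    (contDiffAt_const.mul (contDiffAt_rpow h hx _)).add h.contDiff_lap.contDiffAt
  have hlapw : ∀ x ∈ hs n, 0 < w x → 0 ≤ lap w x := by
    intro x hx hwx
    have hu := h.pos x hx
    have e1 : lap (fun y => u y ^ ((p + 1) / 2)) x
        = (p + 1) / 2 * u x ^ ((p + 1) / 2 - 1) * lap u x
          + (p + 1) / 2 * (((p + 1) / 2 - 1) * u x ^ ((p + 1) / 2 - 1 - 1)) * ∑ i, pd i u x ^ 2 := by
      refine lap_comp (γ := fun t => t ^ ((p + 1) / 2))
        (γ₁ := fun t => (p + 1) / 2 * t ^ ((p + 1) / 2 - 1)) h.contDiff_two.contDiffAt ?_ ?_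
      · filter_upwards [lt_mem_nhds hu] with t ht
        exact Real.hasDerivAt_rpow_const (Or.inl ht.ne')
      · exact (Real.hasDerivAt_rpow_const (Or.inl hu.ne')).const_mul _
    have e2 : lap w x = l * lap (fun y => u y ^ ((p + 1) / 2)) x + u x ^ p := by
      rw [hw, lap_add (contDiffAt_const.mul (contDiffAt_rpow h hx _)) h.contDiff_lap.contDiffAt,
        lap_const_mul, h.eqn x hx]
    have e3 : u x ^ p = u x ^ ((p + 1) / 2 - 1) * u x ^ ((p + 1) / 2) := by
      rw [← Real.rpow_add hu]; congr 1; ring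
    rw [e2, e1, e3]
    have g1 : 0 ≤ ∑ i, pd i u x ^ 2 := Finset.sum_nonneg fun i _ => sq_nonneg _
    have g2 : 0 ≤ (p + 1) / 2 * (((p + 1) / 2 - 1) * u x ^ ((p + 1) / 2 - 1 - 1)) := by
      have : 0 ≤ (p + 1) / 2 - 1 := by linarith
      positivity
    have g3 : 0 ≤ l * (p + 1) / 2 * u x ^ ((p + 1) / 2 - 1) * w x := by positivity
    have g4 : l * (p + 1) / 2 * u x ^ ((p + 1) / 2 - 1) * w x
        = l * ((p + 1) / 2 * u x ^ ((p + 1) / 2 - 1) * lap u x)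
          + (l ^ 2 * ((p + 1) / 2)) * (u x ^ ((p + 1) / 2 - 1) * u x ^ ((p + 1) / 2)) := by
      simp only [hw]; ring
    rw [hll, one_mul] at g4
    have g5 := mul_nonneg hl0.le (mul_nonneg g2 g1)
    linarith
  obtain ⟨C, hC, hen⟩ := h.energy_ball
  intro x hx
  suffices H : ∀ ε : ℝ, 0 < ε → w x ≤ ε by
    have := le_of_forall_pos_le_add (a := w x) (b := 0) fun ε hε => by simpa using H ε hε
    simp only [hw] at this
    linarith
  intro ε hε
  classical
  set g : Eu N → ℝ := fun y => if 0 < y n then bump (w y - ε) else 0 with hg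
  have gin : ∀ y ∈ hs n, g y = bump (w y - ε) := fun y hy => if_pos hy
  have gev : ∀ y ∈ hs n, g =ᶠ[𝓝 y] fun z => bump (w z - ε) := fun y hy => by
    filter_upwards [(isOpen_hs n).mem_nhds hy] with z hz using gin z hz
  have gbd : ∀ y : Eu N, y n = 0 → g =ᶠ[𝓝 y] fun _ => 0 := by
    intro y hy
    have hwy : w y = 0 := by
      simp only [hw, h.bdry y hy, h.bdry_lap y hy]
      rw [Real.zero_rpow (by linarith)]; simp
    filter_upwards [hwc.continuousAt.eventually (gt_mem_nhds (show w y < ε by rw [hwy]; exact hε))]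
      with z hz
    simp only [hg]
    split_ifs
    · exact bump_eq_zero (by linarith)
    · rfl
  have gsm : ContDiff ℝ 2 g := by
    rw [contDiff_iff_contDiffAt]
    intro y
    rcases lt_trichotomy (y n) 0 with hy | hy | hy
    · have : g =ᶠ[𝓝 y] fun _ => 0 := by
        have hc : Continuous fun z : Eu N => z n := by fun_prop
        filter_upwards [hc.continuousAt.eventually (gt_mem_nhds hy)] with z hz
        exact if_neg (not_lt.mpr (le_of_lt hz))
      exact contDiffAt_const.congr_of_eventuallyEq this
    · exact contDiffAt_const.congr_of_eventuallyEq (gbd y hy)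
    · refine ContDiffAt.congr_of_eventuallyEq ?_ (gev y hy)
      exact contDiff_bump.contDiffAt.comp y ((hw2 y hy).sub contDiffAt_const)
  have glap : ∀ y ∈ hs n, 0 ≤ lap g y := by
    intro y hy
    rw [lap_congr (gev y hy), lap_comp (γ := fun t => bump (t - ε)) (γ₁ := fun t => bumpDeriv (t - ε))
      (γ₂ := bumpDeriv₂ (w y - ε)) (hw2 y hy)
      (Eventually.of_forall fun t => (hasDerivAt_bump (t - ε)).comp_sub_const t ε)
      ((hasDerivAt_bumpDeriv (w y - ε)).comp_sub_const (w y) ε)]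
    refine add_nonneg ?_ (mul_nonneg (bumpDeriv₂_nonneg _)
      (Finset.sum_nonneg fun i _ => sq_nonneg _))
    rcases le_or_gt (w y - ε) 0 with h0 | h0
    · rw [bumpDeriv_eq_zero h0, zero_mul]
    · exact mul_nonneg (bumpDeriv_nonneg _) (hlapw y hy (by linarith))
  have gint : ∀ R : ℝ, 1 ≤ R → ∫ y in hb n R, g y
      ≤ (2 * l ^ 2 * C + 2 * C) * R ^ ((N : ℝ) - 4 * (p + 1) / (p - 1)) := by
    intro R hR
    obtain ⟨h1, h2⟩ := hen R (by linarith)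
    have i1 : IntegrableOn (fun y => 2 * l ^ 2 * u y ^ (p + 1)) (hb n R) :=
      integrableOn_hb (continuous_const.mul (h.continuous_rpow (by linarith))) n R
    have i2 : IntegrableOn (fun y => 2 * lap u y ^ 2) (hb n R) :=
      integrableOn_hb (continuous_const.mul (h.continuous_lap.pow 2)) n R
    calc ∫ y in hb n R, g y
        ≤ ∫ y in hb n R, (2 * l ^ 2 * u y ^ (p + 1) + 2 * lap u y ^ 2) := by
          refine setIntegral_mono_on (integrableOn_hb gsm.continuous n R) (i1.add i2)
            (measurableSet_hb n R) fun y hy => ?_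
          have hy' := (mem_hb.mp hy).1
          rw [gin y hy']
          refine (bump_le _).trans ?_
          have b1 : max (w y - ε) 0 ^ 2 ≤ w y ^ 2 := by
            rcases le_total (w y - ε) 0 with h0 | h0
            · rw [max_eq_right h0]; simpa using sq_nonneg (w y)
            · rw [max_eq_left h0]
              exact pow_le_pow_left₀ h0 (by linarith) 2
          have b2 : u y ^ (p + 1) = (u y ^ ((p + 1) / 2)) ^ 2 := by
            rw [← Real.rpow_mul_natCast (h.pos y hy').le]; congr 1; push_cast; ring
          rw [b2]
          refine b1.trans ?_
          simp only [hw]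
          nlinarith [sq_nonneg (l * u y ^ ((p + 1) / 2) - lap u y)]
      _ = 2 * l ^ 2 * (∫ y in hb n R, u y ^ (p + 1)) + 2 * ∫ y in hb n R, lap u y ^ 2 := by
          rw [integral_add i1 i2, integral_const_mul, integral_const_mul]
      _ ≤ 2 * l ^ 2 * (C * R ^ ((N : ℝ) - 4 * (p + 1) / (p - 1)))
          + 2 * (C * R ^ ((N : ℝ) - 4 * (p + 1) / (p - 1))) := by gcongr
      _ = _ := by ring
  have ha : 0 < 4 * (p + 1) / (p - 1) := div_pos (by linarith) (by linarith)
  have := eq_zero_of_subharmonic hN gsm (fun y hy => by rw [gin y hy]; exact bump_nonneg _) glap gbd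
    ha gint x hx
  rw [gin x hx] at this
  linarith [nonpos_of_bump_eq_zero this]

end Comparison

section Testing

variable {n : Fin N}

theorem exists_cut_grad_bound : ∃ C : ℝ, 0 < C ∧ ∀ R : ℝ, 0 < R → ∀ x : Eu N,
    ∑ i, pd i (cut R) x ^ 2 ≤ C * R⁻¹ ^ 2 ∧ |lap (cut R) x| ≤ C * R⁻¹ ^ 2 := by
  obtain ⟨C, hC, hb⟩ := exists_cut_bound (N := N)
  refine ⟨N * C ^ 2 + N * C + 1, by positivity, fun R hR x => ⟨?_, ?_⟩⟩
  · calc ∑ i, pd i (cut R) x ^ 2 ≤ ∑ _i : Fin N, (C / R) ^ 2 := by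
          refine Finset.sum_le_sum fun i _ => ?_
          rw [← sq_abs]
          exact pow_le_pow_left₀ (abs_nonneg _) (hb R hR x i i).1 2
      _ = N * C ^ 2 * R⁻¹ ^ 2 := by
          simp only [Finset.sum_const, Finset.card_univ, Fintype.card_fin, nsmul_eq_mul]
          field_simp
      _ ≤ _ := by
          refine mul_le_mul_of_nonneg_right ?_ (by positivity)
          have : 0 ≤ N * C := by positivity
          linarith
  · calc |lap (cut R) x| ≤ ∑ _i : Fin N, C / R ^ 2 := by
          rw [lap_eq_sum_pd]
          exact (Finset.abs_sum_le_sum_abs _ _).trans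
            (Finset.sum_le_sum fun i _ => (hb R hR x i i).2)
      _ = N * C * R⁻¹ ^ 2 := by
          simp only [Finset.sum_const, Finset.card_univ, Fintype.card_fin, nsmul_eq_mul]
          field_simp
      _ ≤ _ := by
          refine mul_le_mul_of_nonneg_right ?_ (by positivity)
          have : 0 ≤ N * C ^ 2 := by positivity
          linarith

theorem pd_rpow {f : Eu N → ℝ} {x : Eu N} (hf : DifferentiableAt ℝ f x) {a : ℝ} (ha : 1 ≤ a)
    (i : Fin N) : pd i (fun y => f y ^ a) x = a * f x ^ (a - 1) * pd i f x :=
  pd_comp hf (Real.hasDerivAt_rpow_const (Or.inr ha)) i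

theorem contDiff_rpow_one {f : Eu N → ℝ} (hf : ContDiff ℝ 1 f) {a : ℝ} (ha : 1 ≤ a) :
    ContDiff ℝ 1 fun y => f y ^ a :=
  hf.rpow_const_of_le (m := 1) (by exact_mod_cast ha)

theorem exists_test_inequality : ∃ E : ℝ, 0 < E ∧ ∀ (z : Eu N → ℝ) (m R : ℝ), ContDiff ℝ 2 z →
    (∀ x ∈ hs n, 0 < z x) → (∀ x : Eu N, x n = 0 → z x = 0) → 2 ≤ m → 0 < R →
    ∫ x in hs n, ∑ i, pd i (fun y => z y ^ (m / 2) * cut R y) x ^ 2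
      ≤ m ^ 2 / (4 * (m - 1)) * (∫ x in hs n, -lap z x * z x ^ (m - 1) * cut R x ^ 2)
        + E * R⁻¹ ^ 2 * ∫ x in hb n (2 * R), z x ^ m := by
  obtain ⟨C, hC, hb⟩ := exists_cut_grad_bound (N := N)
  refine ⟨2 * C, by positivity, fun z m R hz hzpos hz0 hm hR => ?_⟩
  set a := m ^ 2 / (4 * (m - 1)) with ha
  have hm1 : 0 < m - 1 := by linarith
  have hz1 : ContDiff ℝ 1 z := hz.of_le (by norm_num)
  have hdz : ∀ i, ContDiff ℝ 1 (pd i z) := fun i => contDiff_pd hz (by norm_num) i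
  have hc2 : ContDiff ℝ 2 (cut R : Eu N → ℝ) := (contDiff_cut R).of_le two_le_infty
  have hc1 : ContDiff ℝ 1 (cut R : Eu N → ℝ) := hc2.of_le (by norm_num)
  have hdc : ∀ i, ContDiff ℝ 1 (pd i (cut R) : Eu N → ℝ) := fun i => contDiff_pd hc2 (by norm_num) i
  have hcs := hasCompactSupport_cut (N := N) hR
  have hzl : Continuous (lap z) := (contDiff_lap (m := 0) hz (by norm_num)).continuous
  have hzm1 : ContDiff ℝ 1 fun y => z y ^ (m - 1) := contDiff_rpow_one hz1 (by linarith)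
  have hzm : ContDiff ℝ 1 fun y => z y ^ m := contDiff_rpow_one hz1 (by linarith)
  have hzh : ContDiff ℝ 1 fun y => z y ^ (m / 2) := contDiff_rpow_one hz1 (by linarith)
  set G : Fin N → Eu N → ℝ := fun i y => a * (z y ^ (m - 1) * (cut R y * cut R y * pd i z y))
    + (1 - 2 * a / m) * (z y ^ m * (cut R y * pd i (cut R) y)) with hG
  have s1 : ∀ i, ContDiff ℝ 1 fun y => z y ^ (m - 1) * (cut R y * cut R y * pd i z y) := fun i =>
    hzm1.mul ((hc1.mul hc1).mul (hdz i))
  have s2 : ∀ i, ContDiff ℝ 1 fun y => z y ^ m * (cut R y * pd i (cut R) y) := fun i =>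
    hzm.mul (hc1.mul (hdc i))
  have hG1 : ∀ i, ContDiff ℝ 1 (G i) := fun i =>
    (contDiff_const.mul (s1 i)).add (contDiff_const.mul (s2 i))
  have hGc : ∀ i, HasCompactSupport (G i) := by
    intro i
    refine hcs.mono fun x hx => ?_
    simp only [Function.mem_support, hG] at hx ⊢
    intro h0; exact hx (by rw [h0]; ring)
  have hG0 : ∀ i (x : Eu N), x n = 0 → G i x = 0 := by
    intro i x hx
    simp only [hG]
    rw [hz0 x hx, Real.zero_rpow hm1.ne', Real.zero_rpow (by linarith)]
    ring
  have hdiv := integral_sum_pd_eq_zero_of_contDiff hG1 hG0 hGc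
  have hφ1 : ContDiff ℝ 1 fun y => z y ^ (m / 2) * cut R y := hzh.mul hc1
  have hφc : HasCompactSupport fun y => z y ^ (m / 2) * cut R y := hcs.mul_left
  have iφ : IntegrableOn (fun x => ∑ i, pd i (fun y => z y ^ (m / 2) * cut R y) x ^ 2) (hs n) := by
    refine (Nice.sum fun i _ => ?_).integrableOn
    have hcsi := hasCompactSupport_pd hφc i
    have hc := (contDiff_pd (m := 0) hφ1 (by norm_num) i).continuous
    refine nice_of_continuous (hc.pow 2) ?_
    refine hcsi.mono fun x hx => ?_
    simp only [Function.mem_support] at hx ⊢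
    intro h0; exact hx (by rw [h0]; ring)
  have iG : IntegrableOn (fun x => ∑ i, pd i (G i) x) (hs n) := by
    refine (Nice.sum fun i _ => ?_).integrableOn
    exact nice_of_continuous (contDiff_pd (m := 0) (hG1 i) (by norm_num) i).continuous
      (hasCompactSupport_pd (hGc i) i)
  have iz : IntegrableOn (fun x => -lap z x * z x ^ (m - 1) * cut R x ^ 2) (hs n) := by
    refine (nice_mul_cut (n := n) (hzl.neg.mul hzm1.continuous) (hc1.continuous.pow 2) ?_).integrableOn
    refine hcs.mono fun x hx => ?_
    simp only [Function.mem_support] at hx ⊢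
    intro h0; exact hx (by simp [Pi.pow_apply, h0])
  have ident : ∀ x ∈ hs n, ∑ i, pd i (fun y => z y ^ (m / 2) * cut R y) x ^ 2
      = ∑ i, pd i (G i) x + a * (-lap z x * z x ^ (m - 1) * cut R x ^ 2)
        + z x ^ m * (2 * a / m * ∑ i, pd i (cut R) x ^ 2
          + (2 * a / m - 1) * (cut R x * lap (cut R) x)) := by
    intro x hx
    have hzx := hzpos x hx
    have d : ∀ {h : Eu N → ℝ}, ContDiff ℝ 1 h → DifferentiableAt ℝ h x := fun hh =>
      hh.differentiable (by norm_num) x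
    have hi : ∀ i, pd i (fun y => z y ^ (m / 2) * cut R y) x ^ 2
        = pd i (G i) x + a * (z x ^ (m - 1) * cut R x ^ 2) * (-pd i (pd i z) x)
          + z x ^ m * (2 * a / m * pd i (cut R) x ^ 2
          + (2 * a / m - 1) * (cut R x * pd i (pd i (cut R)) x)) := by
      intro i
      have e1 : pd i (G i) x = a * ((m - 1) * z x ^ (m - 1 - 1) * pd i z x
            * (cut R x * cut R x * pd i z x)
          + z x ^ (m - 1) * ((pd i (cut R) x * cut R x + cut R x * pd i (cut R) x) * pd i z x
            + cut R x * cut R x * pd i (pd i z) x))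
          + (1 - 2 * a / m) * (m * z x ^ (m - 1) * pd i z x * (cut R x * pd i (cut R) x)
            + z x ^ m * (pd i (cut R) x * pd i (cut R) x + cut R x * pd i (pd i (cut R)) x)) := by
        simp only [hG]
        rw [pd_add ((d (s1 i)).const_mul _) ((d (s2 i)).const_mul _), pd_const_mul, pd_const_mul,
          pd_mul (d hzm1) (d ((hc1.mul hc1).mul (hdz i))),
          pd_mul (d (hc1.mul hc1)) (d (hdz i)), pd_mul (d hc1) (d hc1),
          pd_mul (d hzm) (d (hc1.mul (hdc i))), pd_mul (d hc1) (d (hdc i)),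
          pd_rpow (d hz1) (by linarith), pd_rpow (d hz1) (by linarith)]
      rw [e1, pd_mul (d hzh) (d hc1), pd_rpow (d hz1) (by linarith)]
      set q := z x ^ (m / 2 - 1) with hq
      have q1 : z x ^ (m / 2) = q * z x := by
        rw [hq, ← Real.rpow_add_one hzx.ne']; congr 1; ring
      have q2 : z x ^ (m - 1 - 1) = q * q := by
        rw [hq, ← Real.rpow_add hzx]; congr 1; ring
      have q3 : z x ^ (m - 1) = q * q * z x := by
        rw [← q2, ← Real.rpow_add_one hzx.ne']; congr 1; ring
      have q4 : z x ^ m = q * q * z x * z x := by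
        rw [← q3, ← Real.rpow_add_one hzx.ne']; congr 1; ring
      rw [q1, q2, q3, q4, ha]
      have hm0 : m ≠ 0 := by linarith
      field_simp
      ring
    rw [Finset.sum_congr rfl fun i _ => hi i, Finset.sum_add_distrib, Finset.sum_add_distrib,
      ← Finset.mul_sum, ← Finset.mul_sum, Finset.sum_add_distrib, ← Finset.mul_sum,
      ← Finset.mul_sum, ← Finset.mul_sum, Finset.sum_neg_distrib, lap_eq_sum_pd, lap_eq_sum_pd]
    ring
  have ib : 2 * a / m ≤ 1 ∧ 0 ≤ 2 * a / m := by
    have : 2 * a / m = m / (2 * (m - 1)) := by rw [ha]; field_simp; ring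
    rw [this]
    exact ⟨(div_le_one (by linarith)).mpr (by linarith), by positivity⟩
  have main : ∫ x in hs n, (∑ i, pd i (fun y => z y ^ (m / 2) * cut R y) x ^ 2
      - (∑ i, pd i (G i) x + a * (-lap z x * z x ^ (m - 1) * cut R x ^ 2)))
      ≤ ∫ x in HalfSpace.hb n (2 * R), 2 * C * R⁻¹ ^ 2 * z x ^ m := by
    refine setIntegral_le_hb (continuous_const.mul hzm.continuous)
      (iφ.sub (iG.add (iz.const_mul a))) (fun x hx hxR => ?_) fun x hx => ?_
    · rw [ident x hx]
      have e1 : ∀ i, pd i (cut R) x = 0 := pd_cut_eq_zero hR hxR.le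
      have e3 := cut_eq_zero hR hxR.le
      simp [e1, e3]
    · have hx' := (mem_hb.mp hx).1
      rw [ident x hx']
      obtain ⟨b1, b2⟩ := hb R hR x
      have b3 : 0 ≤ ∑ i, pd i (cut R) x ^ 2 := Finset.sum_nonneg fun i _ => sq_nonneg _
      have b4 : 2 * a / m * ∑ i, pd i (cut R) x ^ 2 ≤ C * R⁻¹ ^ 2 :=
        (mul_le_of_le_one_left b3 ib.1).trans b1
      have b5 : (2 * a / m - 1) * (cut R x * lap (cut R) x) ≤ C * R⁻¹ ^ 2 := by
        refine (le_abs_self _).trans ?_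
        rw [abs_mul, abs_mul]
        have c1 : |2 * a / m - 1| ≤ 1 := abs_le.mpr ⟨by linarith [ib.2], by linarith [ib.1]⟩
        have c2 : |cut R x| ≤ 1 := by
          rw [abs_of_nonneg (cut_nonneg _ _)]; exact cut_le_one _ _
        calc _ ≤ 1 * (1 * |lap (cut R) x|) := by gcongr
          _ ≤ _ := by simpa using b2
      have b6 := mul_le_mul_of_nonneg_left (add_le_add b4 b5) (Real.rpow_nonneg (hzpos x hx').le m)
      linarith
  have iGz : IntegrableOn (fun x => ∑ i, pd i (G i) x + a * (-lap z x * z x ^ (m - 1) * cut R x ^ 2))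
    (hs n) := iG.add (iz.const_mul a)
  rw [integral_sub iφ iGz, integral_add iG (iz.const_mul a), hdiv, integral_const_mul,
    integral_const_mul] at main
  linarith

end Testing

section Reverse

variable {n : Fin N} {p : ℝ} {u : Eu N → ℝ}

theorem lap_neg (f : Eu N → ℝ) (x : Eu N) : lap (fun y => -f y) x = -lap f x := by
  simp only [lap_eq_sum_pd]
  rw [← Finset.sum_neg_distrib]
  refine Finset.sum_congr rfl fun i _ => ?_
  rw [← pd_neg]
  congr 1
  funext y
  exact pd_neg i

theorem mul_rpow_add_mul_rpow_le {a b s : ℝ} (ha : 0 < a) (hb : 0 < b) (hs : 1 ≤ s) :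
    b * a ^ (s - 1) + a * b ^ (s - 1) ≤ a ^ s + b ^ s := by
  have e1 : a ^ s = a ^ (s - 1) * a := by rw [← Real.rpow_add_one ha.ne']; congr 1; ring
  have e2 : b ^ s = b ^ (s - 1) * b := by rw [← Real.rpow_add_one hb.ne']; congr 1; ring
  rw [e1, e2]
  rcases le_total a b with hab | hab
  · have := Real.rpow_le_rpow ha.le hab (by linarith : 0 ≤ s - 1)
    nlinarith
  · have := Real.rpow_le_rpow hb.le hab (by linarith : 0 ≤ s - 1)
    nlinarith

theorem Sol.exists_weighted_inequality (h : Sol n p u) : ∃ E : ℝ, 0 < E ∧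
    ∀ (z : Eu N → ℝ) (m R : ℝ), ContDiff ℝ 2 z → (∀ x ∈ hs n, 0 < z x) →
    (∀ x : Eu N, x n = 0 → z x = 0) → 2 ≤ m → 0 < R →
    √p * ∫ x in hs n, u x ^ ((p - 1) / 2) * z x ^ m * cut R x ^ 2
      ≤ m ^ 2 / (4 * (m - 1)) * (∫ x in hs n, -lap z x * z x ^ (m - 1) * cut R x ^ 2)
        + E * R⁻¹ ^ 2 * ∫ x in hb n (2 * R), z x ^ m := by
  have hp := h.hp
  obtain ⟨E, hE, hT⟩ := exists_test_inequality (n := n)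
  refine ⟨E, hE, fun z m R hz hzpos hz0 hm hR => le_trans (le_of_eq_of_le
    (b := ∫ x in hs n, (√p * u x ^ ((p - 1) / 2)) * (z x ^ (m / 2) * cut R x) ^ 2) ?_ ?_)
    (hT z m R hz hzpos hz0 hm hR)⟩
  · rw [← integral_const_mul]
    refine setIntegral_congr_fun (isOpen_hs n).measurableSet fun x hx => ?_
    have hzx := hzpos x hx
    have e : (z x ^ (m / 2)) ^ 2 = z x ^ m := by
      rw [← Real.rpow_natCast, ← Real.rpow_mul hzx.le]; congr 1; push_cast; ring
    rw [mul_pow, e]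
    ring
  · have hφ : ContDiff ℝ 1 fun y => z y ^ (m / 2) * cut R y :=
      (contDiff_rpow_one (hz.of_le (by norm_num)) (by linarith)).mul
        ((contDiff_cut R).of_le (by exact_mod_cast le_top))
    have hφc : HasCompactSupport fun y => z y ^ (m / 2) * cut R y :=
      (hasCompactSupport_cut hR).mul_left
    refine first_order (V := fun x => √p * u x ^ ((p - 1) / 2)) (R := 2 * R)
      (continuous_const.mul (h.continuous_rpow (by linarith)))
      (fun x hx => mul_pos (Real.sqrt_pos.mpr (by linarith)) (Real.rpow_pos_of_pos (h.pos x hx) _))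
      (fun ψ hψ hψc hψ0 => ?_) hφ.continuous.continuousOn hφ.contDiffOn
      (fun x hx => mul_nonneg (Real.rpow_nonneg (hzpos x hx).le _) (cut_nonneg R x))
      (fun x hx => ?_) (fun x _ hx => ?_) fun i => ?_
    · refine le_of_eq_of_le ?_ (h.stab ψ (hψ.of_le two_le_infty) hψc hψ0)
      rw [← integral_const_mul]
      refine setIntegral_congr_fun (isOpen_hs n).measurableSet fun x hx => ?_
      have hux := h.pos x hx
      have e : (u x ^ ((p - 1) / 2)) ^ 2 = u x ^ (p - 1) := by
        rw [← Real.rpow_natCast, ← Real.rpow_mul hux.le]; congr 1; push_cast; ring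
      rw [mul_pow, mul_pow, e, Real.sq_sqrt (by linarith)]
      ring
    · rw [hz0 x hx, Real.zero_rpow (by linarith), zero_mul]
    · rw [cut_eq_zero hR hx, mul_zero]
    · obtain ⟨C, hC⟩ := (nice_of_continuous (n := n)
        (contDiff_pd (m := 0) hφ (by norm_num) i).continuous (hasCompactSupport_pd hφc i)).bdd
      exact ⟨C, hC⟩

theorem integrableOn_mul_cut_sq {f : Eu N → ℝ} (hf : Continuous f) {R : ℝ} (hR : 0 < R) :
    IntegrableOn (fun x => f x * cut R x ^ 2) (hs n) := by
  have hc : HasCompactSupport fun x : Eu N => cut R x ^ 2 :=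
    (hasCompactSupport_cut hR).mono fun x hx => by
      simp only [Function.mem_support] at hx ⊢
      intro h0
      exact hx (by rw [h0]; ring)
  exact (nice_mul_cut hf ((contDiff_cut R).continuous.pow 2) hc).integrableOn

set_option maxHeartbeats 1000000 in
theorem Sol.reverse_estimate (h : Sol n p u) (hN : 3 ≤ N) {s : ℝ} (hs2 : 2 ≤ s)
    (hsub : ((p + 1) * s / 2) ^ 2 / (4 * ((p + 1) * s / 2 - 1)) * (s ^ 2 / (4 * (s - 1))) < p) :
    ∃ C : ℝ, 0 < C ∧ ∀ R : ℝ, 0 < R →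
      ∫ x in hs n, u x ^ p * (-lap u x) ^ (s - 1) * cut R x ^ 2
        ≤ C * R⁻¹ ^ 2 * ∫ x in hb n (2 * R), (-lap u x) ^ s := by
  have hp := h.hp
  set m := (p + 1) * s / 2 with hm
  have hm2 : 2 ≤ m := by rw [hm]; nlinarith
  set a₁ := m ^ 2 / (4 * (m - 1)) with ha₁
  set a₂ := s ^ 2 / (4 * (s - 1)) with ha₂
  have ha₁0 : 0 < a₁ := div_pos (by positivity) (by linarith)
  have ha₂0 : 0 < a₂ := div_pos (by positivity) (by linarith)
  set μ := √(a₂ / a₁) with hμ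
  have hμ0 : 0 < μ := Real.sqrt_pos.mpr (by positivity)
  have hμ2 : a₁ * μ ^ 2 = a₂ := by
    rw [hμ, Real.sq_sqrt (by positivity)]; field_simp
  have hκ : a₁ * μ < √p := by
    refine Real.lt_sqrt_of_sq_lt ?_
    calc (a₁ * μ) ^ 2 = a₁ * (a₁ * μ ^ 2) := by ring
      _ < p := by rw [hμ2]; exact hsub
  obtain ⟨E, hE, hW⟩ := h.exists_weighted_inequality
  set l := √(2 / (p + 1)) with hl
  have hl0 : 0 < l := Real.sqrt_pos.mpr (div_pos two_pos (by linarith))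
  have hsou := h.le_neg_lap hN
  set v : Eu N → ℝ := fun x => -lap u x with hv
  have hv2 : ContDiff ℝ 2 v := h.contDiff_lap.neg
  have hvpos : ∀ x ∈ hs n, 0 < v x := fun x hx =>
    (mul_pos hl0 (Real.rpow_pos_of_pos (h.pos x hx) _)).trans_le (hsou x hx)
  have hv0 : ∀ x : Eu N, x n = 0 → v x = 0 := fun x hx => by simp [hv, h.bdry_lap x hx]
  have hcv : ∀ {a : ℝ}, 0 ≤ a → Continuous fun x => v x ^ a := fun ha =>
    hv2.continuous.rpow_const fun _ => Or.inr ha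
  have hcu : ∀ {a : ℝ}, 0 ≤ a → Continuous fun x => u x ^ a := fun ha => h.continuous_rpow ha
  refine ⟨(μ ^ s * (E * (l ^ s)⁻¹) + E) / ((√p - a₁ * μ) * μ), div_pos (by positivity)
    (mul_pos (by linarith) hμ0), fun R hR => ?_⟩
  have I1 := hW u m R h.contDiff_two h.pos h.bdry hm2 hR
  have I2 := hW v s R hv2 hvpos hv0 hs2 hR
  have hms := (isOpen_hs n).measurableSet
  set P := ∫ x in hs n, -lap u x * u x ^ (m - 1) * cut R x ^ 2 with hP
  set Q := ∫ x in hs n, u x ^ p * v x ^ (s - 1) * cut R x ^ 2 with hQ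
  set A := ∫ x in hs n, u x ^ ((p - 1) / 2) * u x ^ m * cut R x ^ 2 with hA
  set B := ∫ x in hs n, u x ^ ((p - 1) / 2) * v x ^ s * cut R x ^ 2 with hB
  set T := ∫ x in hb n (2 * R), v x ^ s with hT
  have hQ' : ∫ x in hs n, -lap v x * v x ^ (s - 1) * cut R x ^ 2 = Q := by
    refine setIntegral_congr_fun hms fun x hx => ?_
    rw [hv, lap_neg, neg_neg, h.eqn x hx]
  rw [hQ'] at I2
  have hT0 : 0 ≤ T := setIntegral_hb_nonneg fun x hx => Real.rpow_nonneg (hvpos x hx).le _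
  have hQ0 : 0 ≤ Q := setIntegral_nonneg hms fun x hx => mul_nonneg
    (mul_nonneg (Real.rpow_nonneg (h.pos x hx).le _) (Real.rpow_nonneg (hvpos x hx).le _))
    (sq_nonneg _)
  have hP0 : 0 ≤ P := setIntegral_nonneg hms fun x hx => mul_nonneg
    (mul_nonneg (hvpos x hx).le (Real.rpow_nonneg (h.pos x hx).le _)) (sq_nonneg _)
  have hUT : ∫ x in hb n (2 * R), u x ^ m ≤ (l ^ s)⁻¹ * T := by
    rw [hT, ← integral_const_mul]
    refine setIntegral_mono_on (integrableOn_hb (hcu (by linarith)) _ _)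
      (integrableOn_hb (continuous_const.mul (hcv (by linarith))) _ _) (measurableSet_hb _ _)
      fun x hx => ?_
    have hx' := (mem_hb.mp hx).1
    have hux := h.pos x hx'
    have e : (l * u x ^ ((p + 1) / 2)) ^ s = l ^ s * u x ^ m := by
      rw [Real.mul_rpow hl0.le (Real.rpow_nonneg hux.le _), ← Real.rpow_mul hux.le, hm]
      congr 2; ring
    have := Real.rpow_le_rpow (mul_nonneg hl0.le (Real.rpow_nonneg hux.le _)) (hsou x hx')
      (by linarith : 0 ≤ s)
    rw [e] at this
    rw [le_inv_mul_iff₀ (Real.rpow_pos_of_pos hl0 s)]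
    exact this
  have hcomb : μ ^ (s - 1) * P + μ * Q ≤ μ ^ s * A + B := by
    have i1 : IntegrableOn (fun x => -lap u x * u x ^ (m - 1) * cut R x ^ 2) (hs n) :=
      integrableOn_mul_cut_sq (hv2.continuous.mul (hcu (by linarith))) hR
    have i2 : IntegrableOn (fun x => u x ^ p * v x ^ (s - 1) * cut R x ^ 2) (hs n) :=
      integrableOn_mul_cut_sq ((hcu (by linarith)).mul (hcv (by linarith))) hR
    have i3 : IntegrableOn (fun x => u x ^ ((p - 1) / 2) * u x ^ m * cut R x ^ 2) (hs n) :=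
      integrableOn_mul_cut_sq ((hcu (by linarith)).mul (hcu (by linarith))) hR
    have i4 : IntegrableOn (fun x => u x ^ ((p - 1) / 2) * v x ^ s * cut R x ^ 2) (hs n) :=
      integrableOn_mul_cut_sq ((hcu (by linarith)).mul (hcv (by linarith))) hR
    rw [hP, hQ, hA, hB, ← integral_const_mul, ← integral_const_mul, ← integral_const_mul,
      ← integral_add (i1.const_mul _) (i2.const_mul _), ← integral_add (i3.const_mul _) i4]
    refine setIntegral_mono_on ((i1.const_mul _).add (i2.const_mul _)) ((i3.const_mul _).add i4)
      hms fun x hx => ?_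
    have hux := h.pos x hx
    have hvx := hvpos x hx
    set U := u x ^ ((p + 1) / 2) with hU
    have hU0 : 0 < U := Real.rpow_pos_of_pos hux _
    have k := mul_rpow_add_mul_rpow_le (s := s) (mul_pos hμ0 hU0) hvx (by linarith)
    rw [Real.mul_rpow hμ0.le hU0.le, Real.mul_rpow hμ0.le hU0.le] at k
    have e1 : u x ^ (m - 1) = u x ^ ((p - 1) / 2) * U ^ (s - 1) := by
      rw [hU, ← Real.rpow_mul hux.le, ← Real.rpow_add hux]; congr 1; rw [hm]; ring
    have e2 : u x ^ p = u x ^ ((p - 1) / 2) * U := by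
      rw [hU, ← Real.rpow_add hux]; congr 1; ring
    have e3 : u x ^ m = U ^ s := by
      rw [hU, ← Real.rpow_mul hux.le]; congr 1; rw [hm]; ring
    have hw : 0 ≤ u x ^ ((p - 1) / 2) * cut R x ^ 2 :=
      mul_nonneg (Real.rpow_nonneg hux.le _) (sq_nonneg _)
    have k2 := mul_le_mul_of_nonneg_left k hw
    rw [e1, e2, e3]
    have hvl : -lap u x = v x := rfl
    rw [hvl]
    linarith
  have hμs : μ ^ s = μ ^ (s - 1) * μ := by
    rw [← Real.rpow_add_one hμ0.ne']; congr 1; ring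
  have hμs0 : 0 < μ ^ s := Real.rpow_pos_of_pos hμ0 s
  have hμs1 : 0 < μ ^ (s - 1) := Real.rpow_pos_of_pos hμ0 _
  have f1 := mul_le_mul_of_nonneg_left I1 hμs0.le
  have f2 := mul_le_mul_of_nonneg_left hUT (by positivity : 0 ≤ μ ^ s * (E * R⁻¹ ^ 2))
  have f3 := mul_le_mul_of_nonneg_left hcomb (Real.sqrt_nonneg p)
  have f4 : μ ^ s * (a₁ * P) = a₁ * μ * (μ ^ (s - 1) * P) := by rw [hμs]; ring
  have f5 : a₂ * Q = a₁ * μ * (μ * Q) := by rw [← hμ2]; ring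
  have f6 : 0 ≤ (√p - a₁ * μ) * (μ ^ (s - 1) * P) :=
    mul_nonneg (by linarith) (mul_nonneg hμs1.le hP0)
  have key : (√p - a₁ * μ) * μ * Q ≤ (μ ^ s * (E * (l ^ s)⁻¹) + E) * R⁻¹ ^ 2 * T := by
    linarith
  rw [div_mul_eq_mul_div, div_mul_eq_mul_div, le_div_iff₀ (mul_pos (by linarith) hμ0)]
  linarith

end Reverse

section Gain

variable {n : Fin N} {p : ℝ} {u : Eu N → ℝ}

theorem Nice.congr {f g : Eu N → ℝ} (h : Nice n f) (hfg : ∀ x ∈ hs n, g x = f x) : Nice n g := by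
  obtain ⟨C, hC⟩ := h.bdd
  obtain ⟨R, hR⟩ := h.supp
  exact ⟨h.cont.congr hfg, ⟨C, fun x hx => by rw [hfg x hx]; exact hC x hx⟩,
    ⟨R, fun x hx hxR => by rw [hfg x hx]; exact hR x hx hxR⟩⟩

theorem Nice.of_abs_le {f g : Eu N → ℝ} (h : Nice n f) (hg : ContinuousOn g (hs n))
    (hgf : ∀ x ∈ hs n, |g x| ≤ |f x|) : Nice n g := by
  obtain ⟨C, hC⟩ := h.bdd
  obtain ⟨R, hR⟩ := h.supp
  refine ⟨hg, ⟨C, fun x hx => (hgf x hx).trans (hC x hx)⟩, ⟨R, fun x hx hxR => ?_⟩⟩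
  have := hgf x hx
  rw [hR x hx hxR, abs_zero] at this
  exact abs_nonpos_iff.mp this

theorem Sol.neg_lap_pos (h : Sol n p u) (hN : 3 ≤ N) : ∀ x ∈ hs n, 0 < -lap u x := fun x hx =>
  (mul_pos (Real.sqrt_pos.mpr (div_pos two_pos (by linarith [h.hp])))
    (Real.rpow_pos_of_pos (h.pos x hx) _)).trans_le (h.le_neg_lap hN x hx)

theorem Sol.exists_le_neg_lap_rpow (h : Sol n p u) (hN : 3 ≤ N) : ∃ K : ℝ, 0 < K ∧
    ∀ x ∈ hs n, u x ≤ K * (-lap u x) ^ (2 / (p + 1)) := by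
  have hp := h.hp
  set l := √(2 / (p + 1)) with hl
  have hl0 : 0 < l := Real.sqrt_pos.mpr (div_pos two_pos (by linarith))
  refine ⟨(l⁻¹) ^ (2 / (p + 1)), Real.rpow_pos_of_pos (inv_pos.mpr hl0) _, fun x hx => ?_⟩
  have hux := h.pos x hx
  have hvx := h.neg_lap_pos hN x hx
  rw [← Real.mul_rpow (inv_pos.mpr hl0).le hvx.le]
  have h1 : u x ^ ((p + 1) / 2) ≤ l⁻¹ * -lap u x := by
    rw [le_inv_mul_iff₀ hl0]; exact h.le_neg_lap hN x hx
  have h2 := Real.rpow_le_rpow (Real.rpow_nonneg hux.le _) h1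
    (div_nonneg zero_le_two (by linarith) : 0 ≤ 2 / (p + 1))
  rw [← Real.rpow_mul hux.le] at h2
  have e : (p + 1) / 2 * (2 / (p + 1)) = 1 := by
    have : p + 1 ≠ 0 := by linarith
    field_simp
  rwa [e, Real.rpow_one] at h2

set_option maxHeartbeats 2000000 in
theorem Sol.gain_estimate (h : Sol n p u) (hN : 3 ≤ N) {s : ℝ} (hs2 : 2 ≤ s) :
    ∃ C : ℝ, 0 < C ∧ ∀ R : ℝ, 0 < R →
      ∫ x in hb n R, (-lap u x) ^ (s + (p - 1) / (p + 1))
        ≤ C * (∫ x in hs n, u x ^ p * (-lap u x) ^ (s - 1) * cut R x ^ 2)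
          + C * R⁻¹ ^ 2 * ∫ x in hb n (2 * R), (-lap u x) ^ s := by
  have hp := h.hp
  obtain ⟨K, hK, huK⟩ := h.exists_le_neg_lap_rpow hN
  obtain ⟨C, hC, hgrad⟩ := exists_cut_grad_bound (N := N)
  have hvpos := h.neg_lap_pos hN
  have hv2 : ContDiff ℝ 2 fun x => -lap u x := h.contDiff_lap.neg
  have hvlap : ∀ x ∈ hs n, lap (fun x => -lap u x) x = -u x ^ p := fun x hx => by
    rw [lap_neg, h.eqn x hx]
  have hv0 : ∀ x : Eu N, x n = 0 → -lap u x = 0 := fun x hx => by simp [h.bdry_lap x hx]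
  have hlap : ∀ x, lap u x = - -lap u x := fun x => (neg_neg _).symm
  generalize hv : (fun x => -lap u x) = v at hv2 hvlap
  have hvx : ∀ x, -lap u x = v x := fun x => congrFun hv x
  simp only [hvx] at huK hvpos hv0 hlap ⊢
  set δ := (p - 1) / (p + 1) with hδ
  have hδ0 : 0 < δ := div_pos (by linarith) (by linarith)
  have hδ1 : 2 / (p + 1) = 1 - δ := by
    have : p + 1 ≠ 0 := by linarith
    rw [hδ]; field_simp; ring
  rw [hδ1] at huK
  have hvr : ∀ {a : ℝ}, 0 ≤ a → Continuous fun x => v x ^ a := fun ha =>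
    hv2.continuous.rpow_const fun _ => Or.inr ha
  set c₁ := s + δ - 1 with hc₁
  set c₂ := s + δ - 2 with hc₂
  have hc₁0 : 0 < c₁ := by rw [hc₁]; linarith
  have hc₂0 : 0 < c₂ := by rw [hc₂]; linarith
  have huc := h.continuous
  have hpu : ∀ i, ContDiff ℝ 1 (pd i u) := fun i => contDiff_pd h.contDiff_two (by norm_num) i
  have hpv : ∀ i, ContDiff ℝ 1 (pd i v) := fun i => contDiff_pd hv2 (by norm_num) i
  have hppu : ∀ i, Continuous (pd i (pd i u)) := fun i =>
    (contDiff_pd (m := 0) (hpu i) (by norm_num) i).continuous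
  have hppv : ∀ i, Continuous (pd i (pd i v)) := fun i =>
    (contDiff_pd (m := 0) (hpv i) (by norm_num) i).continuous
  refine ⟨max (c₁ * K) ((4 * c₁ / c₂ + 2) * K * C), lt_max_of_lt_left (by positivity),
    fun R hR => ?_⟩
  set M := max (c₁ * K) ((4 * c₁ / c₂ + 2) * K * C) with hM
  have hη2 : ContDiff ℝ 2 (cut R : Eu N → ℝ) := (contDiff_cut R).of_le two_le_infty
  set η : Eu N → ℝ := cut R with hη
  have hη1 : ContDiff ℝ 1 η := hη2.of_le (by norm_num)
  have hpη : ∀ i, ContDiff ℝ 1 (pd i η) := fun i => contDiff_pd hη2 (by norm_num) i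
  have hppη : ∀ i, Continuous (pd i (pd i η)) := fun i =>
    (contDiff_pd (m := 0) (hpη i) (by norm_num) i).continuous
  have hηR : ∀ x, 2 * R ≤ ‖x‖ → η x = 0 := fun x hx => cut_eq_zero hR hx
  have hηR' : ∀ i x, 2 * R ≤ ‖x‖ → pd i η x = 0 := fun i x hx => pd_cut_eq_zero hR hx i
  have hηR'' : ∀ i x, 2 * R ≤ ‖x‖ → pd i (pd i η) x = 0 := fun i x hx =>
    pd_pd_cut_eq_zero hR hx i i
  set D : Fin N → Eu N → ℝ := fun i y => c₁ * (v y ^ c₂ * (pd i v y * (η y * η y)))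
    + v y ^ c₁ * (2 * (η y * pd i η y)) with hD
  set F : Fin N → Eu N → ℝ := fun i y => v y ^ c₁ * (η y * η y * pd i u y) - u y * D i y with hF
  set X : Fin N → Eu N → ℝ := fun i y => (v y ^ c₁ * (η y ^ 2 * pd i (pd i u) y)
    - c₁ * (u y * v y ^ c₂ * (pd i (pd i v) y * η y ^ 2))
    - 4 * c₁ * (u y * v y ^ c₂ * (η y * pd i v y * pd i η y))
    - 2 * (u y * v y ^ c₁ * (pd i η y ^ 2 + η y * pd i (pd i η) y)))
    + (-(c₁ * c₂)) * (u y * v y ^ (c₂ - 1) * (pd i v y ^ 2 * η y ^ 2)) with hX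
  have hvc₁ := hvr hc₁0.le
  have hvc₂ := hvr hc₂0.le
  have cη := hη1.continuous
  have cpη := fun i => (hpη i).continuous
  have cpv := fun i => (hpv i).continuous
  have cpu := fun i => (hpu i).continuous
  have d : ∀ {f : Eu N → ℝ} (x : Eu N), ContDiff ℝ 1 f → DifferentiableAt ℝ f x := fun x hf =>
    hf.differentiable (by norm_num) x
  have dv : ∀ x ∈ hs n, ∀ a : ℝ, DifferentiableAt ℝ (fun y => v y ^ a) x := fun x hx a =>
    (d x (hv2.of_le (by norm_num))).rpow_const (Or.inl (hvpos x hx).ne')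
  have pv : ∀ x ∈ hs n, ∀ (a : ℝ) (i), pd i (fun y => v y ^ a) x
      = a * v x ^ (a - 1) * pd i v x := fun x hx a i =>
    pd_comp (γ := fun t => t ^ a) (d x (hv2.of_le (by norm_num)))
      (Real.hasDerivAt_rpow_const (Or.inl (hvpos x hx).ne')) i
  have hDd : ∀ x ∈ hs n, ∀ i, DifferentiableAt ℝ (D i) x := fun x hx i =>
    (((dv x hx c₂).fun_mul ((d x (hpv i)).fun_mul
      ((d x hη1).fun_mul (d x hη1)))).const_mul c₁).fun_add
      ((dv x hx c₁).fun_mul (((d x hη1).fun_mul (d x (hpη i))).const_mul 2))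
  have hFX : ∀ i, ∀ x ∈ hs n, pd i (F i) x = X i x := by
    intro i x hx
    have du := d x (h.contDiff_two.of_le (by norm_num : (1 : WithTop ℕ∞) ≤ 2))
    have dη := d x hη1
    have t1 : pd i (D i) x = c₁ * (c₂ * v x ^ (c₂ - 1) * pd i v x * (pd i v x * (η x * η x))
        + v x ^ c₂ * (pd i (pd i v) x * (η x * η x)
          + pd i v x * (pd i η x * η x + η x * pd i η x)))
        + (c₁ * v x ^ (c₁ - 1) * pd i v x * (2 * (η x * pd i η x))
          + v x ^ c₁ * (2 * (pd i η x * pd i η x + η x * pd i (pd i η) x))) := by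
      simp only [hD]
      rw [pd_add (((dv x hx c₂).fun_mul ((d x (hpv i)).fun_mul (dη.fun_mul dη))).const_mul c₁)
        ((dv x hx c₁).fun_mul ((dη.fun_mul (d x (hpη i))).const_mul 2)), pd_const_mul,
        pd_mul (dv x hx c₂) ((d x (hpv i)).fun_mul (dη.fun_mul dη)),
        pd_mul (d x (hpv i)) (dη.fun_mul dη), pd_mul dη dη,
        pd_mul (dv x hx c₁) ((dη.fun_mul (d x (hpη i))).const_mul 2), pd_const_mul,
        pd_mul dη (d x (hpη i)), pv x hx, pv x hx]
    have e1 : c₁ - 1 = c₂ := by rw [hc₁, hc₂]; ring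
    simp only [hF]
    rw [pd_sub ((dv x hx c₁).fun_mul ((dη.fun_mul dη).fun_mul (d x (hpu i))))
      (du.fun_mul (hDd x hx i)), pd_mul (dv x hx c₁) ((dη.fun_mul dη).fun_mul (d x (hpu i))),
      pd_mul (dη.fun_mul dη) (d x (hpu i)), pd_mul dη dη, pd_mul du (hDd x hx i), t1, pv x hx, e1]
    simp only [hX, hD]
    ring
  have hXn : ∀ i, Nice n (X i) := by
    intro i
    refine Nice.add ?_ (Nice.const_mul ?_ _)
    · refine nice_of_continuousOn (R := 2 * R) (Continuous.continuousOn ?_) fun x _ hx => ?_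
      · have := cpv i
        have := cpu i
        have := cpη i
        have := hppu i
        have := hppv i
        have := hppη i
        fun_prop
      · simp [hηR x hx, hηR' i x hx]
    · refine Nice.of_abs_le (f := fun y => K * (v y ^ (s - 2) * (pd i v y ^ 2 * η y ^ 2))) ?_ ?_
        fun x hx => ?_
      · refine nice_of_continuousOn (R := 2 * R) (Continuous.continuousOn ?_) fun x _ hx => ?_
        · have := cpv i
          have := hvr (by linarith : 0 ≤ s - 2)
          fun_prop
        · simp [hηR x hx]
      · refine (huc.continuousOn.mul (hv2.continuous.continuousOn.rpow_const fun x hx =>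
          Or.inl (hvpos x hx).ne')).mul (Continuous.continuousOn ?_)
        exact ((cpv i).pow 2).mul (cη.pow 2)
      · have hv' := hvpos x hx
        have k1 : u x * v x ^ (c₂ - 1) ≤ K * v x ^ (s - 2) := by
          calc _ ≤ K * v x ^ (1 - δ) * v x ^ (c₂ - 1) :=
                mul_le_mul_of_nonneg_right (huK x hx) (Real.rpow_nonneg hv'.le _)
            _ = _ := by
                rw [mul_assoc, ← Real.rpow_add hv']; congr 2; rw [hc₂]; ring
        have k0 : 0 ≤ u x * v x ^ (c₂ - 1) :=
          mul_nonneg (h.pos x hx).le (Real.rpow_nonneg hv'.le _)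
        have k2 : 0 ≤ pd i v x ^ 2 * η x ^ 2 := by positivity
        rw [abs_of_nonneg (mul_nonneg k0 k2), ← mul_assoc K,
          abs_of_nonneg (mul_nonneg (k0.trans k1) k2)]
        exact mul_le_mul_of_nonneg_right k1 k2
  have hdiv : ∫ x in hs n, ∑ i, pd i (F i) x = 0 := by
    refine integral_sum_pd_eq_zero (R := 2 * R) (fun i => Continuous.continuousOn ?_)
      (fun i x hx => ?_) (fun i x _ hx => ?_) (fun i x hx => ?_) fun i => (hXn i).congr (hFX i)
    · have := cpv i
      have := cpu i
      have := cpη i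
      fun_prop
    · simp only [hF]
      rw [h.bdry x hx, hv0 x hx, Real.zero_rpow hc₁0.ne']
      ring
    · simp [hF, hD, hηR x hx]
    · exact ((dv x hx c₁).fun_mul (((d x hη1).fun_mul (d x hη1)).fun_mul (d x (hpu i)))).fun_sub
        ((d x (h.contDiff_two.of_le (by norm_num : (1 : WithTop ℕ∞) ≤ 2))).fun_mul (hDd x hx i))
  have iX : IntegrableOn (fun x => ∑ i, pd i (F i) x) (hs n) :=
    (Nice.sum fun i _ => (hXn i).congr (hFX i)).integrableOn
  have iS : IntegrableOn (fun x => v x ^ (s + δ) * η x ^ 2) (hs n) :=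
    integrableOn_mul_cut_sq (hvr (by linarith)) hR
  have iQ : IntegrableOn (fun x => u x ^ p * v x ^ (s - 1) * η x ^ 2) (hs n) :=
    integrableOn_mul_cut_sq ((h.continuous_rpow (by linarith)).mul (hvr (by linarith))) hR
  have main : ∫ x in hs n, (v x ^ (s + δ) * η x ^ 2 + ∑ i, pd i (F i) x
      - M * (u x ^ p * v x ^ (s - 1) * η x ^ 2))
      ≤ ∫ x in hb n (2 * R), M * R⁻¹ ^ 2 * v x ^ s := by
    refine setIntegral_le_hb (continuous_const.mul (hvr (by linarith)))
      ((iS.add iX).sub (iQ.const_mul M)) (fun x hx hxR => ?_) fun x hx => ?_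
    · rw [Finset.sum_congr rfl fun i _ => hFX i x hx]
      simp [hX, hηR x hxR.le, hηR' _ x hxR.le]
    · have hx' := (mem_hb.mp hx).1
      have hv' := hvpos x hx'
      have hu' := h.pos x hx'
      obtain ⟨b1, b2⟩ := hgrad R hR x
      rw [← hη] at b1 b2
      rw [Finset.sum_congr rfl fun i _ => hFX i x hx']
      set w := v x ^ (c₂ - 1) with hw
      have hw0 : 0 < w := Real.rpow_pos_of_pos hv' _
      have w1 : v x ^ c₂ = w * v x := by
        rw [hw, ← Real.rpow_add_one hv'.ne']; congr 1; ring
      have w2 : v x ^ c₁ = w * v x ^ 2 := by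
        rw [sq, ← mul_assoc, ← w1, ← Real.rpow_add_one hv'.ne']; congr 1; rw [hc₁, hc₂]; ring
      have w3 : v x ^ (s + δ) = w * v x ^ 3 := by
        rw [pow_succ, ← mul_assoc, ← w2, ← Real.rpow_add_one hv'.ne']; congr 1; rw [hc₁]; ring
      set r := v x ^ (s - 2) with hr
      have r1 : v x ^ (s - 1) = r * v x := by
        rw [hr, ← Real.rpow_add_one hv'.ne']; congr 1; ring
      have r2 : v x ^ s = r * v x ^ 2 := by
        rw [sq, ← mul_assoc, ← r1, ← Real.rpow_add_one hv'.ne']; congr 1; ring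
      have k1 : u x * w ≤ K * r := by
        calc _ ≤ K * v x ^ (1 - δ) * w :=
              mul_le_mul_of_nonneg_right (huK x hx') hw0.le
          _ = _ := by
              rw [mul_assoc, hw, ← Real.rpow_add hv', hr]; congr 2; rw [hc₂]; ring
      have hr0 : 0 < r := Real.rpow_pos_of_pos hv' _
      have hup : 0 ≤ u x ^ p := Real.rpow_nonneg hu'.le _
      have hη0 : 0 ≤ η x := cut_nonneg R x
      have hη1' : η x ≤ 1 := cut_le_one R x
      have hXi : ∀ i, X i x ≤ w * v x ^ 2 * η x ^ 2 * pd i (pd i u) x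
          - c₁ * u x * w * v x * η x ^ 2 * pd i (pd i v) x
          + u x * w * v x ^ 2 * ((4 * c₁ / c₂) * pd i η x ^ 2 - 2 * η x * pd i (pd i η) x) := by
        intro i
        simp only [hX]
        rw [w1, w2, ← hw]
        have sq1 : 0 ≤ c₁ / c₂ * (u x * w) * (c₂ * pd i v x * η x + 2 * v x * pd i η x) ^ 2 := by
          positivity
        have sq2 : 0 ≤ u x * w * v x ^ 2 * pd i η x ^ 2 := by positivity
        have sq3 : c₁ / c₂ * (u x * w) * (c₂ * pd i v x * η x + 2 * v x * pd i η x) ^ 2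
            = c₁ * c₂ * (u x * w * (pd i v x ^ 2 * η x ^ 2))
              + 4 * c₁ * (u x * w * v x * (η x * pd i v x * pd i η x))
              + (4 * c₁ / c₂) * (u x * w * v x ^ 2 * pd i η x ^ 2) := by
          field_simp; ring
        linarith
      have hsum : ∑ i, X i x ≤ w * v x ^ 2 * η x ^ 2 * lap u x
          - c₁ * u x * w * v x * η x ^ 2 * lap v x
          + u x * w * v x ^ 2 * ((4 * c₁ / c₂) * ∑ i, pd i η x ^ 2 - 2 * η x * lap η x) := by
        refine (Finset.sum_le_sum fun i _ => hXi i).trans (le_of_eq ?_)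
        rw [Finset.sum_add_distrib, Finset.sum_sub_distrib, ← Finset.mul_sum, ← Finset.mul_sum,
          ← Finset.mul_sum, Finset.sum_sub_distrib, ← Finset.mul_sum, ← Finset.mul_sum,
          lap_eq_sum_pd, lap_eq_sum_pd, lap_eq_sum_pd]
      rw [hvlap x hx', hlap x] at hsum
      have b3 : 0 ≤ ∑ i, pd i η x ^ 2 := Finset.sum_nonneg fun i _ => sq_nonneg _
      have b4 : (4 * c₁ / c₂) * ∑ i, pd i η x ^ 2 - 2 * η x * lap η x
          ≤ (4 * c₁ / c₂ + 2) * C * R⁻¹ ^ 2 := by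
        have m1 : (4 * c₁ / c₂) * ∑ i, pd i η x ^ 2 ≤ (4 * c₁ / c₂) * (C * R⁻¹ ^ 2) :=
          mul_le_mul_of_nonneg_left b1 (by positivity)
        have m2 : -(η x * lap η x) ≤ C * R⁻¹ ^ 2 := by
          refine (neg_le_abs _).trans ?_
          rw [abs_mul, abs_of_nonneg hη0]
          exact (mul_le_of_le_one_left (abs_nonneg _) hη1').trans b2
        linarith
      have g1 : u x * w * v x ^ 2 * ((4 * c₁ / c₂) * ∑ i, pd i η x ^ 2 - 2 * η x * lap η x)
          ≤ M * R⁻¹ ^ 2 * (r * v x ^ 2) := by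
        calc _ ≤ u x * w * v x ^ 2 * ((4 * c₁ / c₂ + 2) * C * R⁻¹ ^ 2) :=
              mul_le_mul_of_nonneg_left b4 (by positivity)
          _ ≤ K * r * v x ^ 2 * ((4 * c₁ / c₂ + 2) * C * R⁻¹ ^ 2) := by gcongr
          _ = (4 * c₁ / c₂ + 2) * K * C * (R⁻¹ ^ 2 * (r * v x ^ 2)) := by ring
          _ ≤ M * (R⁻¹ ^ 2 * (r * v x ^ 2)) :=
              mul_le_mul_of_nonneg_right (le_max_right _ _) (by positivity)
          _ = _ := by ring
      have g2 : c₁ * u x * w * v x * η x ^ 2 * u x ^ p ≤ M * (u x ^ p * (r * v x) * η x ^ 2) := by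
        calc _ = c₁ * (u x * w) * (u x ^ p * v x * η x ^ 2) := by ring
          _ ≤ c₁ * (K * r) * (u x ^ p * v x * η x ^ 2) := by gcongr
          _ = c₁ * K * (u x ^ p * (r * v x) * η x ^ 2) := by ring
          _ ≤ _ := mul_le_mul_of_nonneg_right (le_max_left _ _) (by positivity)
      rw [w3, r1, r2]
      linarith
  have low : ∫ x in hb n R, v x ^ (s + δ) ≤ ∫ x in hs n, v x ^ (s + δ) * η x ^ 2 := by
    refine setIntegral_hb_le (hvr (by linarith)) iS
      (fun x hx => mul_nonneg (Real.rpow_nonneg (hvpos x hx).le _) (sq_nonneg _)) fun x hx => ?_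
    rw [hη, cut_eq_one hR (mem_hb.mp hx).2]
    simp
  have iSX : IntegrableOn (fun x => v x ^ (s + δ) * η x ^ 2 + ∑ i, pd i (F i) x) (hs n) :=
    iS.add iX
  rw [integral_sub iSX (iQ.const_mul M), integral_add iS iX, hdiv, integral_const_mul,
    integral_const_mul] at main
  linarith

end Gain

section Bootstrap

variable {n : Fin N} {p : ℝ} {u : Eu N → ℝ}

/-- Growth of the `L^s` mass of `-Δu` on half balls at the rate predicted by scaling. -/
def Growth (n : Fin N) (p : ℝ) (u : Eu N → ℝ) (s : ℝ) : Prop :=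
  ∃ C : ℝ, 0 < C ∧ ∀ R : ℝ, 1 ≤ R →
    ∫ x in hb n R, (-lap u x) ^ s ≤ C * R ^ ((N : ℝ) - 2 * (p + 1) / (p - 1) * s)

theorem Sol.growth_two (h : Sol n p u) : Growth n p u 2 := by
  obtain ⟨C, hC, hE⟩ := h.energy_ball
  refine ⟨C, hC, fun R hR => ?_⟩
  have h1 := (hE R (by linarith)).1
  have e : 2 * (p + 1) / (p - 1) * 2 = 4 * (p + 1) / (p - 1) := by ring
  rw [e]
  refine le_of_eq_of_le (integral_congr_ae (Eventually.of_forall fun x => ?_)) h1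
  simp only [Real.rpow_two, neg_sq]

theorem rpow_le_rpow_add_rpow {t a b c : ℝ} (ht : 0 < t) (hab : a ≤ b) (hbc : b ≤ c) :
    t ^ b ≤ t ^ a + t ^ c := by
  rcases le_total 1 t with h1 | h1
  · exact (Real.rpow_le_rpow_of_exponent_le h1 hbc).trans
      (le_add_of_nonneg_left (Real.rpow_nonneg ht.le _))
  · exact (Real.rpow_le_rpow_of_exponent_ge ht h1 hab).trans
      (le_add_of_nonneg_right (Real.rpow_nonneg ht.le _))

theorem Sol.continuous_neg_lap_rpow (h : Sol n p u) {a : ℝ} (ha : 0 ≤ a) :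
    Continuous fun x => (-lap u x) ^ a :=
  h.continuous_lap.neg.rpow_const fun _ => Or.inr ha

theorem Sol.growth_interpolate (h : Sol n p u) (hN : 3 ≤ N) {a b c : ℝ} (ha0 : 0 ≤ a)
    (hab : a ≤ b) (hbc : b ≤ c) (ha : Growth n p u a) (hc : Growth n p u c) :
    Growth n p u b := by
  obtain ⟨A, hA, hA'⟩ := ha
  obtain ⟨B, hB, hB'⟩ := hc
  refine ⟨A + B, by positivity, fun R hR => ?_⟩
  have hR0 : 0 < R := by linarith
  set α := 2 * (p + 1) / (p - 1) with hα
  have key : ∫ x in hb n R, (-lap u x) ^ b ≤ ∫ x in hb n R,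
      (R ^ (α * (a - b)) * (-lap u x) ^ a + R ^ (α * (c - b)) * (-lap u x) ^ c) := by
    refine setIntegral_mono_on
      (integrableOn_hb (h.continuous_neg_lap_rpow (by linarith)) _ _)
      (integrableOn_hb ((continuous_const.mul (h.continuous_neg_lap_rpow ha0)).add
        (continuous_const.mul (h.continuous_neg_lap_rpow (by linarith)))) _ _)
      (measurableSet_hb _ _) fun x hx => ?_
    have hv := h.neg_lap_pos hN x hx.1
    have e : ∀ q : ℝ, (-lap u x * R ^ α) ^ q = (-lap u x) ^ q * R ^ (α * q) := fun q => by
      rw [Real.mul_rpow hv.le (Real.rpow_nonneg hR0.le _), ← Real.rpow_mul hR0.le]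
    have k := rpow_le_rpow_add_rpow (mul_pos hv (Real.rpow_pos_of_pos hR0 α)) hab hbc
    rw [e, e, e] at k
    have e2 : ∀ q : ℝ, R ^ (α * (q - b)) * R ^ (α * b) = R ^ (α * q) := fun q => by
      rw [← Real.rpow_add hR0]; congr 1; ring
    rw [← e2 a, ← e2 c] at k
    refine le_of_mul_le_mul_right ?_ (Real.rpow_pos_of_pos hR0 (α * b))
    linarith
  refine key.trans ?_
  have i1 := (integrableOn_hb (h.continuous_neg_lap_rpow ha0) n R).const_mul (R ^ (α * (a - b)))
  have i2 := (integrableOn_hb (h.continuous_neg_lap_rpow (by linarith : 0 ≤ c)) n R).const_mul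
    (R ^ (α * (c - b)))
  rw [integral_add i1 i2, integral_const_mul, integral_const_mul]
  have e3 : ∀ q : ℝ, R ^ (α * (q - b)) * R ^ ((N : ℝ) - α * q) = R ^ ((N : ℝ) - α * b) := fun q => by
    rw [← Real.rpow_add hR0]; congr 1; ring
  have k1 := mul_le_mul_of_nonneg_left (hA' R hR) (Real.rpow_nonneg hR0.le (α * (a - b)))
  have k2 := mul_le_mul_of_nonneg_left (hB' R hR) (Real.rpow_nonneg hR0.le (α * (c - b)))
  have e4 := e3 a
  have e5 := e3 c
  calc _ ≤ R ^ (α * (a - b)) * (A * R ^ ((N : ℝ) - α * a))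
        + R ^ (α * (c - b)) * (B * R ^ ((N : ℝ) - α * c)) := add_le_add k1 k2
    _ = A * (R ^ (α * (a - b)) * R ^ ((N : ℝ) - α * a))
        + B * (R ^ (α * (c - b)) * R ^ ((N : ℝ) - α * c)) := by ring
    _ = _ := by rw [e4, e5]; ring

/-- The range of exponents for which the two test inequalities can be combined. -/
def Subcritical (p s : ℝ) : Prop :=
  ((p + 1) * s / 2) ^ 2 / (4 * ((p + 1) * s / 2 - 1)) * (s ^ 2 / (4 * (s - 1))) < p

theorem Growth.double {s : ℝ} (hg : Growth n p u s) : ∃ C : ℝ, 0 < C ∧ ∀ R : ℝ, 1 ≤ R →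
    R⁻¹ ^ 2 * ∫ x in hb n (2 * R), (-lap u x) ^ s
      ≤ C * R ^ ((N : ℝ) - 2 - 2 * (p + 1) / (p - 1) * s) := by
  obtain ⟨C, hC, hC'⟩ := hg
  set β := (N : ℝ) - 2 * (p + 1) / (p - 1) * s with hβ
  refine ⟨C * 2 ^ β, mul_pos hC (Real.rpow_pos_of_pos two_pos _), fun R hR => ?_⟩
  have hR0 : 0 < R := by linarith
  have k := mul_le_mul_of_nonneg_left (hC' (2 * R) (by linarith))
    (by positivity : (0 : ℝ) ≤ R⁻¹ ^ 2)
  refine k.trans (le_of_eq ?_)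
  have e : R ^ ((N : ℝ) - 2 - 2 * (p + 1) / (p - 1) * s) = R⁻¹ ^ 2 * R ^ β := by
    rw [show (N : ℝ) - 2 - 2 * (p + 1) / (p - 1) * s = β - (2 : ℕ) by rw [hβ]; push_cast; ring,
      Real.rpow_sub_natCast hR0.ne', inv_pow, div_eq_inv_mul]
  rw [e, Real.mul_rpow two_pos.le hR0.le]
  ring

theorem Sol.decay (h : Sol n p u) (hN : 3 ≤ N) {s : ℝ} (hs : 2 ≤ s) (hsub : Subcritical p s)
    (hg : Growth n p u s) : ∃ C : ℝ, 0 < C ∧ ∀ R : ℝ, 1 ≤ R →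
    ∫ x in HalfSpace.hs n, u x ^ p * (-lap u x) ^ (s - 1) * cut R x ^ 2
      ≤ C * R ^ ((N : ℝ) - 2 - 2 * (p + 1) / (p - 1) * s) := by
  obtain ⟨A, hA, hA'⟩ := h.reverse_estimate hN hs hsub
  obtain ⟨B, hB, hB'⟩ := hg.double
  refine ⟨A * B, by positivity, fun R hR => (hA' R (by linarith)).trans ?_⟩
  have := mul_le_mul_of_nonneg_left (hB' R hR) hA.le
  linarith

theorem Sol.growth_gain (h : Sol n p u) (hN : 3 ≤ N) {s : ℝ} (hs : 2 ≤ s) (hsub : Subcritical p s)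
    (hg : Growth n p u s) : Growth n p u (s + (p - 1) / (p + 1)) := by
  obtain ⟨A, hA, hA'⟩ := h.decay hN hs hsub hg
  obtain ⟨B, hB, hB'⟩ := hg.double
  obtain ⟨C, hC, hC'⟩ := h.gain_estimate hN hs
  refine ⟨C * A + C * B, by positivity, fun R hR => (hC' R (by linarith)).trans ?_⟩
  have k1 := mul_le_mul_of_nonneg_left (hA' R hR) hC.le
  have k2 := mul_le_mul_of_nonneg_left (hB' R hR) hC.le
  have e : (N : ℝ) - 2 * (p + 1) / (p - 1) * (s + (p - 1) / (p + 1))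
      = (N : ℝ) - 2 - 2 * (p + 1) / (p - 1) * s := by
    have h1 : p - 1 ≠ 0 := by linarith [h.hp]
    have h2 : p + 1 ≠ 0 := by linarith [h.hp]
    field_simp; ring
  rw [e]
  linarith

theorem Sol.growth (h : Sol n p u) (hN : 3 ≤ N) {s₀ : ℝ}
    (hsub : ∀ s, 2 ≤ s → s < s₀ → Subcritical p s) {s : ℝ} (hs : 2 ≤ s) (hs₀ : s < s₀) :
    Growth n p u s := by
  have hp := h.hp
  set δ := (p - 1) / (p + 1) with hδ
  have hδ0 : 0 < δ := div_pos (by linarith) (by linarith)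
  suffices H : ∀ k : ℕ, ∀ s, 2 ≤ s → s < s₀ → s ≤ 2 + k * δ → Growth n p u s by
    obtain ⟨k, hk⟩ := exists_nat_ge ((s - 2) / δ)
    rw [div_le_iff₀ hδ0] at hk
    exact H k s hs hs₀ (by linarith)
  intro k
  induction k with
  | zero =>
    intro s hs _ hk
    have : s = 2 := by simp at hk; linarith
    rw [this]; exact h.growth_two
  | succ k ih =>
    intro s hs hs₀ hk
    push_cast at hk
    rcases le_total 2 (s - δ) with h2 | h2
    · have := h.growth_gain hN h2 (hsub _ h2 (by linarith)) (ih _ h2 (by linarith) (by linarith))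
      rwa [← hδ, sub_add_cancel] at this
    · exact h.growth_interpolate hN zero_le_two hs (by linarith : s ≤ 2 + δ) h.growth_two
        (h.growth_gain hN le_rfl (hsub 2 le_rfl (by linarith)) h.growth_two)

theorem Sol.false_of_subcritical (h : Sol n p u) (hN : 3 ≤ N) {s₀ : ℝ} (hs₀ : 2 < s₀)
    (hsub : ∀ s, 2 ≤ s → s < s₀ → Subcritical p s)
    (hdim : (N : ℝ) < 2 + 2 * (p + 1) / (p - 1) * s₀) : False := by
  have hp := h.hp
  set α := 2 * (p + 1) / (p - 1) with hα
  have hα0 : 0 < α := div_pos (by linarith) (by linarith)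
  obtain ⟨s, hs, hss, hd⟩ : ∃ s, 2 ≤ s ∧ s < s₀ ∧ (N : ℝ) - 2 < α * s := by
    have h1 : ((N : ℝ) - 2) / α < s₀ := by rw [div_lt_iff₀ hα0]; linarith
    obtain ⟨s, hs1, hs2⟩ := exists_between (max_lt hs₀ h1)
    refine ⟨s, (le_max_left _ _).trans hs1.le, hs2, ?_⟩
    have := (le_max_right _ _).trans_lt hs1
    rw [div_lt_iff₀ hα0] at this
    linarith
  obtain ⟨C, hC, hC'⟩ := h.decay hN hs (hsub s hs hss) (h.growth hN hsub hs hss)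
  have hcont : Continuous fun x => u x ^ p * (-lap u x) ^ (s - 1) :=
    (h.continuous_rpow (by linarith)).mul (h.continuous_neg_lap_rpow (by linarith))
  have hpos : ∀ x ∈ HalfSpace.hs n, 0 < u x ^ p * (-lap u x) ^ (s - 1) := fun x hx =>
    mul_pos (Real.rpow_pos_of_pos (h.pos x hx) _) (Real.rpow_pos_of_pos (h.neg_lap_pos hN x hx) _)
  have hz := eq_zero_of_tendsto_hb (n := n) (C := C) (a := 2 + α * s - N) hcont
    (fun x hx => (hpos x hx).le) (by linarith) fun R hR => by
      have hR0 : 0 < R := by linarith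
      refine le_trans (setIntegral_hb_le hcont (integrableOn_mul_cut_sq hcont hR0)
        (fun x hx => mul_nonneg (hpos x hx).le (sq_nonneg _)) fun x hx => ?_)
        ((hC' R hR).trans (le_of_eq ?_))
      · rw [cut_eq_one hR0 (mem_hb.mp hx).2]; simp
      · congr 2; ring
  have hmem : (EuclideanSpace.single n (1 : ℝ) : Eu N) ∈ HalfSpace.hs n := by
    rw [mem_hs]; simp
  exact (hpos _ hmem).ne' (hz _ hmem)

theorem subcritical_iff (hp : 1 < p) {s : ℝ} (hs : 2 ≤ s) :
    Subcritical p s ↔ Hpoly p ((p + 1) * s / (p - 1)) < 0 := by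
  have h1 : 0 < p - 1 := by linarith
  have h2 : 0 < p + 1 := by linarith
  have hm : 0 < (p + 1) * s / 2 - 1 := by nlinarith
  have hs1 : 0 < s - 1 := by linarith
  have e1 : Hpoly p ((p + 1) * s / (p - 1)) = (p + 1) ^ 2 / (p - 1) ^ 4
      * ((p + 1) ^ 2 * s ^ 4 - 32 * p * ((p + 1) * s ^ 2 - (p + 3) * s + 2)) := by
    unfold Hpoly; field_simp; ring
  have e2 : ((p + 1) * s / 2) ^ 2 / (4 * ((p + 1) * s / 2 - 1)) * (s ^ 2 / (4 * (s - 1)))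
      = (p + 1) ^ 2 * s ^ 4 / 4 / (16 * (((p + 1) * s / 2 - 1) * (s - 1))) := by
    rw [div_mul_div_comm]
    congr 1 <;> ring
  rw [Subcritical, e1, e2, div_lt_iff₀ (by positivity), ← smul_eq_mul ((p + 1) ^ 2 / (p - 1) ^ 4),
    smul_neg_iff_of_pos_left (by positivity)]
  constructor <;> intro h <;> nlinarith

theorem exists_subcritical_range (hp : 1 < p) {x₀ : ℝ} (hroot : Hpoly p x₀ = 0)
    (hmax : ∀ y, Hpoly p y = 0 → y ≤ x₀) :
    2 < (p - 1) / (p + 1) * x₀ ∧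
      ∀ s, 2 ≤ s → s < (p - 1) / (p + 1) * x₀ → Subcritical p s := by
  have h1 : 0 < p - 1 := by linarith
  have h2 : 0 < p + 1 := by linarith
  set s₀ := (p - 1) / (p + 1) * x₀ with hs₀
  have hx₀ : x₀ = (p + 1) * s₀ / (p - 1) := by rw [hs₀]; field_simp
  set f : ℝ → ℝ := fun t => -(16 * (p - 1) * (3 * p + 1)) - 32 * (2 * p + 1) * (p - 1) * t
    + (24 * (p + 1) ^ 2 - 32 * p * (p + 1)) * t ^ 2 + 8 * (p + 1) ^ 2 * t ^ 3
    + (p + 1) ^ 2 * t ^ 4 with hf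
  have hH : ∀ t, Hpoly p ((p + 1) * (2 + t) / (p - 1)) = (p + 1) ^ 2 / (p - 1) ^ 4 * f t := by
    intro t
    simp only [hf]
    unfold Hpoly; field_simp; ring
  have hc : (p + 1) ^ 2 / (p - 1) ^ 4 ≠ 0 := by positivity
  have h0 : f (s₀ - 2) = 0 := by
    have := hH (s₀ - 2)
    rw [add_sub_cancel, ← hx₀, hroot] at this
    exact (mul_eq_zero.mp this.symm).resolve_left hc
  have hfc : Continuous f := by simp only [hf]; fun_prop
  have hf0 : f 0 < 0 := by
    simp only [hf]
    have : 0 < 16 * (p - 1) * (3 * p + 1) := by positivity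
    nlinarith
  have hs2 : 2 < s₀ := by
    have hT : 0 ≤ f 100 := by
      simp only [hf]
      nlinarith
    obtain ⟨t, ht, hft⟩ := intermediate_value_Icc (by norm_num : (0 : ℝ) ≤ 100) hfc.continuousOn
      ⟨hf0.le, hT⟩
    have ht0 : 0 < t := lt_of_le_of_ne ht.1 fun h => by rw [← h] at hft; exact hf0.ne hft
    have := hmax ((p + 1) * (2 + t) / (p - 1)) (by rw [hH, hft, mul_zero])
    rw [hx₀, div_le_div_iff_of_pos_right h1, mul_le_mul_iff_right₀ h2] at this
    linarith
  refine ⟨hs2, fun s hs hss => ?_⟩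
  rw [subcritical_iff hp hs, show s = 2 + (s - 2) by ring, hH]
  refine mul_neg_of_pos_of_neg (by positivity) ?_
  generalize hT : s₀ - 2 = T at h0
  generalize ht : s - 2 = t
  have ht0 : 0 ≤ t := by linarith
  have htT : t < T := by linarith
  have hT0 : 0 < T := by linarith
  have key : T ^ 2 * f t = t ^ 2 * f T - (T - t) * (16 * (p - 1) * (3 * p + 1) * (T + t)
      + 32 * (2 * p + 1) * (p - 1) * (t * T) + 8 * (p + 1) ^ 2 * (t ^ 2 * T ^ 2)
      + (p + 1) ^ 2 * (t ^ 2 * T ^ 2) * (T + t)) := by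
    simp only [hf]; ring
  rw [h0, mul_zero, zero_sub] at key
  have hTt : 0 < T - t := by linarith
  have hneg : T ^ 2 * f t < 0 := by
    rw [key]
    exact neg_neg_of_pos (by positivity)
  exact (pos_iff_neg_of_mul_neg (by simpa [mul_comm] using hneg)).mp (by positivity)

end Bootstrap

end HalfSpace

/-- If `N < 2 + 2x₀`, with `x₀` the largest real root of `H`, then there is no classical
stable solution of the Navier problem `Δ²u = u^p`, `u > 0` on the half space
`{x : x_N > 0}` with `u = Δu = 0` on the boundary hyperplane. -/
theorem no_stable_solution_half_space
    (N : ℕ) (hN : 5 ≤ N) (p : ℝ) (hp : 1 < p) (x₀ : ℝ)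
    (hroot : Hpoly p x₀ = 0) (hlargest : ∀ x : ℝ, x₀ < x → Hpoly p x ≠ 0)
    (hdim : (N : ℝ) < 2 + 2 * x₀) :
    ¬ ∃ u : EuclideanSpace ℝ (Fin N) → ℝ,
        ContDiff ℝ 4 u ∧
        (∀ x : EuclideanSpace ℝ (Fin N), 0 < x ⟨N - 1, by omega⟩ → 0 < u x) ∧
        (∀ x : EuclideanSpace ℝ (Fin N), 0 < x ⟨N - 1, by omega⟩ →
          lap (lap u) x = u x ^ p) ∧
        (∀ x : EuclideanSpace ℝ (Fin N), x ⟨N - 1, by omega⟩ = 0 →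
          u x = 0 ∧ lap u x = 0) ∧
        (∀ φ : EuclideanSpace ℝ (Fin N) → ℝ, ContDiff ℝ (⊤ : ℕ∞) φ →
          HasCompactSupport φ →
          (∀ x : EuclideanSpace ℝ (Fin N), x ⟨N - 1, by omega⟩ = 0 → φ x = 0) →
          p * ∫ x in {y : EuclideanSpace ℝ (Fin N) | 0 < y ⟨N - 1, by omega⟩},
              u x ^ (p - 1) * φ x ^ 2
            ≤ ∫ x in {y : EuclideanSpace ℝ (Fin N) | 0 < y ⟨N - 1, by omega⟩},
                (lap φ x) ^ 2) := by
  rintro ⟨u, hu, hpos, heqn, hbdry, hstab⟩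
  set n : Fin N := ⟨N - 1, by omega⟩ with hn
  have hsol : HalfSpace.Sol n p u :=
    { hp := hp
      smooth := hu
      pos := hpos
      eqn := heqn
      bdry := fun x hx => (hbdry x hx).1
      bdry_lap := fun x hx => (hbdry x hx).2
      stab := fun φ hφ hc h0 => HalfSpace.stability_extend
        (hu.continuous.rpow_const fun _ => Or.inr (by linarith)) hstab hφ hc h0 }
  obtain ⟨hs₀, hsub⟩ := HalfSpace.exists_subcritical_range hp hroot fun y hy =>
    not_lt.mp fun hlt => hlargest y hlt hy
  refine hsol.false_of_subcritical (by omega) hs₀ hsub ?_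
  have h1 : p - 1 ≠ 0 := by linarith
  have h2 : p + 1 ≠ 0 := by linarith
  have e : 2 * (p + 1) / (p - 1) * ((p - 1) / (p + 1) * x₀) = 2 * x₀ := by
    field_simp
  rw [e]
  exact hdim
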